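/- Let η ∈ {1,2} and let q, r, s be primes with q ≡ 3 (mod 4), r ≡ s ≡ 5 (mod 8), Legendre symbols (q/r) = (q/s) = (−1)^{δ_{η,2}} and (r/s) = 1, and suppose the negative Pell equation x² − rs·y² = −1 has no integer solutions. Assume the non-square condition, and let m be the integer with h₂(ηqrs) = 2^{m+1}. Then for every integer n ≥ 0, the 2-Sylow subgroup of the ideal class group of the n-th layer F_n of the cyclotomic ℤ₂-extension of F = ℚ(√(ηqrs)) is isomorphic to ℤ/2ℤ × ℤ/2^mℤ; in particular A(F) ≅ ℤ/2ℤ × ℤ/2^mℤ. -/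

import Mathlib

open IntermediateField NumberField

/-- The `n`-th layer `k(2·cos(2π/2^(n+2)))` of the cyclotomic `ℤ₂`-extension of a
(totally real) subfield of `ℝ`. -/
noncomputable def layer (F : IntermediateField ℚ ℝ) (n : ℕ) : IntermediateField ℚ ℝ :=
  F ⊔ IntermediateField.adjoin ℚ {2 * Real.cos (2 * Real.pi / 2 ^ (n + 2))}

/-- The 2-part of the class number of a subfield of `ℝ` (the largest power of 2 dividing
the cardinality of the class group of its ring of integers). -/
noncomputable def h2 (F : IntermediateField ℚ ℝ) : ℕ :=
  2 ^ ((Nat.card (ClassGroup (NumberField.RingOfIntegers F))).factorization 2)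

section

theorem amb_count {M I : Type*} [CommGroup M] [CommGroup I] (σ : M →* M) (τ : I →* I) (δ : M →* I)
    (hσ : ∀ x, σ (σ x) = x) (hτ : ∀ x, τ (τ x) = x) (hδ : ∀ x, δ (σ x) = τ (δ x))
    (h90 : ∀ y, y * σ y = 1 → ∃ z, y = z / σ z)
    (S Fix T : Subgroup I) (MK E Ep Em : Subgroup M)
    (hFix : ∀ i, i ∈ Fix ↔ τ i = i) (hMK : ∀ x, x ∈ MK ↔ σ x = x)
    (hE : ∀ x, x ∈ E ↔ δ x = 1)
    (hEp : ∀ x, x ∈ Ep ↔ δ x = 1 ∧ σ x = x)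
    (hEm : ∀ x, x ∈ Em ↔ δ x = 1 ∧ x * σ x = 1)
    (hT : ∀ i, i ∈ T ↔ ∃ x, δ x = i / τ i)
    (hS : S ≤ Fix) (hS2 : S.relIndex Fix ≤ 2)
    (h : ℕ) (hMS : MK.map δ ≤ S) (hh : (MK.map δ).relIndex S ≤ h)
    (hu0 : (Ep.map (powMonoidHom 2)).relIndex Ep ≠ 0)
    (huv : 2 * (Ep.map (powMonoidHom 2)).relIndex Ep ≤ (Em.map (powMonoidHom 2)).relIndex Em) :
    δ.range.relIndex T ≤ h := by
  let nm : M →* M := MonoidHom.id M * σ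
  let df : M →* M := MonoidHom.id M / σ
  have hnm : ∀ x, nm x = x * σ x := fun x => rfl
  have hdf : ∀ x, df x = x / σ x := fun x => rfl
  set NE := E.map nm with hNE
  set DE := E.map df with hDE
  -- step 3
  have h3a : (Ep.map (powMonoidHom 2)).comap nm ⊓ E = Ep ⊔ Em := by
    ext e
    simp only [Subgroup.mem_inf, Subgroup.mem_comap, Subgroup.mem_map, Subgroup.mem_sup, hnm,
      powMonoidHom_apply, hE]
    constructor
    · rintro ⟨⟨p, hp, hpe⟩, he⟩
      refine ⟨p, hp, e / p, ?_, by simp⟩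
      rw [hEp] at hp
      rw [hEm]
      refine ⟨by simp [he, hp.1], ?_⟩
      rw [map_div, hp.2, div_mul_div_comm, ← hpe, sq, div_self']
    · rintro ⟨p, hp, m, hm, rfl⟩
      have hp' := (hEp _).1 hp
      have hm' := (hEm _).1 hm
      refine ⟨⟨p, hp, ?_⟩, by simp [hp'.1, hm'.1]⟩
      rw [map_mul, hp'.2, mul_mul_mul_comm, hm'.2, mul_one, sq]
  have h3b : (Em.map (powMonoidHom 2)).comap df ⊓ E = Ep ⊔ Em := by
    ext e
    simp only [Subgroup.mem_inf, Subgroup.mem_comap, Subgroup.mem_map, Subgroup.mem_sup, hdf,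
      powMonoidHom_apply, hE]
    constructor
    · rintro ⟨⟨m, hm, hpe⟩, he⟩
      refine ⟨e / m, ?_, m, hm, by simp⟩
      rw [hEm] at hm
      rw [hEp]
      refine ⟨by simp [he, hm.1], ?_⟩
      have h1 : σ m = m⁻¹ := (inv_eq_of_mul_eq_one_right hm.2).symm
      have h2 : σ e = e / m ^ 2 := by rw [hpe]; simp
      rw [map_div, h1, h2, sq]; 
      rw [div_inv_eq_mul, div_mul_eq_div_div, div_mul_cancel]
    · rintro ⟨p, hp, m, hm, rfl⟩
      have hp' := (hEp _).1 hp
      have hm' := (hEm _).1 hm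
      have h1 : σ m = m⁻¹ := (inv_eq_of_mul_eq_one_right hm'.2).symm
      refine ⟨⟨m, hm, ?_⟩, by simp [hp'.1, hm'.1]⟩
      rw [map_mul, hp'.2, h1, sq, mul_div_mul_left_eq_div, div_inv_eq_mul]
  have t1 : (Ep ⊔ Em).relIndex E = (Ep.map (powMonoidHom 2)).relIndex NE := by
    rw [← h3a, Subgroup.inf_relIndex_right, Subgroup.relIndex_comap]
  have t2 : (Ep ⊔ Em).relIndex E = (Em.map (powMonoidHom 2)).relIndex DE := by
    rw [← h3b, Subgroup.inf_relIndex_right, Subgroup.relIndex_comap]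
  have l1 : Ep.map (powMonoidHom 2) ≤ NE := by
    rintro _ ⟨p, hp, rfl⟩
    have hp' := (hEp _).1 hp
    exact ⟨p, (hE _).2 hp'.1, by rw [hnm, hp'.2, powMonoidHom_apply, sq]⟩
  have l2 : NE ≤ Ep := by
    rintro _ ⟨e, he, rfl⟩
    have he' := (hE _).1 he
    rw [hEp, hnm]
    refine ⟨by simp [hδ, he'], by rw [map_mul, hσ, mul_comm]⟩
  have l3 : Em.map (powMonoidHom 2) ≤ DE := by
    rintro _ ⟨p, hp, rfl⟩
    have hp' := (hEm _).1 hp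
    have h1 : σ p = p⁻¹ := (inv_eq_of_mul_eq_one_right hp'.2).symm
    exact ⟨p, (hE _).2 hp'.1, by rw [hdf, h1, powMonoidHom_apply, sq, div_inv_eq_mul]⟩
  have l4 : DE ≤ Em := by
    rintro _ ⟨e, he, rfl⟩
    have he' := (hE _).1 he
    rw [hEm, hdf]
    refine ⟨by simp [hδ, he'], by rw [map_div, hσ]; simp⟩
  have u1 := Subgroup.relIndex_mul_relIndex _ _ _ l1 l2
  have u2 := Subgroup.relIndex_mul_relIndex _ _ _ l3 l4
  -- step 2
  have s2 : (MK.map δ).comap δ = DE.comap df := by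
    ext x
    simp only [Subgroup.mem_comap, Subgroup.mem_map, hdf, hDE]
    constructor
    · rintro ⟨k, hk, hkx⟩
      refine ⟨x / k, (hE _).2 (by simp [hkx]), ?_⟩
      rw [map_div, (hMK _).1 hk]; simp
    · rintro ⟨e, he, hex⟩
      refine ⟨x / e, (hMK _).2 ?_, by simp [(hE _).1 he]⟩
      rw [map_div]
      rw [div_eq_div_iff_mul_eq_mul] at hex ⊢
      rw [mul_comm _ e, mul_comm _ (σ e), mul_comm (σ e)]; exact hex
  have s2a : (Fix.comap δ).map δ = Fix ⊓ δ.range := by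
    rw [Subgroup.map_comap_eq, inf_comm]
  have s2b : (Fix.comap δ).map df = Em := by
    ext y
    simp only [Subgroup.mem_comap, Subgroup.mem_map, hdf, hEm, hFix]
    constructor
    · rintro ⟨x, hx, rfl⟩
      refine ⟨by rw [map_div, hδ, hx, div_self'], by rw [map_div, hσ]; simp⟩
    · rintro ⟨hy1, hy2⟩
      obtain ⟨z, rfl⟩ := h90 y hy2
      refine ⟨z, ?_, rfl⟩
      rw [map_div, hδ, div_eq_one] at hy1
      exact hy1.symm
  have e2 : (MK.map δ).relIndex (Fix ⊓ δ.range) = DE.relIndex Em := by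
    rw [← s2a, ← Subgroup.relIndex_comap, s2, Subgroup.relIndex_comap, s2b]
  -- step 1
  let p2 : I × M →* M := nm.comp (MonoidHom.snd I M)
  let G : Subgroup (I × M) :=
    ((MonoidHom.id I / τ).comp (MonoidHom.fst I M)).eqLocus (δ.comp (MonoidHom.snd I M))
  have hG : ∀ i x, (i, x) ∈ G ↔ i / τ i = δ x := fun i x => Iff.rfl
  have g1 : G.map (MonoidHom.fst I M) = T := by
    ext i
    rw [hT]
    constructor
    · rintro ⟨⟨j, x⟩, hx, rfl⟩
      exact ⟨x, ((hG _ _).1 hx).symm⟩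
    · rintro ⟨x, hx⟩
      exact ⟨(i, x), (hG _ _).2 hx.symm, rfl⟩
  have g2 : G.map p2 ≤ Ep := by
    rintro _ ⟨⟨j, x⟩, hx, rfl⟩
    have hx' := (hG _ _).1 hx
    rw [hEp]
    change δ (x * σ x) = 1 ∧ σ (x * σ x) = x * σ x
    refine ⟨by rw [map_mul, hδ, ← hx', map_div, hτ]; simp, by rw [map_mul, hσ, mul_comm]⟩
  have g3 : (Fix ⊔ δ.range).comap (MonoidHom.fst I M) ⊓ G = NE.comap p2 ⊓ G := by
    ext ⟨i, x⟩
    simp only [Subgroup.mem_inf, Subgroup.mem_comap, hG]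
    change (i ∈ Fix ⊔ δ.range ∧ _) ↔ (x * σ x ∈ NE ∧ _)
    refine and_congr_left fun hx => ?_
    rw [Subgroup.mem_sup]
    constructor
    · rintro ⟨f, hf, _, ⟨b, rfl⟩, rfl⟩
      rw [hFix] at hf
      refine ⟨x / (b / σ b), (hE _).2 ?_, ?_⟩
      · rw [map_div, map_div, hδ, ← hx, map_mul, hf]; simp
      · rw [hnm]; simp only [map_div, hσ]
        rw [div_mul_div_comm, div_mul_div_cancel, div_self', div_one]
    · rintro ⟨e, he, hex⟩
      rw [hnm] at hex
      replace he := (hE _).1 he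
      obtain ⟨b, hb⟩ := h90 (x / e) (by rw [map_div, div_mul_div_comm, hex, div_self'])
      refine ⟨i / δ b, ?_, δ b, ⟨b, rfl⟩, by simp⟩
      rw [hFix, map_div, ← hδ]
      have : i / τ i = δ b / δ (σ b) := by
        rw [hx, ← map_div, ← hb, map_div, he, div_one]
      rw [div_eq_div_iff_mul_eq_mul] at this ⊢
      rw [mul_comm, ← this, mul_comm]
  have e1 : (Fix ⊔ δ.range).relIndex T ≤ NE.relIndex Ep := by
    rw [← g1, ← Subgroup.relIndex_comap, ← Subgroup.inf_relIndex_right, g3,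
      Subgroup.inf_relIndex_right, Subgroup.relIndex_comap]
    refine Subgroup.relIndex_le_of_le_right g2 ?_
    intro h0
    rw [h0, mul_zero] at u1
    exact hu0 u1.symm
  have hW : Fix ⊔ δ.range ≤ T := by
    refine sup_le (fun i hi => (hT _).2 ⟨1, ?_⟩) ?_
    · rw [(hFix _).1 hi]; simp
    · rintro _ ⟨x, rfl⟩
      exact (hT _).2 ⟨x / σ x, by rw [map_div, hδ]⟩
  have c1 := Subgroup.relIndex_mul_relIndex δ.range _ _ le_sup_right hW
  have c2 : δ.range.relIndex (Fix ⊔ δ.range) = (Fix ⊓ δ.range).relIndex Fix := by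
    rw [sup_comm, Subgroup.relIndex_sup_left, inf_comm, Subgroup.inf_relIndex_right]
  have hMF : MK.map δ ≤ Fix ⊓ δ.range := by
    refine le_inf (hMS.trans hS) ?_
    rintro _ ⟨x, _, rfl⟩; exact ⟨x, rfl⟩
  have c3 := Subgroup.relIndex_mul_relIndex _ _ _ hMF inf_le_left
  have c4 := Subgroup.relIndex_mul_relIndex _ _ _ hMS hS
  rw [← c1, c2]
  rw [e2] at c3
  rw [← t1] at u1
  rw [← t2] at u2
  set a := (Fix ⊓ δ.range).relIndex Fix
  set t := (Ep ⊔ Em).relIndex E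
  set x := NE.relIndex Ep
  set y := DE.relIndex Em
  set w := (Fix ⊔ δ.range).relIndex T
  have ht : 0 < t := by
    rcases Nat.eq_zero_or_pos t with h0 | h0
    · rw [h0, zero_mul] at u1; exact absurd u1.symm hu0
    · exact h0
  have hxy : 2 * x ≤ y := by
    rw [← u1, ← u2] at huv
    have : t * (2 * x) ≤ t * y := by linarith
    exact Nat.le_of_mul_le_mul_left this ht
  have : 2 * (a * w) ≤ 2 * h := calc
    2 * (a * w) ≤ 2 * (a * x) := by gcongr
    _ = (2 * x) * a := by ring
    _ ≤ y * a := by gcongr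
    _ = _ := c3
    _ = _ := c4.symm
    _ ≤ h * 2 := by gcongr
    _ = 2 * h := by ring
  omega

end

section

open NumberField Module

theorem index_two_nsmul {V : Type*} [AddCommGroup V] [Module.Finite ℤ V] (z : V) (hz : z ≠ 0)
    (h2 : z + z = 0) (hsq : ∀ v : V, v + v ≠ z)
    (ht : ∀ v : V, ∀ n : ℕ, 0 < n → n • v = 0 → v = 0 ∨ v = z) :
    (nsmulAddMonoidHom (α := V) 2).range.index = 2 ^ (finrank ℤ V + 1) := by
  set T : Submodule ℤ V := Submodule.torsion ℤ V with hT
  have hTm : ∀ v, v ∈ T ↔ v = 0 ∨ v = z := by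
    intro v
    constructor
    · intro hv
      rw [hT, Submodule.mem_torsion_iff] at hv
      obtain ⟨a, ha⟩ := hv
      have ha0 : (a : ℤ) ≠ 0 := nonZeroDivisors.coe_ne_zero a
      refine ht v (a : ℤ).natAbs (Int.natAbs_pos.2 ha0) ?_
      have h1 : (a : ℤ) • v = 0 := ha
      rw [← natCast_zsmul]
      rcases Int.natAbs_eq (a : ℤ) with h | h
      · rw [h] at h1; simpa using h1
      · rw [h, neg_smul, neg_eq_zero] at h1; simpa using h1
    · intro hv
      rw [hT, Submodule.mem_torsion_iff]
      refine ⟨⟨2, by simp⟩, ?_⟩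
      change (2 : ℤ) • v = 0
      rcases hv with rfl | rfl
      · simp
      · rw [two_smul, h2]
  have hfr : finrank ℤ (V ⧸ T) = finrank ℤ V := finrank_quotient_eq_of_le_torsion le_rfl
  have i1 := AddSubgroup.index_range_nsmul (V ⧸ T) 2
  rw [hfr] at i1
  have key : (nsmulAddMonoidHom (α := V ⧸ T) 2).range.comap (Submodule.mkQ T).toAddMonoidHom
      = (nsmulAddMonoidHom (α := V) 2).range ⊔ T.toAddSubgroup := by
    ext v
    rw [AddSubgroup.mem_comap, AddSubgroup.mem_sup]
    constructor
    · rintro ⟨w, hw⟩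
      obtain ⟨w, rfl⟩ := Submodule.mkQ_surjective T w
      refine ⟨2 • w, ⟨w, rfl⟩, v - 2 • w, ?_, by abel⟩
      have : T.mkQ (v - 2 • w) = 0 := by
        rw [map_sub, sub_eq_zero, map_nsmul]; exact hw.symm
      rw [Submodule.mkQ_apply, Submodule.Quotient.mk_eq_zero] at this
      exact this
    · rintro ⟨_, ⟨w, rfl⟩, t, ht, rfl⟩
      refine ⟨T.mkQ w, ?_⟩
      have : T.mkQ t = 0 := by
        rw [Submodule.mkQ_apply, Submodule.Quotient.mk_eq_zero]; exact ht
      change 2 • T.mkQ w = T.mkQ (2 • w + t)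
      rw [map_add, this, map_nsmul, add_zero]
  have i2 := AddSubgroup.index_comap_of_surjective (nsmulAddMonoidHom (α := V ⧸ T) 2).range
    (f := (Submodule.mkQ T).toAddMonoidHom) (Submodule.mkQ_surjective T)
  rw [key, i1] at i2
  have i3 := AddSubgroup.relIndex_mul_index
    (show (nsmulAddMonoidHom (α := V) 2).range ≤
      (nsmulAddMonoidHom (α := V) 2).range ⊔ T.toAddSubgroup from le_sup_left)
  have i4 : (nsmulAddMonoidHom (α := V) 2).range.relIndex
      ((nsmulAddMonoidHom (α := V) 2).range ⊔ T.toAddSubgroup) = 2 := by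
    rw [AddSubgroup.relIndex_sup_left, ← AddSubgroup.inf_relIndex_right]
    have : (nsmulAddMonoidHom (α := V) 2).range ⊓ T.toAddSubgroup = ⊥ := by
      rw [eq_bot_iff]
      rintro _ ⟨⟨w, rfl⟩, ht⟩
      have ht' := (hTm _).1 ht
      rw [AddSubgroup.mem_bot]
      rcases ht' with h | h
      · exact h
      · exfalso
        refine hsq w ?_
        rw [← h]; exact (two_smul ℕ w).symm
    rw [this, AddSubgroup.relIndex_bot_left]
    have : (T.toAddSubgroup : Set V) = {0, z} := by
      ext v; exact hTm v
    change Nat.card (T.toAddSubgroup : Set V) = 2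
    rw [this, Nat.card_coe_set_eq, Set.ncard_pair hz.symm]
  rw [← i3, i4, i2, pow_succ, mul_comm]

/-- The same for multiplicative groups. -/
theorem index_sq {A : Type*} [CommGroup A] [Module.Finite ℤ (Additive A)] (z : A) (hz : z ≠ 1)
    (h2 : z * z = 1) (hsq : ∀ v : A, v * v ≠ z)
    (ht : ∀ v : A, ∀ n : ℕ, 0 < n → v ^ n = 1 → v = 1 ∨ v = z) :
    (powMonoidHom (α := A) 2).range.index = 2 ^ (finrank ℤ (Additive A) + 1) := by
  rw [← index_two_nsmul (V := Additive A) (Additive.ofMul z) hz h2 hsq ht]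
  exact (Subgroup.index_toAddSubgroup (H := (powMonoidHom (α := A) 2).range)).symm

theorem index_sq_subgroup {A : Type*} [CommGroup A] (H : Subgroup A)
    [Module.Finite ℤ (Additive H)] (z : A) (hzH : z ∈ H) (hz : z ≠ 1)
    (h2 : z * z = 1) (hsq : ∀ v : A, v * v ≠ z)
    (ht : ∀ v : A, ∀ n : ℕ, 0 < n → v ^ n = 1 → v = 1 ∨ v = z) :
    (H.map (powMonoidHom 2)).relIndex H = 2 ^ (finrank ℤ (Additive H) + 1) := by
  have := index_sq (A := H) ⟨z, hzH⟩ (fun h => hz (congrArg Subtype.val h)) (Subtype.ext h2)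
    (fun v h => hsq v (congrArg Subtype.val h)) (by
      intro v n hn hv
      rcases ht v n hn (by simpa using congrArg Subtype.val hv) with h | h
      · left; exact Subtype.ext h
      · right; exact Subtype.ext h)
  rw [← this]
  rw [Subgroup.relIndex]
  congr 1
  ext v
  rw [Subgroup.mem_subgroupOf]
  constructor
  · rintro ⟨w, hw, h⟩
    exact ⟨⟨w, hw⟩, Subtype.ext h⟩
  · rintro ⟨w, h⟩
    exact ⟨w, w.2, congrArg Subtype.val h⟩

section quad
variable {K L : Type*} [Field K] [Field L] [CharZero L] [Algebra K L]

theorem quad_repr (h2 : finrank K L = 2) (σ : L ≃ₐ[K] L) (x : L) (hx : x ≠ 0) (hσ : σ x = -x)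
    (y : L) : ∃ a b : K, y = algebraMap K L a + algebraMap K L b * x := by
  have : FiniteDimensional K L := FiniteDimensional.of_finrank_pos (by omega)
  have hli : LinearIndependent K ![(1 : L), x] := by
    rw [LinearIndependent.pair_iff]
    intro a b hab
    have h1 := congrArg σ hab
    rw [map_add, Algebra.smul_def, Algebra.smul_def, map_mul, map_mul, AlgEquiv.commutes, AlgEquiv.commutes, hσ, map_one, map_zero, mul_neg, ← Algebra.smul_def, ← Algebra.smul_def] at h1
    have h3 : b • x + b • x = 0 := by
      have : (a • (1:L) + b • x) - (a • (1:L) + -(b • x)) = 0 := by rw [hab, h1, sub_zero]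
      rw [← this]; abel
    have hb : b = 0 := by
      rw [← two_nsmul, smul_eq_zero, smul_eq_zero] at h3
      rcases h3 with h | h | h
      · omega
      · exact h
      · exact absurd h hx
    rw [hb, zero_smul, add_zero] at hab
    refine ⟨?_, hb⟩
    rcases smul_eq_zero.1 hab with h | h
    · exact h
    · exact absurd h one_ne_zero
  have : y ∈ Submodule.span K (Set.range ![(1 : L), x]) := by
    rw [hli.span_eq_top_of_card_eq_finrank' (by simp [h2])]; trivial
  rw [Matrix.range_cons, Matrix.range_cons, Matrix.range_empty, Set.union_empty,
    Set.singleton_union, Submodule.mem_span_pair] at this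
  obtain ⟨a, b, h⟩ := this
  exact ⟨a, b, by rw [← h, Algebra.smul_def, Algebra.smul_def, mul_one]⟩

theorem quad_inv (h2 : finrank K L = 2) (σ : L ≃ₐ[K] L) (x : L) (hx : x ≠ 0) (hσ : σ x = -x)
    (y : L) : σ (σ y) = y := by
  obtain ⟨a, b, rfl⟩ := quad_repr h2 σ x hx hσ y
  simp [hσ]

theorem quad_fix (h2 : finrank K L = 2) (σ : L ≃ₐ[K] L) (x : L) (hx : x ≠ 0) (hσ : σ x = -x)
    (y : L) (hy : σ y = y) : ∃ a : K, y = algebraMap K L a := by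
  obtain ⟨a, b, rfl⟩ := quad_repr h2 σ x hx hσ y
  refine ⟨a, ?_⟩
  simp only [map_add, map_mul, AlgEquiv.commutes, hσ] at hy
  have : 2 * (algebraMap K L b * x) = 0 := by linear_combination -hy
  rw [mul_eq_zero] at this
  rcases this with h | h
  · exact absurd h two_ne_zero
  · rw [h, add_zero]

theorem quad_norm (h2 : finrank K L = 2) (σ : L ≃ₐ[K] L) (x : L) (hx : x ≠ 0) (hσ : σ x = -x)
    (y : L) : algebraMap K L (Algebra.norm K y) = y * σ y := by
  have : FiniteDimensional K L := FiniteDimensional.of_finrank_pos (by omega)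
  have hx1 : x * x ∈ Set.range (algebraMap K L) := by
    obtain ⟨a, h⟩ := quad_fix h2 σ x hx hσ (x * x) (by simp [hσ])
    exact ⟨a, h.symm⟩
  obtain ⟨c, hc⟩ := hx1
  classical
  have hG : IsGalois K L := by
    refine IsGalois.of_card_aut_eq_finrank K L ?_
    have h1 : (1 : L ≃ₐ[K] L) ≠ σ := by
      intro h
      have : x = -x := by rw [← hσ, ← h]; rfl
      exact hx (self_eq_neg.1 this)
    have h3 : Nat.card (L ≃ₐ[K] L) ≤ finrank K L := by
      rw [Nat.card_eq_fintype_card]; exact AlgEquiv.card_le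
    have : Nat.card ({1, σ} : Set (L ≃ₐ[K] L)) ≤ Nat.card (L ≃ₐ[K] L) :=
      Nat.card_le_card_of_injective _ Subtype.val_injective
    rw [Nat.card_coe_set_eq, Set.ncard_pair h1] at this
    omega
  rw [Algebra.norm_eq_prod_automorphisms]
  have h1 : (1 : L ≃ₐ[K] L) ≠ σ := by
    intro h
    have : x = -x := by rw [← hσ, ← h]; rfl
    exact hx (self_eq_neg.1 this)
  have hu : (Finset.univ : Finset (L ≃ₐ[K] L)) = {1, σ} := by
    symm
    rw [← Finset.card_eq_iff_eq_univ, Finset.card_pair h1, ← Nat.card_eq_fintype_card,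
      IsGalois.card_aut_eq_finrank, h2]
  rw [hu, Finset.prod_pair h1]; rfl

theorem quad_h90 (σ : L ≃ₐ[K] L) (x : L) (hx : x ≠ 0) (hσ : σ x = -x)
    (y : L) (hy : y * σ y = 1) : ∃ z : L, z ≠ 0 ∧ y = z / σ z := by
  by_cases h : y = -1
  · exact ⟨x, hx, by rw [h, hσ, div_neg, div_self hx]⟩
  · have h1 : 1 + y ≠ 0 := fun h' => h (by linear_combination h')
    refine ⟨1 + y, h1, ?_⟩
    have h3 : σ (1 + y) ≠ 0 := (map_ne_zero σ).2 h1
    rw [eq_div_iff h3, map_add, map_one]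
    linear_combination hy

end quad

theorem unit_indices {K L : Type*} [Field K] [Field L] [NumberField K] [NumberField L]
    [Algebra K L] [IsTotallyReal K] [IsTotallyReal L] (φ : L →+* ℝ)
    (h2 : finrank K L = 2) (σ : L ≃ₐ[K] L) (x : L) (hx : x ≠ 0) (hσ : σ x = -x)
    (Ep Em : Subgroup Lˣ)
    (hEp : ∀ y, y ∈ Ep ↔ (∃ u : (𝓞 L)ˣ, (y : L) = (u : 𝓞 L)) ∧ σ y = y)
    (hEm : ∀ y, y ∈ Em ↔ (∃ u : (𝓞 L)ˣ, (y : L) = (u : 𝓞 L)) ∧ y * σ y = (1 : L)) :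
    (Ep.map (powMonoidHom 2)).relIndex Ep ≠ 0 ∧
    2 * (Ep.map (powMonoidHom 2)).relIndex Ep ≤ (Em.map (powMonoidHom 2)).relIndex Em := by
  have hz : (-1 : Lˣ) ≠ 1 := by
    intro h
    have := congrArg Units.val h
    simp only [Units.val_neg, Units.val_one] at this
    norm_num at this
  have hsq : ∀ v : Lˣ, v * v ≠ -1 := by
    intro v h
    have := congrArg (fun u : Lˣ => φ u) h
    simp only [Units.val_mul, map_mul, Units.val_neg, map_neg, Units.val_one, map_one] at this
    nlinarith [mul_self_nonneg (φ v)]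
  have ht : ∀ v : Lˣ, ∀ n : ℕ, 0 < n → v ^ n = 1 → v = 1 ∨ v = -1 := by
    intro v n hn hv
    have := congrArg (fun u : Lˣ => φ u) hv
    simp only [Units.val_pow_eq_pow_val, map_pow, Units.val_one, map_one] at this
    have h1 : |φ v| = 1 := by
      rw [← pow_eq_one_iff_of_nonneg (abs_nonneg _) hn.ne', ← abs_pow, this, abs_one]
    rcases (abs_eq zero_le_one).1 h1 with h | h
    · left; ext; apply φ.injective; simpa using h
    · right; ext; apply φ.injective; simpa using h
  -- the unit groups
  let jL : (𝓞 L)ˣ →* Lˣ := Units.map (algebraMap (𝓞 L) L).toMonoidHom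
  let jK : (𝓞 K)ˣ →* Lˣ := Units.map (algebraMap (𝓞 K) L).toMonoidHom
  have jL_inj : Function.Injective jL := Units.map_injective (RingOfIntegers.coe_injective)
  have jK_inj : Function.Injective jK := Units.map_injective (FaithfulSMul.algebraMap_injective _ _)
  have hEpr : Ep = jK.range := by
    ext y
    rw [hEp]
    constructor
    · rintro ⟨⟨u, hu⟩, hy⟩
      obtain ⟨a, ha⟩ := quad_fix h2 σ x hx hσ y hy
      have hInteg : IsIntegral ℤ a := by
        rw [← isIntegral_algebraMap_iff (FaithfulSMul.algebraMap_injective K L), ← ha, hu]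
        exact RingOfIntegers.isIntegral_coe _
      have hInteg' : IsIntegral ℤ a⁻¹ := by
        rw [← isIntegral_algebraMap_iff (FaithfulSMul.algebraMap_injective K L), map_inv₀, ← ha, hu]
        have : ((u : 𝓞 L) : L)⁻¹ = ((u⁻¹ : (𝓞 L)ˣ) : 𝓞 L) := by
          refine inv_eq_of_mul_eq_one_right ?_
          rw [← map_mul]; simp
        rw [this]
        exact RingOfIntegers.isIntegral_coe _
      have ha0 : a ≠ 0 := by
        rintro rfl
        simp at ha
      refine ⟨⟨⟨a, hInteg⟩, ⟨a⁻¹, hInteg'⟩, ?_, ?_⟩, ?_⟩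
      · exact Subtype.ext (mul_inv_cancel₀ ha0)
      · exact Subtype.ext (inv_mul_cancel₀ ha0)
      · ext; rw [ha]; rfl
    · rintro ⟨u, rfl⟩
      refine ⟨⟨Units.map (algebraMap (𝓞 K) (𝓞 L)).toMonoidHom u, ?_⟩, ?_⟩
      · rfl
      · change σ (algebraMap (𝓞 K) L u) = algebraMap (𝓞 K) L u
        rw [IsScalarTower.algebraMap_apply (𝓞 K) K L]; simp
  have hEmle : Em ≤ jL.range := by
    intro y hy
    obtain ⟨⟨u, hu⟩, -⟩ := (hEm y).1 hy
    exact ⟨u, Units.ext hu.symm⟩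
  -- finiteness
  have rL : finrank ℤ (Additive (𝓞 L)ˣ) + 1 = finrank ℚ L := by
    rw [Units.finrank_eq, Units.rank, InfinitePlace.card_eq_nrRealPlaces_add_nrComplexPlaces,
      IsTotallyReal.nrComplexPlaces_eq_zero, ← IsTotallyReal.finrank]
    have : 0 < finrank ℚ L := finrank_pos
    omega
  have rK : finrank ℤ (Additive (𝓞 K)ˣ) + 1 = finrank ℚ K := by
    rw [Units.finrank_eq, Units.rank, InfinitePlace.card_eq_nrRealPlaces_add_nrComplexPlaces,
      IsTotallyReal.nrComplexPlaces_eq_zero, ← IsTotallyReal.finrank]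
    have : 0 < finrank ℚ K := finrank_pos
    omega
  have rKL : finrank ℚ L = 2 * finrank ℚ K := by
    rw [← finrank_mul_finrank ℚ K L, h2, mul_comm]
  let eK : Additive (𝓞 K)ˣ ≃ₗ[ℤ] Additive Ep :=
    (MulEquiv.toAdditive ((MonoidHom.ofInjective jK_inj).trans
      (MulEquiv.subgroupCongr hEpr.symm))).toIntLinearEquiv
  have fEp : Module.Finite ℤ (Additive Ep) := Module.Finite.equiv eK
  have rEp : finrank ℤ (Additive Ep) = finrank ℤ (Additive (𝓞 K)ˣ) := eK.finrank_eq.symm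
  let eL : Additive (𝓞 L)ˣ ≃ₗ[ℤ] Additive jL.range :=
    (MulEquiv.toAdditive (MonoidHom.ofInjective jL_inj)).toIntLinearEquiv
  have fEL : Module.Finite ℤ (Additive jL.range) := Module.Finite.equiv eL
  have rEL : finrank ℤ (Additive jL.range) = finrank ℤ (Additive (𝓞 L)ˣ) := eL.finrank_eq.symm
  let iM : Additive Em →ₗ[ℤ] Additive jL.range :=
    (MonoidHom.toAdditive (Subgroup.inclusion hEmle)).toIntLinearMap
  have iM_inj : Function.Injective iM := Subgroup.inclusion_injective hEmle
  have fEm : Module.Finite ℤ (Additive Em) := Module.Finite.of_injective iM iM_inj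
  have hnorm : ∀ y : jL.range, (y * Units.map (σ : L →* L) y : Lˣ) ∈ Ep := by
    rintro ⟨_, ⟨u, rfl⟩⟩
    rw [hEp]
    refine ⟨⟨u * Units.map (RingOfIntegers.mapRingHom (σ : L →+* L)).toMonoidHom u, ?_⟩, ?_⟩
    · rfl
    · change σ (_ * σ _) = _ * σ _
      rw [map_mul, quad_inv h2 σ x hx hσ, mul_comm]
  let N0 : jL.range →* Ep :=
    { toFun := fun y => ⟨y * Units.map (σ : L →* L) y, hnorm y⟩
      map_one' := by ext; simp
      map_mul' := by
        intro a b
        ext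
        simp
        ring }
  let N : Additive jL.range →ₗ[ℤ] Additive Ep := (MonoidHom.toAdditive N0).toIntLinearMap
  have hker : finrank ℤ (LinearMap.ker N) ≤ finrank ℤ (Additive Em) := by
    rw [← LinearMap.finrank_range_of_inj iM_inj]
    refine Submodule.finrank_mono ?_
    rintro y hy
    have h1 : N0 y.toMul = 1 := hy
    have h1' := congrArg (fun u : Ep => ((u : Lˣ) : L)) h1
    refine ⟨Additive.ofMul ⟨(y.toMul : Lˣ), ?_⟩, ?_⟩
    · rw [hEm]
      obtain ⟨u, hu⟩ := y.toMul.2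
      refine ⟨⟨u, ?_⟩, ?_⟩
      · rw [← hu]; rfl
      · exact h1'
    · rfl
  have hrn := Submodule.finrank_quotient_add_finrank (LinearMap.ker N)
  rw [N.quotKerEquivRange.finrank_eq] at hrn
  have hrl : finrank ℤ (LinearMap.range N) ≤ finrank ℤ (Additive Ep) := Submodule.finrank_le _
  have hd : finrank ℤ (Additive Ep) + 1 ≤ finrank ℤ (Additive Em) := by omega
  rw [index_sq_subgroup Ep (-1) _ hz (by simp) hsq ht, index_sq_subgroup Em (-1) _ hz (by simp) hsq ht]
  · refine ⟨by positivity, ?_⟩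
    rw [← pow_succ']
    exact Nat.pow_le_pow_right (by norm_num) (by omega)
  · rw [hEm]; exact ⟨⟨-1, by simp⟩, by simp⟩
  · rw [hEp]; exact ⟨⟨-1, by simp⟩, by simp⟩

end

section

open NumberField Module
open scoped nonZeroDivisors

section cl
variable {R S T : Type*} [CommRing R] [IsDedekindDomain R] [CommRing S] [IsDedekindDomain S]
  [CommRing T] [IsDedekindDomain T]

open Classical in
/-- Class of an ideal (trivial class for the zero ideal). -/
noncomputable def icl (I : Ideal R) : ClassGroup R :=
  if h : I ≠ ⊥ then ClassGroup.mk0 ⟨I, mem_nonZeroDivisors_of_ne_zero h⟩ else 1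

theorem icl_of_ne {I : Ideal R} (h : I ≠ ⊥) :
    icl I = ClassGroup.mk0 ⟨I, mem_nonZeroDivisors_of_ne_zero h⟩ := by
  rw [icl, dif_pos h]

theorem icl_mul {I J : Ideal R} (hI : I ≠ ⊥) (hJ : J ≠ ⊥) : icl (I * J) = icl I * icl J := by
  rw [icl_of_ne hI, icl_of_ne hJ, icl_of_ne (mul_ne_zero hI hJ), ← map_mul]
  rfl

theorem icl_eq_one {I : Ideal R} (hI : I ≠ ⊥) : icl I = 1 ↔ I.IsPrincipal := by
  rw [icl_of_ne hI, ClassGroup.mk0_eq_one_iff]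

theorem icl_span (x : R) : icl (Ideal.span {x}) = 1 := by
  by_cases h : Ideal.span {x} = ⊥
  · rw [icl, dif_neg (not_not.2 h)]
  · rw [icl_eq_one h]; exact ⟨⟨x, rfl⟩⟩

theorem icl_of_principal {I : Ideal R} (h : I.IsPrincipal) : icl I = 1 := by
  obtain ⟨⟨x, rfl⟩⟩ := h
  exact icl_span x

theorem icl_top : icl (⊤ : Ideal R) = 1 := by
  rw [← Ideal.span_singleton_one]; exact icl_span 1

theorem icl_pow {I : Ideal R} (hI : I ≠ ⊥) (n : ℕ) : icl (I ^ n) = icl I ^ n := by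
  induction n with
  | zero => rw [pow_zero, pow_zero, Ideal.one_eq_top, icl_top]
  | succ n ih => rw [pow_succ, pow_succ, icl_mul (pow_ne_zero n hI) hI, ih]

theorem icl_surj (c : ClassGroup R) : ∃ I : Ideal R, I ≠ ⊥ ∧ icl I = c := by
  obtain ⟨I, rfl⟩ := ClassGroup.mk0_surjective c
  have : (I : Ideal R) ≠ ⊥ := nonZeroDivisors.coe_ne_zero I
  exact ⟨I, this, icl_of_ne this⟩

theorem icl_eq {I J : Ideal R} (hI : I ≠ ⊥) (hJ : J ≠ ⊥) :
    icl I = icl J ↔ ∃ x y : R, x ≠ 0 ∧ y ≠ 0 ∧ Ideal.span {x} * I = Ideal.span {y} * J := by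
  rw [icl_of_ne hI, icl_of_ne hJ, ClassGroup.mk0_eq_mk0_iff]
  exact ⟨fun ⟨x, y, hx, hy, h⟩ => ⟨x, y, hx, hy, h⟩, fun ⟨x, y, hx, hy, h⟩ => ⟨x, y, hx, hy, h⟩⟩

/-- Homomorphism of class groups induced by a multiplicative map of ideals. -/
noncomputable def clLift (f : Ideal R →* Ideal S) (h0 : ∀ I, I ≠ ⊥ → f I ≠ ⊥)
    (hp : ∀ x, (f (Ideal.span {x})).IsPrincipal) : ClassGroup R →* ClassGroup S :=
  have key : ∀ I J : Ideal R, I ≠ ⊥ → J ≠ ⊥ → icl I = icl J → icl (f I) = icl (f J) := by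
    intro I J hI hJ h
    obtain ⟨x, y, hx, hy, h⟩ := (icl_eq hI hJ).1 h
    have := congrArg (fun I => icl (f I)) h
    simp only [map_mul] at this
    rwa [icl_mul (h0 _ (by simpa using hx)) (h0 _ hI), icl_mul (h0 _ (by simpa using hy)) (h0 _ hJ),
      icl_of_principal (hp x), icl_of_principal (hp y), one_mul, one_mul] at this
  MonoidHom.mk' (fun c => icl (f (icl_surj c).choose)) (by
    intro a b
    rw [← icl_mul (h0 _ (icl_surj a).choose_spec.1) (h0 _ (icl_surj b).choose_spec.1), ← map_mul]
    refine key _ _ (icl_surj (a * b)).choose_spec.1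
      (mul_ne_zero (icl_surj a).choose_spec.1 (icl_surj b).choose_spec.1) ?_
    rw [(icl_surj (a * b)).choose_spec.2, icl_mul (icl_surj a).choose_spec.1
      (icl_surj b).choose_spec.1, (icl_surj a).choose_spec.2, (icl_surj b).choose_spec.2])

theorem clLift_icl (f : Ideal R →* Ideal S) (h0 : ∀ I, I ≠ ⊥ → f I ≠ ⊥)
    (hp : ∀ x, (f (Ideal.span {x})).IsPrincipal) {I : Ideal R} (hI : I ≠ ⊥) :
    clLift f h0 hp (icl I) = icl (f I) := by
  have hJ := (icl_surj (icl I)).choose_spec.1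
  have h := (icl_surj (icl I)).choose_spec.2
  change icl (f (icl_surj (icl I)).choose) = icl (f I)
  generalize (icl_surj (icl I)).choose = J at hJ h
  obtain ⟨x, y, hx, hy, h⟩ := (icl_eq hJ hI).1 h
  have := congrArg (fun I => icl (f I)) h
  simp only [map_mul] at this
  rwa [icl_mul (h0 _ (by simpa using hx)) (h0 _ hJ), icl_mul (h0 _ (by simpa using hy)) (h0 _ hI),
      icl_of_principal (hp x), icl_of_principal (hp y), one_mul, one_mul] at this

theorem cl_hom_ext {G : Type*} [Group G] {f g : ClassGroup R →* G}
    (h : ∀ I : Ideal R, I ≠ ⊥ → f (icl I) = g (icl I)) (c : ClassGroup R) : f c = g c := by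
  obtain ⟨I, hI, rfl⟩ := icl_surj c
  exact h I hI

end cl

section nf
variable (K L M : Type*) [Field K] [Field L] [NumberField K] [NumberField L]
    [Algebra K L] [Field M] [NumberField M] [Algebra K M] [Algebra L M] [IsScalarTower K L M]

/-- Norm on class groups. -/
noncomputable def clNorm : ClassGroup (𝓞 L) →* ClassGroup (𝓞 K) :=
  clLift (Ideal.relNorm (𝓞 K) : Ideal (𝓞 L) →*₀ Ideal (𝓞 K)).toMonoidHom
    (fun I hI h => hI (Ideal.relNorm_eq_bot_iff.1 h))
    (fun x => ⟨⟨_, Ideal.relNorm_singleton (𝓞 K) x⟩⟩)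

theorem clNorm_icl {I : Ideal (𝓞 L)} (hI : I ≠ ⊥) :
    clNorm K L (icl I) = icl (Ideal.relNorm (𝓞 K) I) := clLift_icl _ _ _ hI

theorem map_ne_bot' {R S : Type*} [CommRing R] [IsDomain R] [CommRing S] [IsDomain S]
    (f : R →+* S) (hf : Function.Injective f) {I : Ideal R} (hI : I ≠ ⊥) : I.map f ≠ ⊥ := by
  intro h
  exact hI ((Ideal.map_eq_bot_iff_of_injective hf).1 h)

/-- Extension of ideal classes. -/
noncomputable def clExt : ClassGroup (𝓞 K) →* ClassGroup (𝓞 L) :=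
  clLift (Ideal.mapHom (algebraMap (𝓞 K) (𝓞 L))).toMonoidHom
    (fun I hI => map_ne_bot' _ (FaithfulSMul.algebraMap_injective _ _) hI)
    (fun x => ⟨⟨algebraMap (𝓞 K) (𝓞 L) x, by
      change Ideal.map _ _ = _
      rw [Ideal.map_span, Set.image_singleton]⟩⟩)

theorem clExt_icl {I : Ideal (𝓞 K)} (hI : I ≠ ⊥) :
    clExt K L (icl I) = icl (I.map (algebraMap (𝓞 K) (𝓞 L))) := clLift_icl _ _ _ hI

variable {K L}
/-- Action of a field isomorphism on ideals. -/
noncomputable def gI (g : L ≃+* M) (I : Ideal (𝓞 L)) : Ideal (𝓞 M) :=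
  I.map (RingOfIntegers.mapRingEquiv g)
end nf
section nf2
variable {K L M : Type*} [Field K] [Field L] [NumberField K] [NumberField L]
     [Field M] [NumberField M] 

/-- Action of a field isomorphism on classes. -/
noncomputable def clMap (g : L ≃+* M) : ClassGroup (𝓞 L) →* ClassGroup (𝓞 M) :=
  clLift (Ideal.mapHom (RingOfIntegers.mapRingEquiv g : 𝓞 L →+* 𝓞 M)).toMonoidHom
    (fun I hI => map_ne_bot' _ (RingOfIntegers.mapRingEquiv g).injective hI)
    (fun x => ⟨⟨RingOfIntegers.mapRingEquiv g x, by
      change Ideal.map _ _ = _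
      rw [Ideal.map_span, Set.image_singleton]; rfl⟩⟩)

theorem clMap_icl (g : L ≃+* M) {I : Ideal (𝓞 L)} (hI : I ≠ ⊥) :
    clMap g (icl I) = icl (gI M g I) := clLift_icl _ _ _ hI

theorem gI_ne_bot (g : L ≃+* M) {I : Ideal (𝓞 L)} (hI : I ≠ ⊥) : gI M g I ≠ ⊥ :=
  map_ne_bot' (RingOfIntegers.mapRingEquiv g : 𝓞 L →+* 𝓞 M)
    (RingOfIntegers.mapRingEquiv g).injective hI

theorem gI_trans (g : K ≃+* L) (h : L ≃+* M) (I : Ideal (𝓞 K)) :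
    gI M h (gI L g I) = gI M (g.trans h) I :=
  Ideal.map_map (RingOfIntegers.mapRingEquiv g : 𝓞 K →+* 𝓞 L) (RingOfIntegers.mapRingEquiv h : 𝓞 L →+* 𝓞 M)

theorem gI_refl (I : Ideal (𝓞 K)) : gI K (RingEquiv.refl K) I = I := Ideal.map_id I

theorem gI_mul (g : L ≃+* M) (I J : Ideal (𝓞 L)) : gI M g (I * J) = gI M g I * gI M g J :=
  Ideal.map_mul (RingOfIntegers.mapRingEquiv g : 𝓞 L →+* 𝓞 M) I J

theorem clMap_trans (g : K ≃+* L) (h : L ≃+* M) (c : ClassGroup (𝓞 K)) :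
    clMap h (clMap g c) = clMap (g.trans h) c := by
  obtain ⟨I, hI, rfl⟩ := icl_surj c
  rw [clMap_icl _ hI, clMap_icl _ (gI_ne_bot g hI), clMap_icl _ hI, gI_trans]

theorem clMap_refl (c : ClassGroup (𝓞 K)) : clMap (RingEquiv.refl K) c = c := by
  obtain ⟨I, hI, rfl⟩ := icl_surj c
  rw [clMap_icl _ hI, gI_refl]

theorem clMap_of_id (g : K ≃+* K) (h : ∀ x, g x = x) (c : ClassGroup (𝓞 K)) : clMap g c = c := by
  have : g = RingEquiv.refl K := RingEquiv.ext h
  rw [this, clMap_refl]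

end nf2

section nf3
variable (K L M : Type*) [Field K] [Field L] [NumberField K] [NumberField L]
    [Algebra K L] [Field M] [NumberField M] [Algebra K M] [Algebra L M] [IsScalarTower K L M]

theorem clNorm_trans (c : ClassGroup (𝓞 M)) : clNorm K L (clNorm L M c) = clNorm K M c := by
  obtain ⟨I, hI, rfl⟩ := icl_surj c
  rw [clNorm_icl _ _ hI, clNorm_icl _ _ (fun h => hI (Ideal.relNorm_eq_bot_iff.1 h)),
    clNorm_icl _ _ hI, Ideal.relNorm_relNorm]

theorem clNorm_clExt (c : ClassGroup (𝓞 K)) : clNorm K L (clExt K L c) = c ^ finrank K L := by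
  obtain ⟨I, hI, rfl⟩ := icl_surj c
  rw [clExt_icl _ _ hI, clNorm_icl _ _ (map_ne_bot' _ (FaithfulSMul.algebraMap_injective _ _) hI),
    Ideal.relNorm_algebraMap, icl_pow hI]
  congr 1
  exact (IsFractionRing.finrank_eq (𝓞 K) K (𝓞 L) L).symm

variable {K L M}
theorem relNorm_gI (σ : L ≃ₐ[K] L) (I : Ideal (𝓞 L)) :
    Ideal.relNorm (𝓞 K) (gI L (σ : L ≃+* L) I) = Ideal.relNorm (𝓞 K) I :=
  Ideal.relNorm_map_algEquiv (RingOfIntegers.mapAlgEquiv σ) I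

theorem clNorm_clMap (σ : L ≃ₐ[K] L) (c : ClassGroup (𝓞 L)) :
    clNorm K L (clMap (σ : L ≃+* L) c) = clNorm K L c := by
  obtain ⟨I, hI, rfl⟩ := icl_surj c
  rw [clMap_icl _ hI, clNorm_icl _ _ (gI_ne_bot _ hI), clNorm_icl _ _ hI, relNorm_gI]

theorem relNorm_map_quad (h2 : finrank K L = 2) (σ : L ≃ₐ[K] L) (x : L) (hx : x ≠ 0)
    (hσ : σ x = -x) (I : Ideal (𝓞 L)) :
    (Ideal.relNorm (𝓞 K) I).map (algebraMap (𝓞 K) (𝓞 L)) = I * gI L (σ : L ≃+* L) I := by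
  by_cases hI : I = ⊥
  · subst hI; simp
  have hle : (Ideal.relNorm (𝓞 K) I).map (algebraMap (𝓞 K) (𝓞 L)) ≤ I * gI L (σ : L ≃+* L) I := by
    rw [Ideal.map_relNorm, Ideal.span_le]
    rintro _ ⟨y, hy, rfl⟩
    have : (algebraMap (𝓞 K) (𝓞 L)) (Algebra.intNorm (𝓞 K) (𝓞 L) y)
        = y * RingOfIntegers.mapRingEquiv (σ : L ≃+* L) y := by
      apply RingOfIntegers.ext
      change algebraMap (𝓞 L) L (algebraMap (𝓞 K) (𝓞 L) _) = (y : L) * σ y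
      rw [← IsScalarTower.algebraMap_apply, IsScalarTower.algebraMap_apply (𝓞 K) K L,
        Algebra.algebraMap_intNorm (A := 𝓞 K) (K := K) (L := L) (B := 𝓞 L),
        quad_norm h2 σ x hx hσ]
    change (algebraMap (𝓞 K) (𝓞 L)) (Algebra.intNorm (𝓞 K) (𝓞 L) y) ∈ _
    rw [this]
    exact Ideal.mul_mem_mul hy (Ideal.mem_map_of_mem _ hy)
  obtain ⟨C, hC⟩ := Ideal.dvd_iff_le.2 hle
  have h1 := congrArg (Ideal.relNorm (𝓞 K)) hC
  have hfr : finrank (𝓞 K) (𝓞 L) = 2 := by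
    rw [← IsFractionRing.finrank_eq (𝓞 K) K (𝓞 L) L, h2]
  rw [Ideal.relNorm_algebraMap, map_mul, map_mul, relNorm_gI, hfr, ← sq] at h1
  have hne : Ideal.relNorm (𝓞 K) I ^ 2 ≠ 0 :=
    pow_ne_zero _ (fun h => hI (Ideal.relNorm_eq_bot_iff.1 h))
  have h3 : Ideal.relNorm (𝓞 K) C = 1 := by
    have : Ideal.relNorm (𝓞 K) I ^ 2 * 1 = Ideal.relNorm (𝓞 K) I ^ 2 * Ideal.relNorm (𝓞 K) C := by
      rw [mul_one]; exact h1
    exact (mul_left_cancel₀ hne this).symm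
  have h4 : C = ⊤ := by
    have := Ideal.relNorm_le_comap (𝓞 K) C
    rw [h3, Ideal.one_eq_top, top_le_iff, Ideal.comap_eq_top_iff] at this
    exact this
  rw [hC, h4, Ideal.mul_top]

theorem clExt_clNorm (h2 : finrank K L = 2) (σ : L ≃ₐ[K] L) (x : L) (hx : x ≠ 0)
    (hσ : σ x = -x) (c : ClassGroup (𝓞 L)) :
    clExt K L (clNorm K L c) = c * clMap (σ : L ≃+* L) c := by
  obtain ⟨I, hI, rfl⟩ := icl_surj c
  rw [clNorm_icl _ _ hI, clExt_icl _ _ (fun h => hI (Ideal.relNorm_eq_bot_iff.1 h)),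
    relNorm_map_quad h2 σ x hx hσ, clMap_icl _ hI, icl_mul hI (gI_ne_bot _ hI)]

/-- naturality of the norm under automorphisms of L preserving K -/
theorem clNorm_equivariant (h2 : finrank K L = 2) (σ : L ≃ₐ[K] L) (x : L) (hx : x ≠ 0)
    (hσ : σ x = -x) (g : L ≃+* L) (g0 : K ≃+* K)
    (hg : ∀ k : K, g (algebraMap K L k) = algebraMap K L (g0 k))
    (hcomm : ∀ y, g (σ y) = σ (g y)) (c : ClassGroup (𝓞 L)) :
    clNorm K L (clMap g c) = clMap g0 (clNorm K L c) := by
  obtain ⟨I, hI, rfl⟩ := icl_surj c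
  have hN : Ideal.relNorm (𝓞 K) I ≠ ⊥ := fun h => hI (Ideal.relNorm_eq_bot_iff.1 h)
  rw [clMap_icl _ hI, clNorm_icl _ _ (gI_ne_bot _ hI), clNorm_icl _ _ hI, clMap_icl _ hN]
  congr 1
  have hinj : Function.Injective (Ideal.map (algebraMap (𝓞 K) (𝓞 L))) := by
    intro I J h
    have := congrArg (Ideal.relNorm (𝓞 K)) h
    have hfr : finrank (𝓞 K) (𝓞 L) = 2 := by
      rw [← IsFractionRing.finrank_eq (𝓞 K) K (𝓞 L) L, h2]
    rw [Ideal.relNorm_algebraMap, Ideal.relNorm_algebraMap, hfr] at this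
    rwa [← pow_left_inj two_ne_zero]
  apply hinj
  rw [relNorm_map_quad h2 σ x hx hσ]
  have h1 : (gI K g0 (Ideal.relNorm (𝓞 K) I)).map (algebraMap (𝓞 K) (𝓞 L))
      = gI L g ((Ideal.relNorm (𝓞 K) I).map (algebraMap (𝓞 K) (𝓞 L))) := by
    rw [gI, gI]
    refine (Ideal.map_map (RingOfIntegers.mapRingEquiv g0 : 𝓞 K →+* 𝓞 K) _).trans
      (Eq.trans ?_ (Ideal.map_map _ (RingOfIntegers.mapRingEquiv g : 𝓞 L →+* 𝓞 L)).symm)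
    congr 1
    ext k
    exact (hg k).symm
  rw [h1, relNorm_map_quad h2 σ x hx hσ, gI_mul, gI_trans, gI_trans]
  congr 2
  ext y
  exact (hcomm y).symm
end nf3

end

section

open NumberField Module
open scoped nonZeroDivisors

section inv
variable {K L : Type*} [Field K] [Field L] [NumberField K] [NumberField L] [Algebra K L]

theorem gI_mono (g : L ≃+* L) {I J : Ideal (𝓞 L)} (h : I ≤ J) : gI L g I ≤ gI L g J :=
  Ideal.map_mono h

theorem mem_gI (g : L ≃+* L) {I : Ideal (𝓞 L)} {y : 𝓞 L} (hy : y ∈ I) :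
    RingOfIntegers.mapRingEquiv g y ∈ gI L g I := Ideal.mem_map_of_mem _ hy

theorem gI_top (g : L ≃+* L) : gI L g ⊤ = ⊤ := Ideal.map_top (RingOfIntegers.mapRingEquiv g : 𝓞 L →+* 𝓞 L)

theorem gI_invol (h2 : finrank K L = 2) (σ : L ≃ₐ[K] L) (x : L) (hx : x ≠ 0)
    (hσ : σ x = -x) (I : Ideal (𝓞 L)) : gI L (σ : L ≃+* L) (gI L (σ : L ≃+* L) I) = I := by
  rw [gI_trans]
  have : (σ : L ≃+* L).trans (σ : L ≃+* L) = RingEquiv.refl L :=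
    RingEquiv.ext (quad_inv h2 σ x hx hσ)
  rw [this, gI_refl]

theorem gI_prime (g : L ≃+* L) {I : Ideal (𝓞 L)} (hI : I.IsMaximal) : (gI L g I).IsMaximal :=
  Ideal.map_isMaximal_of_equiv _

theorem inert_or_ram (h2 : finrank K L = 2) (σ : L ≃ₐ[K] L) (x : 𝓞 L) (hx : (x : L) ≠ 0)
    (hσ : σ x = -x) (q : Ideal (𝓞 L)) (hq0 : q ≠ ⊥) (hq : q.IsMaximal)
    (hqs : gI L (σ : L ≃+* L) q = q) :
    (∃ J : Ideal (𝓞 K), J ≠ ⊥ ∧ q = J.map (algebraMap (𝓞 K) (𝓞 L))) ∨ 2 * x ∈ q := by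
  have hsq := relNorm_map_quad h2 σ x hx hσ q
  rw [hqs] at hsq
  set p := q.under (𝓞 K) with hp
  have hp0 : p ≠ ⊥ := Ideal.IsIntegral.comap_ne_bot (𝓞 K) hq0
  have hqt : q ≠ ⊤ := hq.ne_top
  obtain ⟨k, hk⟩ := Ideal.exists_relNorm_eq_pow_of_isPrime q p
  rw [hk, Ideal.map_pow] at hsq
  have hle : p.map (algebraMap (𝓞 K) (𝓞 L)) ≤ q := Ideal.map_comap_le
  obtain ⟨c, hc⟩ := Ideal.dvd_iff_le.2 hle
  have hunit : ∀ a b : Ideal (𝓞 L), a * b = ⊤ → a = ⊤ := by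
    intro a b h
    rw [eq_top_iff, ← h]; exact Ideal.mul_le_left
  rcases Nat.lt_or_ge k 2 with h | h
  · interval_cases k
    · exfalso
      rw [pow_zero] at hsq
      exact hqt (hunit q q (hsq.symm.trans Ideal.one_eq_top))
    · right
      rw [pow_one] at hk
      have habs : Ideal.absNorm p = Ideal.absNorm q := by
        rw [← hk, Ideal.absNorm_relNorm]
      have hf : Function.Injective (algebraMap (𝓞 K ⧸ p) (𝓞 L ⧸ q)) :=
        Ideal.algebraMap_quotient_injective
      have : Finite (𝓞 L ⧸ q) := Ideal.finiteQuotientOfFreeOfNeBot q hq0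
      have : Finite (𝓞 K ⧸ p) := Ideal.finiteQuotientOfFreeOfNeBot p hp0
      have hb : Function.Bijective (algebraMap (𝓞 K ⧸ p) (𝓞 L ⧸ q)) := by
        refine (Function.Injective.bijective_of_nat_card_le hf ?_)
        exact habs.symm.le
      obtain ⟨y, hy⟩ := hb.2 (Ideal.Quotient.mk q x)
      obtain ⟨y, rfl⟩ := Ideal.Quotient.mk_surjective y
      have h1 : algebraMap (𝓞 K) (𝓞 L) y - x ∈ q := by
        rw [← Ideal.Quotient.eq, ← hy]; rfl
      have h3 := mem_gI (σ : L ≃+* L) h1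
      rw [hqs] at h3
      have h4 : RingOfIntegers.mapRingEquiv (σ : L ≃+* L) (algebraMap (𝓞 K) (𝓞 L) y - x)
          = algebraMap (𝓞 K) (𝓞 L) y + x := by
        rw [map_sub]
        apply RingOfIntegers.ext
        change σ (algebraMap K L y) - σ x = algebraMap K L y + x
        rw [hσ, σ.commutes, sub_neg_eq_add]
      rw [h4] at h3
      have := q.sub_mem h3 h1
      convert this using 1
      ring
  · left
    refine ⟨p, hp0, ?_⟩
    obtain ⟨j, rfl⟩ := Nat.exists_eq_add_of_le h
    have h3 : q ^ 2 * 1 = q ^ 2 * (q ^ j * c ^ (2 + j)) := by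
      have e : q ^ 2 * (q ^ j * c ^ (2 + j)) = (q * c) ^ (2 + j) := by ring
      rw [e, ← hc, hsq, mul_one, sq]
    have h4 := (mul_left_cancel₀ (pow_ne_zero 2 hq0) h3).symm
    have hc1 : c = ⊤ := by
      refine hunit c (q ^ j * c ^ (1 + j)) ?_
      rw [← Ideal.one_eq_top, ← h4]; ring
    rw [hc, hc1, Ideal.mul_top]

theorem inv_induction (h2 : finrank K L = 2) (σ : L ≃ₐ[K] L) (x : 𝓞 L) (hx : (x : L) ≠ 0)
    (hσ : σ x = -x) (H : Ideal (𝓞 L) → Prop) (hmul : ∀ a b, a ≠ ⊥ → b ≠ ⊥ → H a → H b → H (a * b))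
    (hmap : ∀ J : Ideal (𝓞 K), J ≠ ⊥ → H (J.map (algebraMap (𝓞 K) (𝓞 L))))
    (hram : ∀ q : Ideal (𝓞 L), q ≠ ⊥ → q.IsMaximal → gI L (σ : L ≃+* L) q = q → 2 * x ∈ q → H q) :
    ∀ a : Ideal (𝓞 L), a ≠ ⊥ → gI L (σ : L ≃+* L) a = a → H a := by
  have main : ∀ n : ℕ, ∀ a : Ideal (𝓞 L), Ideal.absNorm a = n → a ≠ ⊥ →
      gI L (σ : L ≃+* L) a = a → H a := by
    intro n
    induction n using Nat.strong_induction_on with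
    | _ n ih =>
    intro a han ha0 has
    by_cases hat : a = ⊤
    · rw [hat]
      have := hmap ⊤ top_ne_bot
      rwa [Ideal.map_top] at this
    obtain ⟨q, hq, haq⟩ := Ideal.exists_le_maximal a hat
    have hq0 : q ≠ ⊥ := fun h => ha0 (le_bot_iff.1 (h ▸ haq))
    -- generic step
    have step : ∀ d : Ideal (𝓞 L), d ≠ ⊥ → d ≠ ⊤ → gI L (σ : L ≃+* L) d = d → H d → a ≤ d → H a := by
      intro d hd0 hdt hds hHd had
      obtain ⟨b, rfl⟩ := Ideal.dvd_iff_le.2 had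
      have hb0 : b ≠ ⊥ := fun h => ha0 (by rw [h, Ideal.mul_bot])
      refine hmul d b hd0 hb0 hHd (ih (Ideal.absNorm b) ?_ b rfl hb0 ?_)
      · rw [← han, map_mul]
        have h1 : Ideal.absNorm d ≠ 0 := fun h => hd0 (Ideal.absNorm_eq_zero_iff.1 h)
        have h3 : Ideal.absNorm d ≠ 1 := fun h => hdt (Ideal.absNorm_eq_one_iff.1 h)
        have h4 : 0 < Ideal.absNorm b :=
          Nat.pos_of_ne_zero (fun h => hb0 (Ideal.absNorm_eq_zero_iff.1 h))
        have : 2 ≤ Ideal.absNorm d := by omega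
        nlinarith
      · rw [gI_mul, hds] at has
        exact mul_left_cancel₀ hd0 has
    by_cases hqs : gI L (σ : L ≃+* L) q = q
    · refine step q hq0 hq.ne_top hqs ?_ haq
      rcases inert_or_ram h2 σ x hx hσ q hq0 hq hqs with ⟨J, hJ, h⟩ | h
      · rw [h]; exact hmap J hJ
      · exact hram q hq0 hq hqs h
    · have hq' := gI_prime (σ : L ≃+* L) hq
      have hcop : q ⊔ gI L (σ : L ≃+* L) q = ⊤ := by
        rw [← Ideal.isCoprime_iff_sup_eq]
        exact Ideal.isCoprime_of_isMaximal (fun h => hqs h.symm)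
      have haq' : a ≤ gI L (σ : L ≃+* L) q := by
        rw [← has]; exact gI_mono _ haq
      have hN := relNorm_map_quad h2 σ x hx hσ q
      refine step (q * gI L (σ : L ≃+* L) q) (mul_ne_zero hq0 (gI_ne_bot _ hq0)) ?_ ?_ ?_ ?_
      · intro h
        exact hq.ne_top (eq_top_iff.2 (h ▸ Ideal.mul_le_left))
      · rw [gI_mul, gI_invol h2 σ x hx hσ, mul_comm]
      · rw [← hN]; exact hmap _ (fun h => hq0 (Ideal.relNorm_eq_bot_iff.1 h))
      · rw [Ideal.mul_eq_inf_of_coprime hcop]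
        exact le_inf haq haq'
  exact fun a => main _ a rfl

end inv

end

section

open NumberField Module
open scoped nonZeroDivisors

section fi
variable {A B K L : Type*} [CommRing A] [IsDedekindDomain A] [CommRing B] [IsDedekindDomain B]
  [Field K] [Field L] [Algebra A K] [IsFractionRing A K] [Algebra B L] [IsFractionRing B L]

open Classical in
/-- Ideals as invertible fractional ideals (total function). -/
noncomputable def fI (K : Type*) [Field K] [Algebra A K] [IsFractionRing A K] (I : Ideal A) :
    (FractionalIdeal A⁰ K)ˣ :=
  if h : I ≠ ⊥ then FractionalIdeal.mk0 K ⟨I, mem_nonZeroDivisors_of_ne_zero h⟩ else 1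

theorem fI_of_ne {I : Ideal A} (h : I ≠ ⊥) :
    fI K I = FractionalIdeal.mk0 K ⟨I, mem_nonZeroDivisors_of_ne_zero h⟩ := by
  rw [fI, dif_pos h]

theorem fI_coe {I : Ideal A} (h : I ≠ ⊥) : (fI K I : FractionalIdeal A⁰ K) = I := by
  rw [fI_of_ne h]; rfl

theorem fI_mul {I J : Ideal A} (hI : I ≠ ⊥) (hJ : J ≠ ⊥) : fI K (I * J) = fI K I * fI K J := by
  rw [fI_of_ne hI, fI_of_ne hJ, fI_of_ne (mul_ne_zero hI hJ), ← map_mul]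
  rfl

theorem fI_inj {I J : Ideal A} (hI : I ≠ ⊥) (hJ : J ≠ ⊥) (h : fI K I = fI K J) : I = J := by
  have := congrArg Units.val h
  rw [fI_coe hI, fI_coe hJ] at this
  exact FractionalIdeal.coeIdeal_injective this

theorem mk_fI {I : Ideal A} (hI : I ≠ ⊥) : ClassGroup.mk K (fI K I) = icl I := by
  rw [fI_of_ne hI, ClassGroup.mk_mk0, icl_of_ne hI]

theorem fI_span (x : A) (u : Kˣ) (hu : (u : K) = algebraMap A K x) (hx : x ≠ 0) :
    toPrincipalIdeal A K u = fI K (Ideal.span {x}) := by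
  rw [toPrincipalIdeal_eq_iff, fI_coe (by simpa using hx), FractionalIdeal.coeIdeal_span_singleton, hu]

theorem fI_frac (i : (FractionalIdeal A⁰ K)ˣ) : ∃ a b : Ideal A, a ≠ ⊥ ∧ b ≠ ⊥ ∧
    i = fI K a / fI K b := by
  obtain ⟨a, J, ha, h⟩ := FractionalIdeal.exists_eq_spanSingleton_mul (i : FractionalIdeal A⁰ K)
  have hJ : J ≠ ⊥ := by
    rintro rfl
    exact i.ne_zero (by rw [h]; simp)
  have hs : Ideal.span {a} ≠ ⊥ := by simpa using ha
  refine ⟨J, Ideal.span {a}, hJ, hs, ?_⟩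
  rw [eq_div_iff_mul_eq']
  apply Units.ext
  rw [Units.val_mul, fI_coe hJ, fI_coe hs, h, FractionalIdeal.coeIdeal_span_singleton,
    mul_right_comm, FractionalIdeal.spanSingleton_mul_spanSingleton, inv_mul_cancel₀,
    FractionalIdeal.spanSingleton_one, one_mul]
  simpa using ha

theorem fI_hom_ext {G : Type*} [Group G] {f g : (FractionalIdeal A⁰ K)ˣ →* G}
    (h : ∀ I : Ideal A, I ≠ ⊥ → f (fI K I) = g (fI K I)) (c) : f c = g c := by
  obtain ⟨a, b, ha, hb, rfl⟩ := fI_frac c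
  rw [map_div, map_div, h a ha, h b hb]

theorem unit_hom_ext {G : Type*} [Group G] {f g : Kˣ →* G}
    (h : ∀ (x : A) (u : Kˣ), x ≠ 0 → (u : K) = algebraMap A K x → f u = g u) (c) : f c = g c := by
  obtain ⟨a, b, hb, hab⟩ := IsFractionRing.div_surjective (A := A) (c : K)
  have hb0 : b ≠ 0 := nonZeroDivisors.ne_zero hb
  have hb' : algebraMap A K b ≠ 0 := by simpa using hb0
  have ha0 : a ≠ 0 := by
    rintro rfl
    exact c.ne_zero (by rw [← hab]; simp)
  have ha' : algebraMap A K a ≠ 0 := by simpa using ha0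
  have : c = Units.mk0 _ ha' / Units.mk0 _ hb' := by
    apply Units.ext; simp [← hab, Units.val_div_eq_div_val]
  rw [this, map_div, map_div, h a _ ha0 rfl, h b _ hb0 rfl]

/-- extension of fractional ideals along an injective ring hom -/
noncomputable def fE (K L : Type*) [Field K] [Field L] [Algebra A K] [IsFractionRing A K]
    [Algebra B L] [IsFractionRing B L] (f : A →+* B) (hf : Function.Injective f) :
    (FractionalIdeal A⁰ K)ˣ →* (FractionalIdeal B⁰ L)ˣ :=
  Units.map (FractionalIdeal.extendedHom' (f := f) (M := A⁰) (K := K) L (N := B⁰)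
    (nonZeroDivisors_le_comap_nonZeroDivisors_of_injective f hf)).toMonoidHom

theorem fE_fI (f : A →+* B) (hf : Function.Injective f) {I : Ideal A} (hI : I ≠ ⊥) :
    fE K L f hf (fI K I) = fI L (I.map f) := by
  apply Units.ext
  rw [fI_coe (map_ne_bot' f hf hI)]
  change FractionalIdeal.extended L _ _ = _
  rw [fI_coe hI, FractionalIdeal.extended_coeIdeal_eq_map]

theorem mk_ker : (ClassGroup.mk K : (FractionalIdeal A⁰ K)ˣ →* ClassGroup A).ker =
    (toPrincipalIdeal A K).range := by
  ext i
  rw [MonoidHom.mem_ker, ClassGroup.mk_eq_one_iff, mem_principal_ideals_iff]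
  constructor
  · intro h
    obtain ⟨⟨x, hx⟩⟩ := h
    refine ⟨x, ?_⟩
    apply FractionalIdeal.coeToSubmodule_injective
    simp only [FractionalIdeal.coe_spanSingleton]
    exact hx.symm
  · rintro ⟨x, hx⟩
    rw [← hx]
    exact ⟨⟨x, FractionalIdeal.coe_spanSingleton _ x⟩⟩

theorem mk_surj' (c : ClassGroup A) : ∃ i : (FractionalIdeal A⁰ K)ˣ, ClassGroup.mk K i = c := by
  obtain ⟨I, hI, rfl⟩ := icl_surj c
  exact ⟨fI K I, mk_fI hI⟩

end fi

section thmA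
variable {K L : Type*} [Field K] [Field L] [NumberField K] [NumberField L] [Algebra K L]

theorem amb_bound [IsTotallyReal K] [IsTotallyReal L] (φ : L →+* ℝ) 
    (h2 : finrank K L = 2) (σ : L ≃ₐ[K] L) (x : 𝓞 L) (hx : (x : L) ≠ 0) (hσ : σ x = -x)
    (hP : ∀ p q : Ideal (𝓞 L), p.IsMaximal → q.IsMaximal → 2 * x ∈ p → 2 * x ∈ q → p = q) :
    Nat.card {c : ClassGroup (𝓞 L) // clMap (σ : L ≃+* L) c = c} ≤ Nat.card (ClassGroup (𝓞 K)) := by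
  set fσ : 𝓞 L →+* 𝓞 L := (RingOfIntegers.mapRingEquiv (σ : L ≃+* L) : 𝓞 L →+* 𝓞 L) with hfσ
  have hfi : Function.Injective fσ := (RingOfIntegers.mapRingEquiv (σ : L ≃+* L)).injective
  set τ := fE L L fσ hfi with hτdef
  have hτI : ∀ I : Ideal (𝓞 L), I ≠ ⊥ → τ (fI L I) = fI L (gI L (σ : L ≃+* L) I) :=
    fun I hI => fE_fI fσ hfi hI
  have hai : Function.Injective (algebraMap (𝓞 K) (𝓞 L)) := FaithfulSMul.algebraMap_injective _ _
  set j := fE K L (algebraMap (𝓞 K) (𝓞 L)) hai with hj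
  have hjI : ∀ I : Ideal (𝓞 K), I ≠ ⊥ → j (fI K I) = fI L (I.map (algebraMap (𝓞 K) (𝓞 L))) :=
    fun I hI => fE_fI _ hai hI
  set s : Lˣ →* Lˣ := Units.map (σ : L →* L) with hs
  set δ := toPrincipalIdeal (𝓞 L) L with hδ
  have hsv : ∀ y : Lˣ, ((s y : Lˣ) : L) = σ y := fun y => rfl
  let Ep : Subgroup Lˣ := δ.ker ⊓ MonoidHom.eqLocus s (MonoidHom.id _)
  let Em : Subgroup Lˣ := δ.ker ⊓ (MonoidHom.id _ * s).ker
  let Fix : Subgroup (FractionalIdeal (𝓞 L)⁰ L)ˣ := MonoidHom.eqLocus τ (MonoidHom.id _)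
  let T : Subgroup (FractionalIdeal (𝓞 L)⁰ L)ˣ := δ.range.comap (MonoidHom.id _ / τ)
  have hker : ∀ y : Lˣ, δ y = 1 ↔ ∃ u : (𝓞 L)ˣ, (y : L) = (u : 𝓞 L) := by
    intro y
    rw [hδ, toPrincipalIdeal_eq_iff]
    constructor
    · intro h
      have h1 : ∀ z : Lˣ, FractionalIdeal.spanSingleton (𝓞 L)⁰ (z : L) = 1 → ∃ a : 𝓞 L, (a : L) = z := by
        intro z hz
        have : (z : L) ∈ FractionalIdeal.spanSingleton (𝓞 L)⁰ (z : L) :=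
          FractionalIdeal.mem_spanSingleton_self _ _
        rw [hz, FractionalIdeal.mem_one_iff] at this
        exact this
      obtain ⟨a, ha⟩ := h1 y h
      obtain ⟨b, hb⟩ := h1 y⁻¹ (by
        rw [Units.val_inv_eq_inv_val, ← FractionalIdeal.spanSingleton_inv, h]; simp)
      have hab : a * b = 1 := by
        apply RingOfIntegers.ext
        exact (congrArg₂ (· * ·) ha hb).trans (by simp)
      exact ⟨⟨a, b, hab, by rw [mul_comm, hab]⟩, ha.symm⟩
    · rintro ⟨u, hu⟩
      rw [hu, ← FractionalIdeal.coeIdeal_span_singleton, Ideal.span_singleton_eq_top.2 u.isUnit]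
      simp
  have hu := unit_indices φ h2 σ x hx hσ Ep Em
    (by
      intro y
      rw [← hker]
      refine and_congr Iff.rfl ?_
      change s y = y ↔ _
      rw [← Units.val_inj]; rfl)
    (by
      intro y
      rw [← hker]
      refine and_congr Iff.rfl ?_
      change y * s y = 1 ↔ _
      rw [← Units.val_inj]; rfl)
  have hττ : ∀ i, τ (τ i) = i := by
    intro i
    refine fI_hom_ext (f := τ.comp τ) (g := MonoidHom.id _) ?_ i
    intro I hI
    change τ (τ (fI L I)) = fI L I
    rw [hτI I hI, hτI _ (gI_ne_bot _ hI), gI_invol h2 σ x hx hσ]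
  have hττj : ∀ i, τ (j i) = j i := by
    intro i
    refine fI_hom_ext (f := τ.comp j) (g := j) ?_ i
    intro I hI
    change τ (j (fI K I)) = j (fI K I)
    rw [hjI I hI, hτI _ (map_ne_bot' _ hai hI)]
    congr 1
    unfold gI
    have : (RingOfIntegers.mapRingEquiv (σ : L ≃+* L) : 𝓞 L →+* 𝓞 L).comp (algebraMap (𝓞 K) (𝓞 L)) =
       algebraMap (𝓞 K) (𝓞 L) := by
      ext z
      change σ (algebraMap K L z) = algebraMap K L z
      exact σ.commutes _
    calc _ = Ideal.map (RingOfIntegers.mapRingEquiv (σ : L ≃+* L) : 𝓞 L →+* 𝓞 L) (Ideal.map (algebraMap (𝓞 K) (𝓞 L)) I) := rfl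
      _ = _ := by rw [Ideal.map_map, this]
  have hδτ : ∀ y, δ (s y) = τ (δ y) := by
    intro y
    refine unit_hom_ext (A := 𝓞 L) (f := δ.comp s) (g := τ.comp δ) ?_ y
    intro a u ha hu
    change δ (s u) = τ (δ u)
    rw [hδ, fI_span a u hu ha, hτI _ (by simpa using ha)]
    have : gI L (σ : L ≃+* L) (Ideal.span {a}) = Ideal.span {fσ a} := by
      unfold gI; exact (Ideal.map_span (RingOfIntegers.mapRingEquiv (σ : L ≃+* L) : 𝓞 L →+* 𝓞 L) _).trans (by rw [Set.image_singleton])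
    rw [this]
    refine fI_span _ _ ?_ (fun h => ha (hfi (by rw [h, map_zero])))
    rw [hsv, hu]; rfl
  have hclτ : ∀ i, ClassGroup.mk L (τ i) = clMap (σ : L ≃+* L) (ClassGroup.mk L i) := by
    intro i
    refine fI_hom_ext (f := (ClassGroup.mk L).comp τ) (g := (clMap (σ : L ≃+* L)).comp (ClassGroup.mk L)) ?_ i
    intro I hI
    change ClassGroup.mk L (τ (fI L I)) = clMap (σ : L ≃+* L) (ClassGroup.mk L (fI L I))
    rw [hτI I hI, mk_fI hI, mk_fI (gI_ne_bot _ hI), clMap_icl _ hI]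
  -- S has index ≤ 2
  have hS2 : j.range.relIndex Fix ≤ 2 := by
    have hex : ∃ p : (FractionalIdeal (𝓞 L)⁰ L)ˣ, p * p ∈ j.range ∧ ∀ q : Ideal (𝓞 L), q ≠ ⊥ → q.IsMaximal →
        gI L (σ : L ≃+* L) q = q → 2 * x ∈ q → fI L q = p := by
      by_cases h : ∃ q : Ideal (𝓞 L), q ≠ ⊥ ∧ q.IsMaximal ∧ 2 * x ∈ q ∧ gI L (σ : L ≃+* L) q = q
      · obtain ⟨q, hq0, hq, hxq, hqs⟩ := h
        refine ⟨fI L q, ?_, fun q' _ h' _ hx' => by rw [hP q q' hq h' hxq hx']⟩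
        refine ⟨fI K (Ideal.relNorm (𝓞 K) q), ?_⟩
        rw [hjI _ (fun h => hq0 (Ideal.relNorm_eq_bot_iff.1 h)), relNorm_map_quad h2 σ x hx hσ, hqs,
          fI_mul hq0 hq0]
      · push Not at h
        exact ⟨1, by simp [one_mem], fun q hq0 hq hs hx => absurd hs (h q hq0 hq hx)⟩
    obtain ⟨p, hp, hpq⟩ := hex
    have hid : ∀ a : Ideal (𝓞 L), a ≠ ⊥ → gI L (σ : L ≃+* L) a = a → 
        (fI L a ∈ j.range ∨ fI L a / p ∈ j.range) := by
      refine inv_induction h2 σ x hx hσ _ ?_ ?_ ?_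
      · intro a b ha hb hHa hHb
        rw [fI_mul ha hb]
        rcases hHa with h | h <;> rcases hHb with h' | h'
        · left; exact mul_mem h h'
        · right; rw [mul_div_assoc]; exact mul_mem h h'
        · right; rw [mul_div_right_comm]; exact mul_mem h h'
        · left
          have := mul_mem (mul_mem h h') hp
          have e : fI L a / p * (fI L b / p) * (p * p) = fI L a * fI L b := by
            rw [div_mul_div_comm, div_mul_cancel]
          rwa [e] at this
      · intro J hJ
        left; rw [← hjI J hJ]; exact ⟨_, rfl⟩
      · intro q h0 hm hs hxq
        right
        rw [hpq q h0 hm hs hxq, div_self']; exact one_mem _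
    have hfix : ∀ i ∈ Fix, i ∈ j.range ∨ i / p ∈ j.range := by
      intro i hi
      obtain ⟨a, b, ha, hb, rfl⟩ := fI_frac i
      have hi' : τ (fI L a / fI L b) = fI L a / fI L b := hi
      have hgb := gI_ne_bot (σ : L ≃+* L) hb
      have hga := gI_ne_bot (σ : L ≃+* L) ha
      rw [map_div, hτI a ha, hτI b hb, div_eq_div_iff_mul_eq_mul, ← fI_mul hga hb, ← fI_mul ha hgb] at hi'
      have hinv := fI_inj (mul_ne_zero hga hb) (mul_ne_zero ha hgb) hi'
      have hbb : fI L (b * gI L (σ : L ≃+* L) b) ∈ j.range := by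
        rw [← relNorm_map_quad h2 σ x hx hσ, ← hjI _ (fun h => hb (Ideal.relNorm_eq_bot_iff.1 h))]
        exact ⟨_, rfl⟩
      have key : fI L a / fI L b = fI L (a * gI L (σ : L ≃+* L) b) / fI L (b * gI L (σ : L ≃+* L) b) := by
        rw [fI_mul ha hgb, fI_mul hb hgb, mul_div_mul_right_eq_div]
      rw [key]
      rcases hid (a * gI L (σ : L ≃+* L) b) (mul_ne_zero ha hgb) (by
        rw [gI_mul, gI_invol h2 σ x hx hσ, hinv]) with h | h
      · left; exact div_mem h hbb
      · right; rw [div_right_comm]; exact div_mem h hbb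
    have hk : (QuotientGroup.mk' j.range).ker = j.range := QuotientGroup.ker_mk' _
    rw [← hk, Subgroup.relIndex_ker]
    have hsub : ((Fix.map (QuotientGroup.mk' j.range) : Subgroup _) : Set _) ⊆
        {1, QuotientGroup.mk' j.range p} := by
      rintro _ ⟨i, hi, rfl⟩
      rcases hfix i hi with h | h
      · left
        rw [← hk] at h; exact h
      · right
        rw [← hk, MonoidHom.mem_ker, map_div, div_eq_one] at h
        exact h
    calc _ ≤ Set.ncard {1, QuotientGroup.mk' j.range p} := Set.ncard_le_ncard hsub (by simp)
      _ ≤ 2 := (Set.ncard_insert_le _ _).trans (by rw [Set.ncard_singleton])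
  have := amb_count s τ δ (fun y => Units.ext (quad_inv h2 σ x hx hσ y)) hττ hδτ
    (by
      intro y hy
      obtain ⟨z, hz, h⟩ := quad_h90 σ x hx hσ y (congrArg Units.val hy)
      refine ⟨Units.mk0 z hz, Units.ext ?_⟩
      rw [h, Units.val_div_eq_div_val]; rfl)
    j.range Fix T (MonoidHom.eqLocus s (MonoidHom.id _)) δ.ker Ep Em (fun _ => Iff.rfl) (fun _ => Iff.rfl)
    (fun _ => Iff.rfl) (fun _ => Iff.rfl) (fun _ => Iff.rfl) (fun _ => Iff.rfl)
    (by rintro _ ⟨i, rfl⟩; exact hττj i) hS2 (Nat.card (ClassGroup (𝓞 K)))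
    (by
      rintro _ ⟨y, hy, rfl⟩
      obtain ⟨a, ha⟩ := quad_fix h2 σ x hx hσ y (congrArg Units.val hy)
      have ha0 : a ≠ 0 := by
        rintro rfl; exact y.ne_zero (by rw [ha, map_zero])
      have : y = Units.map (algebraMap K L : K →* L) (Units.mk0 a ha0) := Units.ext ha
      rw [this]
      refine ⟨toPrincipalIdeal (𝓞 K) K (Units.mk0 a ha0), ?_⟩
      refine unit_hom_ext (A := 𝓞 K) (f := j.comp (toPrincipalIdeal (𝓞 K) K)) (g := δ.comp (Units.map (algebraMap K L : K →* L))) ?_ _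
      intro b u hb hu
      change j (toPrincipalIdeal (𝓞 K) K u) = δ _
      rw [fI_span b u hu hb, hjI _ (by simpa using hb), Ideal.map_span, Set.image_singleton]
      refine (fI_span _ _ ?_ (fun h => hb (hai (by rw [h, map_zero])))).symm
      change algebraMap K L u = _
      rw [hu]; rfl)
    ?_ hu.1 hu.2
  · rw [hδ, ← mk_ker, Subgroup.relIndex_ker] at this
    refine le_trans (le_of_eq ?_) this
    refine Nat.card_congr (Equiv.setCongr ?_)
    ext c
    constructor
    · intro hc
      obtain ⟨i, rfl⟩ := mk_surj' (K := L) c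
      refine ⟨i, ?_, rfl⟩
      change i / τ i ∈ δ.range
      rw [hδ, ← mk_ker, MonoidHom.mem_ker, map_div, div_eq_one, hclτ]
      exact Eq.symm hc
    · rintro ⟨i, hi, rfl⟩
      change i / τ i ∈ δ.range at hi
      rw [hδ, ← mk_ker, MonoidHom.mem_ker, map_div, div_eq_one, hclτ] at hi
      exact hi.symm
  · have hle : (toPrincipalIdeal (𝓞 K) K).range.map j ≤ Subgroup.map δ (MonoidHom.eqLocus s (MonoidHom.id _)) := by
      rintro _ ⟨_, ⟨u, rfl⟩, rfl⟩
      refine ⟨Units.map (algebraMap K L : K →* L) u, ?_, ?_⟩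
      · apply Units.ext; exact σ.commutes _
      · symm
        refine unit_hom_ext (A := 𝓞 K) (f := j.comp (toPrincipalIdeal (𝓞 K) K)) (g := δ.comp (Units.map (algebraMap K L : K →* L))) ?_ _
        intro b u hb hu
        change j (toPrincipalIdeal (𝓞 K) K u) = δ _
        rw [fI_span b u hu hb, hjI _ (by simpa using hb), Ideal.map_span, Set.image_singleton]
        refine (fI_span _ _ ?_ (fun h => hb (hai (by rw [h, map_zero])))).symm
        change algebraMap K L u = _
        rw [hu]; rfl
    have hpos : 0 < Nat.card (ClassGroup (𝓞 K)) := Nat.card_pos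
    refine Nat.le_of_dvd hpos ?_
    refine (Subgroup.relIndex_dvd_of_le_left j.range hle).trans ?_
    rw [MonoidHom.range_eq_map j, Subgroup.relIndex_map_map]
    refine (Subgroup.relIndex_dvd_of_le_left _ (le_sup_left : (toPrincipalIdeal (𝓞 K) K).range ≤ _)).trans ?_
    rw [top_sup_eq, ← mk_ker, Subgroup.relIndex_ker]
    exact Subgroup.card_subgroup_dvd_card _

end thmA

end

section

section grp
variable {G H : Type*} [CommGroup G] [CommGroup H]

/-- 2-primary elements -/
def tp (x : G) : Prop := ∃ k : ℕ, x ^ 2 ^ k = 1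

theorem tp_one : tp (1 : G) := ⟨0, by simp⟩
theorem tp_mul {x y : G} (hx : tp x) (hy : tp y) : tp (x * y) := by
  obtain ⟨a, ha⟩ := hx
  obtain ⟨b, hb⟩ := hy
  exact ⟨a + b, by rw [mul_pow, pow_add, pow_mul, ha, one_pow, one_mul, mul_comm, pow_mul, hb, one_pow]⟩
theorem tp_inv {x : G} (hx : tp x) : tp x⁻¹ := by
  obtain ⟨a, ha⟩ := hx
  exact ⟨a, by rw [inv_pow, ha, inv_one]⟩
theorem tp_div {x y : G} (hx : tp x) (hy : tp y) : tp (x / y) := by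
  rw [div_eq_mul_inv]; exact tp_mul hx (tp_inv hy)
theorem tp_pow {x : G} (hx : tp x) (n : ℕ) : tp (x ^ n) := by
  obtain ⟨a, ha⟩ := hx
  exact ⟨a, by rw [← pow_mul, mul_comm, pow_mul, ha, one_pow]⟩
theorem tp_map (f : G →* H) {x : G} (hx : tp x) : tp (f x) := by
  obtain ⟨a, ha⟩ := hx
  exact ⟨a, by rw [← map_pow, ha, map_one]⟩
theorem tp_of_sq {x : G} (hx : tp (x ^ 2)) : tp x := by
  obtain ⟨a, ha⟩ := hx
  exact ⟨a + 1, by rw [pow_succ', pow_mul, ha]⟩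

theorem tp_proj_aux [Finite G] {n k m e : ℕ} (hm : Odd m) (hnm : n = 2 ^ k * m)
    (he1 : e ≡ 1 [MOD 2 ^ k]) (he2 : e ≡ 0 [MOD m]) (hA : Nat.card G ∣ n) :
    (∀ x : G, tp (x ^ e)) ∧ (∀ x : G, tp x → x ^ e = x) := by
  have hex : ∀ x : G, x ^ n = 1 := fun x => by
    obtain ⟨t, ht⟩ := hA
    rw [ht, pow_mul, pow_card_eq_one', one_pow]
  constructor
  · intro x
    obtain ⟨f, hf⟩ := (Nat.modEq_zero_iff_dvd.1 he2)
    refine ⟨k, ?_⟩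
    rw [hf, ← pow_mul, mul_right_comm, mul_comm m, ← hnm, pow_mul, hex, one_pow]
  · rintro x ⟨j, hj⟩
    have h2k : x ^ 2 ^ k = 1 := by
      have h1 := pow_gcd_eq_one.2 ⟨hj, hex x⟩
      refine orderOf_dvd_iff_pow_eq_one.1 ((orderOf_dvd_of_pow_eq_one h1).trans ?_)
      rw [hnm]
      have : Nat.Coprime (Nat.gcd (2 ^ j) (2 ^ k * m)) m :=
        Nat.Coprime.coprime_dvd_left (Nat.gcd_dvd_left _ _) ((Nat.coprime_two_left.2 hm).pow_left j)
      exact this.dvd_of_dvd_mul_right (Nat.gcd_dvd_right _ _)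
    have := (pow_eq_pow_iff_modEq (x := x) (n := e) (m := 1)).2
      (he1.of_dvd (orderOf_dvd_of_pow_eq_one h2k))
    rwa [pow_one] at this

/-- the idempotent exponent -/
theorem tp_proj [Finite G] [Finite H] : ∃ e : ℕ, (∀ x : G, tp (x ^ e)) ∧ (∀ x : G, tp x → x ^ e = x) ∧
    (∀ x : H, tp (x ^ e)) ∧ (∀ x : H, tp x → x ^ e = x) := by
  set n := Nat.card G * Nat.card H with hn
  have hn0 : n ≠ 0 := mul_ne_zero Nat.card_pos.ne' Nat.card_pos.ne'
  obtain ⟨k, m, hm, hnm⟩ := Nat.exists_eq_two_pow_mul_odd hn0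
  have hcop : Nat.Coprime (2 ^ k) m := (Nat.coprime_two_left.2 hm).pow_left k
  obtain ⟨e, he1, he2⟩ := Nat.chineseRemainder hcop 1 0
  have a := tp_proj_aux (G := G) hm hnm he1 he2 (Dvd.intro _ rfl)
  have b := tp_proj_aux (G := H) hm hnm he1 he2 (Dvd.intro_left _ rfl)
  exact ⟨e, a.1, a.2, b.1, b.2⟩

theorem ker_of_surj [Finite G] [Finite H] (N : G →* H) (σ : G →* G) (hN : Function.Surjective N) (hNσ : ∀ x, N (σ x) = N x)
    (hc : Nat.card {c : G // σ c = c} ≤ Nat.card H) (y : G) (hy : N y = 1) : ∃ z, y = z / σ z := by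
  let d : G →* G := MonoidHom.id G / σ
  have hle : d.range ≤ N.ker := by
    rintro _ ⟨z, rfl⟩
    change N (z / σ z) = 1
    rw [map_div, hNσ, div_self']
  have h1 : Nat.card d.ker * Nat.card d.range = Nat.card G := by
    have := d.ker.card_mul_index
    rwa [Subgroup.index_ker] at this
  have h2 : Nat.card N.ker * Nat.card H = Nat.card G := by
    have := N.ker.card_mul_index
    rwa [Subgroup.index_ker, MonoidHom.range_eq_top.2 hN, Subgroup.card_top] at this
  have h3 : Nat.card d.ker ≤ Nat.card H := by
    refine le_trans (le_of_eq ?_) hc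
    refine Nat.card_congr (Equiv.setCongr ?_)
    ext c
    change c / σ c = 1 ↔ σ c = c
    rw [div_eq_one]; exact eq_comm
  have h4 : Nat.card N.ker ≤ Nat.card d.range := by
    have hpos : 0 < Nat.card H := Nat.card_pos
    have : Nat.card N.ker * Nat.card H ≤ Nat.card d.range * Nat.card H := by
      rw [h2, ← h1, mul_comm]; exact Nat.mul_le_mul_left _ h3
    exact Nat.le_of_mul_le_mul_right this hpos
  have := Subgroup.eq_of_le_of_card_ge hle h4
  have hy' : y ∈ d.range := by rw [this]; exact hy
  obtain ⟨z, rfl⟩ := hy'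
  exact ⟨z, rfl⟩

theorem inj_of_triv [Finite G] (N : G →* H) (σ : G →* G) (hk : ∀ y, N y = 1 → ∃ z, y = z / σ z)
    (ht : ∀ x, tp x → σ x = x) (x : G) (hx : tp x) (hNx : N x = 1) : x = 1 := by
  obtain ⟨e, he1, he2, -, -⟩ := tp_proj (G := G) (H := G)
  obtain ⟨z, rfl⟩ := hk x hNx
  rw [← he2 _ hx, div_pow, ← map_pow, ht _ (he1 z), div_self']

theorem inj_step [Finite G] (N : G →* H) (γ : G →* G) (γ0 : H →* H) (hγ4 : ∀ x, γ (γ (γ (γ x))) = x)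
    (hk : ∀ y, N y = 1 → ∃ z, y = z / γ (γ z)) (hN : ∀ x, N (γ x) = γ0 (N x))
    (ht : ∀ x, tp x → γ0 x = x) (x : G) (hx : tp x) (hNx : N x = 1) : x = 1 := by
  obtain ⟨e, he1, he2, -, -⟩ := tp_proj (G := G) (H := G)
  have hB : ∀ x, tp x → ∃ z, tp z ∧ x / γ x = (z / γ z) * γ (z / γ z) := by
    intro x hx
    obtain ⟨z, hz⟩ := hk (x / γ x) (by rw [map_div, hN, ht _ (tp_map N hx), div_self'])
    refine ⟨z ^ e, he1 z, ?_⟩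
    have : (x / γ x) ^ e = x / γ x := he2 _ (tp_div hx (tp_map γ hx))
    rw [← this, hz, map_div, div_mul_div_cancel, div_pow, ← map_pow, ← map_pow]
  have hB2 : ∀ x, tp x → ∃ w, tp w ∧ x / γ x = (w / γ w) ^ 2 := by
    intro x hx
    obtain ⟨z1, h1, e1⟩ := hB x hx
    obtain ⟨z2, h2, e2⟩ := hB z1 h1
    obtain ⟨z3, h3, e3⟩ := hB z2 h2
    obtain ⟨z, h4, e4⟩ := hB z3 h3
    refine ⟨z * γ z ^ 2 * γ (γ z) ^ 3 * γ (γ (γ z)) ^ 2, ?_, ?_⟩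
    · exact tp_mul (tp_mul (tp_mul h4 (tp_pow (tp_map γ h4) _)) (tp_pow (tp_map γ (tp_map γ h4)) _))
        (tp_pow (tp_map γ (tp_map γ (tp_map γ h4))) _)
    · set b := z / γ z with hb
      have e5 : z * γ z ^ 2 * γ (γ z) ^ 3 * γ (γ (γ z)) ^ 2 / γ (z * γ z ^ 2 * γ (γ z) ^ 3 * γ (γ (γ z)) ^ 2)
        = b * γ b ^ 2 * γ (γ b) ^ 3 * γ (γ (γ b)) ^ 2 := by
        rw [hb]
        simp only [map_mul, map_pow, map_div]
        simp only [div_pow, div_mul_div_comm]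
      rw [e5, e1, e2, e3, e4]
      have e6 : γ (γ (γ (γ b))) = b := hγ4 b
      simp only [map_mul, e6]
      apply Additive.ofMul.injective
      simp only [ofMul_mul, ofMul_pow]
      abel
  have hB3 : ∀ k : ℕ, ∀ x, tp x → ∃ w, tp w ∧ x / γ x = (w / γ w) ^ 2 ^ k := by
    intro k
    induction k with
    | zero => exact fun x hx => ⟨x, hx, by simp⟩
    | succ k ih =>
      intro x hx
      obtain ⟨w, hw, h⟩ := ih x hx
      obtain ⟨v, hv, h'⟩ := hB2 w hw
      exact ⟨v, hv, by rw [h, h', ← pow_mul, pow_succ']⟩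
  obtain ⟨k, m, hm, hnm⟩ := Nat.exists_eq_two_pow_mul_odd (Nat.card_pos (α := G)).ne'
  have htriv : ∀ x, tp x → γ x = x := by
    intro x hx
    obtain ⟨w, hw, h⟩ := hB3 k x hx
    obtain ⟨j, hj⟩ := tp_div hx (tp_map γ hx)
    have h1 : (x / γ x) ^ m = 1 := by
      rw [h, ← pow_mul, ← hnm, pow_card_eq_one']
    have h2 := pow_gcd_eq_one.2 ⟨hj, h1⟩
    have h3 : Nat.gcd (2 ^ j) m = 1 := ((Nat.coprime_two_left.2 hm).pow_left j)
    rw [h3, pow_one, div_eq_one] at h2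
    exact h2.symm
  refine inj_of_triv N (γ.comp γ) hk (fun x hx => ?_) x hx hNx
  change γ (γ x) = x
  rw [htriv x hx, htriv x hx]

theorem surj_step [Finite G] [Finite H] {G0 : Type*} [CommGroup G0] [Finite G0] (N : G →* H) (N0 : H →* G0)
    (hN : Function.Surjective (N0.comp N)) (hinj : ∀ y, tp y → N0 y = 1 → y = 1)
    (hsq : ∀ y, ∃ x, N x = y ^ 2) : Function.Surjective N := by
  obtain ⟨e, he1, he2, he3, he4⟩ := tp_proj (G := G) (H := H)
  intro y
  -- y = y^e * (y / y^e)
  obtain ⟨x, hx⟩ := hN (N0 (y ^ e))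
  change N0 (N x) = _ at hx
  obtain ⟨f, -, -, hf3, hf4⟩ := tp_proj (G := G0) (H := H)
  have h1 : N (x ^ f) = y ^ e := by
    have htp : tp (N (x ^ f)) := by rw [map_pow]; exact hf3 _
    refine div_eq_one.1 (hinj _ (tp_div htp (he3 y)) ?_)
    rw [map_div, map_pow, map_pow, hx, ← map_pow, hf4 _ (he3 y), div_self']
  obtain ⟨k, m, hm, hnm⟩ := Nat.exists_eq_two_pow_mul_odd (Nat.card_pos (α := H)).ne'
  have h2 : (y / y ^ e) ^ m = 1 := by
    have hz : tp ((y / y ^ e) ^ m) := ⟨k, by rw [← pow_mul, mul_comm m, ← hnm, pow_card_eq_one']⟩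
    rw [← he4 _ hz, ← pow_mul, mul_comm, pow_mul, div_pow, he4 _ (he3 y), div_self', one_pow]
  obtain ⟨t, ht⟩ := hm
  obtain ⟨v, hv⟩ := hsq ((y / y ^ e) ^ (t + 1))
  refine ⟨x ^ f * v, ?_⟩
  rw [map_mul, h1, hv, ← pow_mul, show (t + 1) * 2 = m + 1 by omega, pow_succ, h2, one_mul,
    mul_div_cancel]

theorem cyc_of_tors [Finite G] (h2 : ∀ x : G, tp x) (h4 : Nat.card {x : G // x ^ 2 = 1} ≤ 2) : IsCyclic G := by
  classical
  have hk : ∀ k : ℕ, Nat.card (powMonoidHom (2 ^ k) : G →* G).ker ≤ 2 ^ k := by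
    intro k
    induction k with
    | zero =>
      have : (powMonoidHom (2 ^ 0) : G →* G).ker = ⊥ := by
        ext x; simp [MonoidHom.mem_ker]
      rw [this]; simp
    | succ k ih =>
      set A := (powMonoidHom (2 ^ (k + 1)) : G →* G).ker
      set B := (powMonoidHom (2 ^ k) : G →* G).ker
      have h1 := Subgroup.relIndex_ker A (powMonoidHom 2 : G →* G)
      have h3 : Nat.card (A.map (powMonoidHom 2 : G →* G)) ≤ Nat.card B := by
        refine Subgroup.card_le_of_le ?_
        rintro _ ⟨x, hx, rfl⟩
        have : x ^ 2 ^ (k + 1) = 1 := hx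
        change (x ^ 2) ^ 2 ^ k = 1
        rw [← pow_mul, ← pow_succ', this]
      have h5 : Nat.card ((powMonoidHom 2 : G →* G).ker) ≤ 2 := h4
      have h6 := Subgroup.relIndex_mul_relIndex ⊥ ((powMonoidHom 2 : G →* G).ker) A bot_le (by
        intro x hx
        have : x ^ 2 = 1 := hx
        change x ^ 2 ^ (k + 1) = 1
        rw [pow_succ', pow_mul, this, one_pow])
      rw [Subgroup.relIndex_bot_left, Subgroup.relIndex_bot_left] at h6
      rw [← h6, h1, pow_succ, mul_comm]
      exact Nat.mul_le_mul (h3.trans ih) h5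
  have := Fintype.ofFinite G
  refine isCyclic_of_card_pow_eq_one_le ?_
  intro n hn
  obtain ⟨k, m, hm, hnm⟩ := Nat.exists_eq_two_pow_mul_odd hn.ne'
  have hcard := hk k
  refine le_trans (le_trans ?_ hcard) (by rw [hnm]; exact Nat.le_mul_of_pos_right _ hm.pos)
  rw [Nat.card_eq_fintype_card, ← Fintype.card_coe]
  refine Fintype.card_le_of_injective (fun a => ⟨a.1, ?_⟩) (fun a b h => ?_)
  · have ha : (a : G) ^ n = 1 := (Finset.mem_filter.1 a.2).2
    obtain ⟨j, hj⟩ := h2 a.1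
    have h1 := pow_gcd_eq_one.2 ⟨hj, ha⟩
    change (a : G) ^ 2 ^ k = 1
    refine orderOf_dvd_iff_pow_eq_one.1 ((orderOf_dvd_of_pow_eq_one h1).trans ?_)
    rw [hnm]
    have : Nat.Coprime (Nat.gcd (2 ^ j) (2 ^ k * m)) m :=
      Nat.Coprime.coprime_dvd_left (Nat.gcd_dvd_left _ _) ((Nat.coprime_two_left.2 hm).pow_left j)
    exact this.dvd_of_dvd_mul_right (Nat.gcd_dvd_right _ _)
  · exact Subtype.ext (congrArg (fun z => z.1) h)

theorem struct_lemma [Finite G] (m : ℕ) (hc : Nat.card G = 2 ^ (m + 1))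
    (h4 : Nat.card {x : G // x ^ 2 = 1} ≤ 4) (p : G) (hp : p ^ 2 = 1) (hps : ∀ y : G, y ^ 2 ≠ p) :
    Nonempty (G ≃* Multiplicative (ZMod 2 × ZMod (2 ^ m))) := by
  classical
  have htp : ∀ x : G, tp x := fun x => ⟨m + 1, by rw [← hc, pow_card_eq_one']⟩
  have hp1 : p ≠ 1 := fun h => hps 1 (by rw [h, one_pow])
  -- maximal subgroup containing squares, avoiding p
  let Q : Set (Subgroup G) := {C | (∀ y : G, y ^ 2 ∈ C) ∧ p ∉ C}
  have hQ : (powMonoidHom 2 : G →* G).range ∈ Q :=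
    ⟨fun y => ⟨y, rfl⟩, by rintro ⟨y, hy⟩; exact hps y hy⟩
  obtain ⟨C, -, hCmax⟩ := (Set.toFinite Q).exists_le_maximal hQ
  have hCsq := hCmax.prop.1
  have hCp := hCmax.prop.2
  have hcov : ∀ x : G, x ∈ C ∨ x * p ∈ C := by
    intro x
    by_contra! hx
    obtain ⟨hx1, hx2⟩ := hx
    let C' : Subgroup G := C ⊔ Subgroup.zpowers x
    have hlt : p ∈ C' := by
      by_contra hpC
      have := hCmax.le_of_ge (y := C') ⟨fun y => Subgroup.mem_sup_left (hCsq y), hpC⟩ le_sup_left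
      exact hx1 (this (Subgroup.mem_sup_right (Subgroup.mem_zpowers x)))
    obtain ⟨c, hc, z, hz, hcz⟩ := Subgroup.mem_sup.1 hlt
    obtain ⟨k, rfl⟩ := Subgroup.mem_zpowers_iff.1 hz
    have hxx : x ^ (2 : ℤ) ∈ C := by exact_mod_cast hCsq x
    rcases Int.even_or_odd' k with ⟨t, rfl | rfl⟩
    · apply hCp
      rw [← hcz, zpow_mul]
      exact mul_mem hc (C.zpow_mem hxx t)
    · apply hx2
      rw [← hcz, zpow_add, zpow_mul, zpow_one]
      have : x * (c * ((x ^ (2 : ℤ)) ^ t * x)) = c * (x ^ (2 : ℤ)) ^ t * x ^ 2 := by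
        apply Additive.ofMul.injective
        simp only [ofMul_mul, ofMul_pow, ofMul_zpow]
        abel
      rw [this]
      exact mul_mem (mul_mem hc (C.zpow_mem hxx t)) (hCsq x)
  have hpp : p * p = 1 := by rw [← sq, hp]
  let Z := Subgroup.zpowers p
  have hord : orderOf p = 2 := orderOf_eq_prime hp hp1
  have hZc : Nat.card Z = 2 := by rw [Nat.card_zpowers, hord]
  have hZ : ∀ z ∈ Z, z = 1 ∨ z = p := by
    intro z hz
    obtain ⟨k, rfl⟩ := Subgroup.mem_zpowers_iff.1 hz
    have hp' : p ^ (2 : ℤ) = 1 := by exact_mod_cast hp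
    rcases Int.even_or_odd' k with ⟨t, rfl | rfl⟩
    · left; rw [zpow_mul, hp', one_zpow]
    · right; rw [zpow_add, zpow_mul, hp', one_zpow, one_mul, zpow_one]
  let f : Z × C →* G := Z.subtype.coprod C.subtype
  have hf : ∀ a : Z × C, f a = (a.1 : G) * (a.2 : G) := fun a => rfl
  have hbij : Function.Bijective f := by
    constructor
    · rw [injective_iff_map_eq_one]
      rintro ⟨⟨z, hz⟩, ⟨c, hc⟩⟩ h
      rw [hf] at h
      change z * c = 1 at h
      rcases hZ z hz with rfl | rfl
      · rw [one_mul] at h; subst h; rfl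
      · exfalso
        apply hCp
        rw [eq_inv_of_mul_eq_one_left h]
        exact inv_mem hc
    · intro x
      rcases hcov x with h | h
      · exact ⟨(1, ⟨x, h⟩), by rw [hf]; simp⟩
      · refine ⟨(⟨p, Subgroup.mem_zpowers p⟩, ⟨x * p, h⟩), ?_⟩
        rw [hf]
        change p * (x * p) = x
        rw [mul_comm x p, ← mul_assoc, hpp, one_mul]
  let e : Z × C ≃* G := MulEquiv.ofBijective f hbij
  have hCc : Nat.card C = 2 ^ m := by
    have := Nat.card_congr e.toEquiv
    rw [Nat.card_prod, hZc, hc, pow_succ'] at this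
    omega
  have hcyc : IsCyclic C := by
    refine cyc_of_tors (fun x => ?_) ?_
    · obtain ⟨k, hk⟩ := htp (x : G)
      exact ⟨k, Subtype.ext (by simpa using hk)⟩
    · have hinj : Function.Injective
        (fun a : Z × {x : C // x ^ 2 = 1} => (⟨(a.1 : G) * (a.2.1 : G), by
          rcases hZ a.1 a.1.2 with h | h
          · have := congrArg Subtype.val a.2.2
            rw [h, one_mul]; exact this
          · have := congrArg Subtype.val a.2.2
            rw [h, mul_pow, hp, one_mul]; exact this⟩ : {x : G // x ^ 2 = 1})) := by
        intro a b h
        have h1 : f (a.1, a.2.1) = f (b.1, b.2.1) := congrArg Subtype.val h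
        have h3 := hbij.1 h1
        rw [Prod.mk.injEq] at h3
        exact Prod.ext h3.1 (Subtype.ext h3.2)
      have := Nat.card_le_card_of_injective _ hinj
      rw [Nat.card_prod, hZc] at this
      omega
  have e1 : Z ≃* Multiplicative (ZMod 2) := mulEquivOfCyclicCardEq (by
    rw [hZc]; simp)
  have e2 : C ≃* Multiplicative (ZMod (2 ^ m)) := mulEquivOfCyclicCardEq (by
    rw [hCc]; simp)
  exact ⟨(e.symm.trans (MulEquiv.prodCongr e1 e2)).trans (MulEquiv.prodMultiplicative _ _).symm⟩

theorem sylow_lemma [Finite G] [Finite H] (N : G →* H) (hN : Function.Surjective N)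
    (hinj : ∀ x, tp x → N x = 1 → x = 1) (m : ℕ)
    (hc : 2 ^ ((Nat.card H).factorization 2) = 2 ^ (m + 1))
    (h4 : Nat.card {x : H // x ^ 2 = 1} ≤ 4) (p : H) (hp : p ^ 2 = 1) (hps : ∀ y : H, y ^ 2 ≠ p)
    (P : Sylow 2 G) : Nonempty (P ≃* Multiplicative (ZMod 2 × ZMod (2 ^ m))) := by
  have hP : ∀ x : G, x ∈ P ↔ tp x := by
    intro x
    constructor
    · intro hx
      obtain ⟨k, hk⟩ := P.isPGroup' ⟨x, hx⟩
      exact ⟨k, by simpa using congrArg Subtype.val hk⟩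
    · intro hx
      let S : Subgroup G := { carrier := {x | tp x}, mul_mem' := tp_mul, one_mem' := tp_one, inv_mem' := tp_inv }
      have hS : IsPGroup 2 S := by
        rintro ⟨y, k, hk⟩
        exact ⟨k, Subtype.ext (by simpa using hk)⟩
      have hle : (P : Subgroup G) ≤ S := by
        intro y hy
        obtain ⟨k, hk⟩ := P.isPGroup' ⟨y, hy⟩
        exact ⟨k, by simpa using congrArg Subtype.val hk⟩
      have := P.is_maximal' hS hle
      have hxS : x ∈ S := hx
      rw [this] at hxS
      exact hxS
  obtain ⟨e, he1, he2, he3, he4⟩ := tp_proj (G := G) (H := H)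
  let S : Subgroup H := { carrier := {x | tp x}, mul_mem' := tp_mul, one_mem' := tp_one, inv_mem' := tp_inv }
  have hS : IsPGroup 2 S := by
    rintro ⟨y, k, hk⟩
    exact ⟨k, Subtype.ext (by simpa using hk)⟩
  obtain ⟨PS, hPS⟩ := hS.exists_le_sylow
  have hPS' : (PS : Subgroup H) = S := by
    refine le_antisymm ?_ hPS
    intro y hy
    obtain ⟨k, hk⟩ := PS.isPGroup' ⟨y, hy⟩
    exact ⟨k, by simpa using congrArg Subtype.val hk⟩
  have hScard : Nat.card S = 2 ^ (m + 1) := by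
    have := PS.card_eq_multiplicity
    rw [← hc, ← this, ← hPS']
  let f : P →* S := (N.comp (P : Subgroup G).subtype).codRestrict S (fun x => tp_map N ((hP x).1 x.2))
  have hf : Function.Bijective f := by
    constructor
    · rw [injective_iff_map_eq_one]
      intro x hx
      exact Subtype.ext (hinj x ((hP x).1 x.2) (congrArg Subtype.val hx))
    · rintro ⟨y, hy⟩
      obtain ⟨x, rfl⟩ := hN y
      refine ⟨⟨x ^ e, (hP _).2 (he1 x)⟩, Subtype.ext ?_⟩
      change N (x ^ e) = N x
      rw [map_pow, he4 _ hy]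
  have hpt : tp p := ⟨1, by simpa using hp⟩
  obtain ⟨g⟩ := struct_lemma (G := S) m hScard (by
      refine le_trans (Nat.card_le_card_of_injective
        (fun a : {x : S // x ^ 2 = 1} => (⟨a.1.1, congrArg Subtype.val a.2⟩ : {x : H // x ^ 2 = 1})) ?_) h4
      intro a b h
      have h' : (a.1.1 : H) = b.1.1 := congrArg (fun z : {x : H // x ^ 2 = 1} => z.1) h
      exact Subtype.ext (Subtype.ext h')) ⟨p, hpt⟩ (Subtype.ext hp)
      (fun y hy => hps y (congrArg Subtype.val hy))
  exact ⟨(MulEquiv.ofBijective f hf).trans g⟩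

end grp

end

section

section pell

theorem leg_one (p : ℕ) [Fact p.Prime] (A m n : ℤ) (hn : ¬ (p : ℤ) ∣ n) (h : (p : ℤ) ∣ A * m ^ 2 - n ^ 2) :
    legendreSym p A = 1 := by
  have hn' : ((n : ℤ) : ZMod p) ≠ 0 := by rwa [Ne, ZMod.intCast_zmod_eq_zero_iff_dvd]
  have h1 : ((A * m ^ 2 : ℤ) : ZMod p) = ((n ^ 2 : ℤ) : ZMod p) := by
    rw [← sub_eq_zero, ← Int.cast_sub, ZMod.intCast_zmod_eq_zero_iff_dvd]; exact h
  have h2 : legendreSym p (A * m ^ 2) = legendreSym p (n ^ 2) := by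
    unfold legendreSym; rw [h1]
  rw [legendreSym.mul, legendreSym.sq_one' p hn'] at h2
  have hm : ((m : ℤ) : ZMod p) ≠ 0 := by
    intro hm
    push_cast at h1
    rw [hm] at h1
    exact hn' (by simpa using h1.symm)
  rwa [legendreSym.sq_one' p hm, mul_one] at h2

/-- `2 ∤`-version -/
theorem leg_four (p : ℕ) [Fact p.Prime] (hp : p ≠ 2) (A m : ℤ) (h : (p : ℤ) ∣ A * m ^ 2 - 4) :
    legendreSym p A = 1 := by
  refine leg_one p A m 2 ?_ (by norm_num; exact h)
  intro h2
  have := (Nat.prime_dvd_prime_iff_eq (Fact.out : p.Prime) Nat.prime_two).1 (by exact_mod_cast h2)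
  exact hp this

theorem pell_split (D : ℕ) (hD : Squarefree D) (γ γ' : ℤ) (hγ : 1 < γ) (hγ' : 0 < γ')
    (h : γ ^ 2 - D * γ' ^ 2 = 1) : ∃ g D1 d1 : ℕ, ∃ m k : ℤ, g * D1 = D ∧ (d1 = 1 ∨ d1 = 2) ∧
      m ≠ 0 ∧ k ≠ 0 ∧ Squarefree (g * d1) ∧ 
      2 * (γ + 1) = g * d1 * m ^ 2 ∧ 2 * (γ - 1) = D1 * d1 * k ^ 2 := by
  obtain ⟨d, m, hdm, hd⟩ := Nat.sq_mul_squarefree (2 * (γ + 1)).toNat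
  have hdm' : ((m : ℤ) ^ 2 * d) = 2 * (γ + 1) := by
    have : (((2 * (γ + 1)).toNat : ℕ) : ℤ) = 2 * (γ + 1) := Int.toNat_of_nonneg (by linarith)
    rw [← this, ← hdm]; push_cast; ring
  have hm0 : (m : ℤ) ≠ 0 := by
    intro h0; rw [h0] at hdm'; norm_num at hdm'; linarith
  have hd0 : d ≠ 0 := hd.ne_zero
  have e1 : (d : ℤ) * (2 * (γ - 1)) * m ^ 2 = D * (2 * γ') ^ 2 := by
    have : (d : ℤ) * (2 * (γ - 1)) * m ^ 2 = (m ^ 2 * d) * (2 * (γ - 1)) := by ring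
    rw [this, hdm']
    linear_combination 4 * h
  have hmd : (m : ℤ) ∣ 2 * γ' := by
    have hsq : (m : ℤ) ^ 2 ∣ D * (2 * γ') ^ 2 := ⟨_, by rw [← e1, mul_comm]⟩
    have h1 : m ^ 2 ∣ D * (2 * γ'.natAbs) ^ 2 := by
      have := Int.natAbs_dvd_natAbs.2 hsq
      simpa [Int.natAbs_mul, Int.natAbs_pow] using this
    have h2 : m ∣ 2 * γ'.natAbs := by
      -- gcd argument
      set n := 2 * γ'.natAbs with hn
      have hn0 : 0 < n := by
        have : γ'.natAbs ≠ 0 := Int.natAbs_ne_zero.2 hγ'.ne'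
        omega
      obtain ⟨t, m', n', ht, hcop, hmt, hnt⟩ := Nat.exists_coprime' (Nat.gcd_pos_of_pos_right m hn0)
      rw [hmt, hnt] at h1 ⊢
      have h3 : m' ^ 2 ∣ D * n' ^ 2 := by
        have : m' ^ 2 * t ^ 2 ∣ D * n' ^ 2 * t ^ 2 := by
          convert h1 using 1 <;> ring
        exact Nat.dvd_of_mul_dvd_mul_right (pow_pos ht 2) this
      have h4 : m' ^ 2 ∣ D := (hcop.pow 2 2).dvd_of_dvd_mul_right h3
      have h5 := hD m' (by rwa [← sq])
      rw [Nat.isUnit_iff] at h5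
      rw [h5, one_mul]
      exact Nat.dvd_mul_left _ _
    have := Int.natCast_dvd_natCast.2 h2
    rwa [Nat.cast_mul, Int.natCast_natAbs, abs_of_pos hγ'] at this
  obtain ⟨k, hk⟩ := hmd
  have e2 : (d : ℤ) * (2 * (γ - 1)) = D * k ^ 2 := by
    rw [hk] at e1
    have : (d : ℤ) * (2 * (γ - 1)) * m ^ 2 = D * k ^ 2 * m ^ 2 := by rw [e1]; ring
    exact mul_right_cancel₀ (pow_ne_zero 2 hm0) this
  obtain ⟨g, d1, D1, hg, hcop, hd1, hD1⟩ := Nat.exists_coprime' (Nat.gcd_pos_of_pos_left D (Nat.pos_of_ne_zero hd0))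
  have hg0 : (g : ℤ) ≠ 0 := by exact_mod_cast hg.ne'
  have e3 : (d1 : ℤ) * (2 * (γ - 1)) = D1 * k ^ 2 := by
    rw [hd1, hD1] at e2
    push_cast at e2
    have : (g : ℤ) * (d1 * (2 * (γ - 1))) = g * (D1 * k ^ 2) := by linear_combination e2
    exact mul_left_cancel₀ hg0 this
  have hsd1 : Squarefree d1 := by
    rw [hd1] at hd; exact hd.of_mul_left
  have hd1k : (d1 : ℤ) ∣ k := by
    have h1 : (d1 : ℤ) ∣ D1 * k ^ 2 := ⟨_, e3.symm⟩
    have h2 : (d1 : ℤ) ∣ k ^ 2 := (Nat.isCoprime_iff_coprime.2 hcop).dvd_of_dvd_mul_left h1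
    have h3 : d1 ∣ k.natAbs ^ 2 := by
      rw [← Int.natAbs_pow]; exact Int.natCast_dvd.1 h2
    rw [Int.natCast_dvd]
    exact (hsd1.dvd_pow_iff_dvd two_ne_zero).1 h3
  obtain ⟨k1, rfl⟩ := hd1k
  have hd10 : (d1 : ℤ) ≠ 0 := by exact_mod_cast hsd1.ne_zero
  have e4 : 2 * (γ - 1) = D1 * d1 * k1 ^ 2 := by
    refine mul_left_cancel₀ hd10 ?_
    rw [e3]; ring
  have e5 : 2 * (γ + 1) = g * d1 * m ^ 2 := by
    rw [← hdm', hd1]; push_cast; ring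
  refine ⟨g, D1, d1, m, k1, by rw [hD1, mul_comm], ?_, hm0, ?_, by rwa [mul_comm, ← hd1], e5, e4⟩
  · have : (d1 : ℤ) ∣ 4 := ⟨g * m ^ 2 - D1 * k1 ^ 2, by linear_combination e5 - e4⟩
    have h4 : d1 ∣ 4 := by exact_mod_cast this
    have : d1 ≤ 4 := Nat.le_of_dvd (by norm_num) h4
    have hns : d1 ≠ 4 := by
      rintro rfl
      have := hsd1 2 (by norm_num)
      rw [Nat.isUnit_iff] at this
      omega
    interval_cases d1 <;> simp_all <;> omega
  · rintro rfl
    norm_num at e4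
    linarith

theorem dvd_split {ℓ g D1 D0 : ℕ} (hℓ : ℓ.Prime) (h : g * D1 = ℓ * D0) :
    (∃ g', g = ℓ * g' ∧ g' * D1 = D0) ∨ (∃ D', D1 = ℓ * D' ∧ g * D' = D0) := by
  have : ℓ ∣ g * D1 := ⟨D0, h⟩
  rcases (hℓ.dvd_mul).1 this with ⟨g', rfl⟩ | ⟨D', rfl⟩
  · left
    refine ⟨g', rfl, ?_⟩
    rw [mul_assoc] at h
    exact Nat.eq_of_mul_eq_mul_left hℓ.pos h
  · right
    refine ⟨D', rfl, ?_⟩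
    rw [mul_left_comm] at h
    exact Nat.eq_of_mul_eq_mul_left hℓ.pos h

theorem leg_cond (p : ℕ) [Fact p.Prime] (hp : p ≠ 2) (A B m k : ℤ) (h : A * m ^ 2 - B * k ^ 2 = 4) :
    ((p : ℤ) ∣ B → legendreSym p A = 1) ∧ ((p : ℤ) ∣ A → legendreSym p (-1 * B) = 1) := by
  constructor
  · rintro ⟨c, hc⟩
    exact leg_four p hp A m ⟨c * k ^ 2, by linear_combination h + hc * k ^ 2⟩
  · rintro ⟨c, hc⟩
    exact leg_four p hp _ k ⟨-c * m ^ 2, by linear_combination h - hc * m ^ 2⟩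

theorem pell_min (D : ℕ) (hD : D % 4 = 2 ∨ D % 4 = 3) (γ : ℤ) (hγ : 1 < γ) (m k : ℤ) (hm : m ≠ 0) (hk : k ≠ 0)
    (hfund : ∀ a b : ℤ, 0 < a → 0 < b → a ^ 2 - (D : ℤ) * b ^ 2 = 1 → γ ≤ a)
    (h1 : 2 * (γ + 1) = m ^ 2) (h2 : 2 * (γ - 1) = D * k ^ 2) : False := by
  have hmk : m ^ 2 - D * k ^ 2 = 4 := by linear_combination h2 - h1
  have hm2 : m % 2 = 0 := by
    have : (m ^ 2) % 2 = 0 := by omega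
    rcases Int.emod_two_eq_zero_or_one m with h | h
    · exact h
    · rw [sq, Int.mul_emod, h] at this; norm_num at this
  obtain ⟨a, rfl⟩ : (2 : ℤ) ∣ m := Int.dvd_of_emod_eq_zero hm2
  have hk2 : k % 2 = 0 := by
    rcases Int.emod_two_eq_zero_or_one k with h | h
    · exact h
    · exfalso
      have e : (D : ℤ) * k ^ 2 = 4 * (a ^ 2 - 1) := by linear_combination -hmk
      obtain ⟨b, rfl⟩ : ∃ b, k = 2 * b + 1 := ⟨k / 2, by omega⟩
      have e2 : (D : ℤ) = 4 * (a ^ 2 - 1 - D * (b ^ 2 + b)) := by linear_combination e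
      omega
  obtain ⟨b, rfl⟩ : (2 : ℤ) ∣ k := Int.dvd_of_emod_eq_zero hk2
  have ha : a ≠ 0 := by rintro rfl; simp at hm
  have hb : b ≠ 0 := by rintro rfl; simp at hk
  have := hfund |a| |b| (abs_pos.2 ha) (abs_pos.2 hb) (by rw [sq_abs, sq_abs]; linarith)
  have h3 : γ + 1 = 2 * a ^ 2 := by linarith
  rw [← sq_abs] at h3
  nlinarith

section four
variable (q r s : ℕ) [Fact q.Prime] [Fact r.Prime] [Fact s.Prime]

structure LegData (q r s : ℕ) [Fact q.Prime] [Fact r.Prime] [Fact s.Prime] (e : ℤ) : Prop where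
  q4 : q % 4 = 3
  r8 : r % 8 = 5
  s8 : s % 8 = 5
  ne : r ≠ s
  rq : legendreSym r q = e
  sq : legendreSym s q = e
  qr : legendreSym q r = e
  qs : legendreSym q s = e
  rs : legendreSym r s = 1
  sr : legendreSym s r = 1
  r2 : legendreSym r 2 = -1
  s2 : legendreSym s 2 = -1
  rm : legendreSym r (-1) = 1
  sm : legendreSym s (-1) = 1
  qm : legendreSym q (-1) = -1

theorem legData (e : ℤ) (hq4 : q % 4 = 3) (hr8 : r % 8 = 5) (hs8 : s % 8 = 5)
    (hqr : legendreSym r q = e) (hqs : legendreSym s q = e) (hrs : legendreSym s r = 1) : LegData q r s e where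
  q4 := hq4
  r8 := hr8
  s8 := hs8
  ne := by
    rintro rfl
    rw [show ((r : ℕ) : ℤ) = ((r : ℕ) : ℤ) from rfl, (legendreSym.eq_zero_iff r r).2 (by simp)] at hrs
    norm_num at hrs
  rq := hqr
  sq := hqs
  qr := by rw [← hqr]; exact legendreSym.quadratic_reciprocity_one_mod_four (by omega) (by omega)
  qs := by rw [← hqs]; exact legendreSym.quadratic_reciprocity_one_mod_four (by omega) (by omega)
  rs := by rw [← hrs]; exact (legendreSym.quadratic_reciprocity_one_mod_four (by omega) (by omega)).symm
  sr := hrs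
  r2 := by
    rw [legendreSym.at_two (by omega), ZMod.χ₈_nat_eq_if_mod_eight]
    simp [hr8]; omega
  s2 := by
    rw [legendreSym.at_two (by omega), ZMod.χ₈_nat_eq_if_mod_eight]
    simp [hs8]; omega
  rm := by rw [legendreSym.at_neg_one (by omega), ZMod.χ₄_nat_one_mod_four (by omega)]
  sm := by rw [legendreSym.at_neg_one (by omega), ZMod.χ₄_nat_one_mod_four (by omega)]
  qm := by rw [legendreSym.at_neg_one (by omega), ZMod.χ₄_nat_three_mod_four hq4]


variable {q r s}

theorem LegData.sqf {e : ℤ} (H : LegData q r s e) : Squarefree (q * (r * s)) := by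
  have hq := (Fact.out : q.Prime)
  have hr := (Fact.out : r.Prime)
  have hs := (Fact.out : s.Prime)
  have h1 := H.q4
  have h2 := H.r8
  have h3 := H.s8
  have qr : q.Coprime r := (Nat.coprime_primes hq hr).2 (by rintro rfl; omega)
  have qs : q.Coprime s := (Nat.coprime_primes hq hs).2 (by rintro rfl; omega)
  have rs : r.Coprime s := (Nat.coprime_primes hr hs).2 H.ne
  rw [Nat.squarefree_mul (qr.mul_right qs), Nat.squarefree_mul rs]
  exact ⟨hq.squarefree, hr.squarefree, hs.squarefree⟩

theorem LegData.mod {e : ℤ} (H : LegData q r s e) : (q * (r * s)) % 4 = 3 := by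
  have h1 := H.q4
  have h2 := H.r8
  have h3 := H.s8
  have h2' : r % 4 = 1 := by omega
  have h3' : s % 4 = 1 := by omega
  rw [Nat.mul_mod, Nat.mul_mod r, h1, h2', h3']

theorem LegData.sqf2 {e : ℤ} (H : LegData q r s e) : Squarefree (2 * (q * (r * s))) := by
  have := H.mod
  rw [Nat.squarefree_mul (Nat.prime_two.coprime_iff_not_dvd.2 (by omega))]
  exact ⟨Nat.prime_two.squarefree, H.sqf⟩

theorem LegData.conds {e : ℤ} (H : LegData q r s e) {g D1 d1 : ℕ} {γ m k : ℤ}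
    (h1 : 2 * (γ + 1) = g * d1 * m ^ 2) (h2 : 2 * (γ - 1) = D1 * d1 * k ^ 2) :
    ((r ∣ D1 → legendreSym r (g * d1) = 1) ∧ (r ∣ g → legendreSym r (-1) * legendreSym r (D1 * d1) = 1)) ∧
    ((s ∣ D1 → legendreSym s (g * d1) = 1) ∧ (s ∣ g → legendreSym s (-1) * legendreSym s (D1 * d1) = 1)) ∧
    ((q ∣ D1 → legendreSym q (g * d1) = 1) ∧ (q ∣ g → legendreSym q (-1) * legendreSym q (D1 * d1) = 1)) := by
  have hh : ((g : ℤ) * d1) * m ^ 2 - (D1 * d1) * k ^ 2 = 4 := by linear_combination h2 - h1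
  have a1 := H.q4
  have a2 := H.r8
  have a3 := H.s8
  have dv : ∀ {a b : ℕ}, a ∣ b → (a : ℤ) ∣ b * d1 := fun h => Dvd.dvd.mul_right (Int.natCast_dvd_natCast.2 h) _
  exact ⟨⟨fun h => (leg_cond r (by omega) _ _ m k hh).1 (dv h), fun h => legendreSym.mul r _ _ ▸ (leg_cond r (by omega) _ _ m k hh).2 (dv h)⟩,
    ⟨fun h => (leg_cond s (by omega) _ _ m k hh).1 (dv h), fun h => legendreSym.mul s _ _ ▸ (leg_cond s (by omega) _ _ m k hh).2 (dv h)⟩,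
    ⟨fun h => (leg_cond q (by omega) _ _ m k hh).1 (dv h), fun h => legendreSym.mul q _ _ ▸ (leg_cond q (by omega) _ _ m k hh).2 (dv h)⟩⟩

theorem LegData.leg4 {e : ℤ} (H : LegData q r s e) : legendreSym q 4 = 1 :=
  leg_four q (by have := H.q4; omega) 4 1 (by norm_num)

theorem one_of_mul {g D : ℕ} (h : g * D = 1) : g = 1 ∧ D = 1 := by simpa using h

theorem pell_F1 (H : LegData q r s 1) (γ γ' : ℤ) (hγ : 1 < γ) (hγ' : 0 < γ')
    (h : γ ^ 2 - (q * (r * s) : ℕ) * γ' ^ 2 = 1)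
    (hfund : ∀ a b : ℤ, 0 < a → 0 < b → a ^ 2 - ((q * (r * s) : ℕ) : ℤ) * b ^ 2 = 1 → γ ≤ a)
    (hns : ¬ ∃ t : ℤ, 2 * (q : ℤ) * (γ - 1) = t ^ 2) :
    ∃ m : ℤ, m ≠ 0 ∧ ((2 * (γ + 1) = r * m ^ 2 ∨ 2 * (γ - 1) = r * m ^ 2) ∨
      (2 * (γ + 1) = s * m ^ 2 ∨ 2 * (γ - 1) = s * m ^ 2)) := by
  obtain ⟨g, D1, d1, m, k, hgD, hd1, hm, hk, hsq, e1, e2⟩ := pell_split _ H.sqf γ γ' hγ hγ' h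
  have hmin := fun h1 h2 => pell_min _ (Or.inr H.mod) γ hγ m k hm hk hfund h1 h2
  obtain ⟨⟨r1, r2⟩, ⟨s1, s2⟩, ⟨q1, q2⟩⟩ := H.conds e1 e2
  have hq := (Fact.out : q.Prime)
  have hr := (Fact.out : r.Prime)
  have hs := (Fact.out : s.Prime)
  rcases dvd_split hq hgD with ⟨g1, rfl, hg1⟩ | ⟨g1, rfl, hg1⟩ <;>
  rcases dvd_split hr hg1 with ⟨g2, rfl, hg2⟩ | ⟨g2, rfl, hg2⟩ <;>
  rcases dvd_split (D0 := 1) hs (hg2.trans (mul_one s).symm) with ⟨g3, rfl, hg3⟩ | ⟨g3, rfl, hg3⟩ <;>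
  obtain ⟨rfl, rfl⟩ := one_of_mul hg3 <;>
  rcases hd1 with rfl | rfl
  all_goals first
    | (have fr := r1 (dvd_mul_right _ _))
    | (have fr := r2 (dvd_mul_right _ _))
    | (have fr := r1 (Dvd.dvd.mul_left (dvd_mul_right _ _) _))
    | (have fr := r2 (Dvd.dvd.mul_left (dvd_mul_right _ _) _))
    | (have fr := r1 (Dvd.dvd.mul_left (Dvd.dvd.mul_left (dvd_mul_right _ _) _) _))
    | (have fr := r2 (Dvd.dvd.mul_left (Dvd.dvd.mul_left (dvd_mul_right _ _) _) _))
    | (have fr := r1 (Dvd.dvd.mul_left (Dvd.dvd.mul_left (Dvd.dvd.mul_left (dvd_mul_right _ _) _) _) _))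
    | (have fr := r2 (Dvd.dvd.mul_left (Dvd.dvd.mul_left (Dvd.dvd.mul_left (dvd_mul_right _ _) _) _) _))
  all_goals first
    | (have fs := s1 (dvd_mul_right _ _))
    | (have fs := s2 (dvd_mul_right _ _))
    | (have fs := s1 (Dvd.dvd.mul_left (dvd_mul_right _ _) _))
    | (have fs := s2 (Dvd.dvd.mul_left (dvd_mul_right _ _) _))
    | (have fs := s1 (Dvd.dvd.mul_left (Dvd.dvd.mul_left (dvd_mul_right _ _) _) _))
    | (have fs := s2 (Dvd.dvd.mul_left (Dvd.dvd.mul_left (dvd_mul_right _ _) _) _))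
    | (have fs := s1 (Dvd.dvd.mul_left (Dvd.dvd.mul_left (Dvd.dvd.mul_left (dvd_mul_right _ _) _) _) _))
    | (have fs := s2 (Dvd.dvd.mul_left (Dvd.dvd.mul_left (Dvd.dvd.mul_left (dvd_mul_right _ _) _) _) _))
  all_goals first
    | (have fq := q1 (dvd_mul_right _ _))
    | (have fq := q2 (dvd_mul_right _ _))
    | (have fq := q1 (Dvd.dvd.mul_left (dvd_mul_right _ _) _))
    | (have fq := q2 (Dvd.dvd.mul_left (dvd_mul_right _ _) _))
    | (have fq := q1 (Dvd.dvd.mul_left (Dvd.dvd.mul_left (dvd_mul_right _ _) _) _))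
    | (have fq := q2 (Dvd.dvd.mul_left (Dvd.dvd.mul_left (dvd_mul_right _ _) _) _))
    | (have fq := q1 (Dvd.dvd.mul_left (Dvd.dvd.mul_left (Dvd.dvd.mul_left (dvd_mul_right _ _) _) _) _))
    | (have fq := q2 (Dvd.dvd.mul_left (Dvd.dvd.mul_left (Dvd.dvd.mul_left (dvd_mul_right _ _) _) _) _))
  all_goals simp [legendreSym.mul, H.rq, H.sq, H.qr, H.qs, H.rs, H.sr, H.r2, H.s2, H.rm, H.sm, H.qm, H.leg4] at fr fs fq
  all_goals push_cast at e1 e2 hmin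
  all_goals first
    | exact ⟨m, hm, Or.inl (Or.inl (by linarith))⟩
    | exact ⟨m, hm, Or.inr (Or.inl (by linarith))⟩
    | exact (hns ⟨q * k, by linear_combination q * e2⟩).elim
    | exact (hmin (by linarith) (by linarith)).elim

theorem pell_F2 (H : LegData q r s (-1)) (γ γ' : ℤ) (hγ : 1 < γ) (hγ' : 0 < γ')
    (h : γ ^ 2 - (2 * (q * (r * s)) : ℕ) * γ' ^ 2 = 1)
    (hfund : ∀ a b : ℤ, 0 < a → 0 < b → a ^ 2 - ((2 * (q * (r * s)) : ℕ) : ℤ) * b ^ 2 = 1 → γ ≤ a)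
    (hns : ¬ ∃ t : ℤ, (q : ℤ) * (γ - 1) = t ^ 2) :
    ∃ m : ℤ, m ≠ 0 ∧ ((2 * (γ + 1) = r * m ^ 2 ∨ 2 * (γ - 1) = r * m ^ 2) ∨
      (2 * (γ + 1) = s * m ^ 2 ∨ 2 * (γ - 1) = s * m ^ 2)) := by
  obtain ⟨g, D1, d1, m, k, hgD, hd1, hm, hk, hsq, e1, e2⟩ := pell_split _ H.sqf2 γ γ' hγ hγ' h
  have hmin := fun h1 h2 => pell_min _ (Or.inl (by have := H.mod; omega)) γ hγ m k hm hk hfund h1 h2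
  obtain ⟨⟨r1, r2⟩, ⟨s1, s2⟩, ⟨q1, q2⟩⟩ := H.conds e1 e2
  have hq := (Fact.out : q.Prime)
  have hr := (Fact.out : r.Prime)
  have hs := (Fact.out : s.Prime)
  rcases dvd_split Nat.prime_two hgD with ⟨g0, rfl, hg0⟩ | ⟨g0, rfl, hg0⟩ <;>
  rcases dvd_split hq hg0 with ⟨g1, rfl, hg1⟩ | ⟨g1, rfl, hg1⟩ <;>
  rcases dvd_split hr hg1 with ⟨g2, rfl, hg2⟩ | ⟨g2, rfl, hg2⟩ <;>
  rcases dvd_split (D0 := 1) hs (hg2.trans (mul_one s).symm) with ⟨g3, rfl, hg3⟩ | ⟨g3, rfl, hg3⟩ <;>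
  obtain ⟨rfl, rfl⟩ := one_of_mul hg3 <;>
  rcases hd1 with rfl | rfl
  all_goals (try (exact absurd (hsq 2 (mul_dvd_mul (dvd_mul_right 2 _) (dvd_refl 2))) (by norm_num)))
  all_goals first
    | (have fr := r1 (dvd_mul_right _ _))
    | (have fr := r2 (dvd_mul_right _ _))
    | (have fr := r1 (Dvd.dvd.mul_left (dvd_mul_right _ _) _))
    | (have fr := r2 (Dvd.dvd.mul_left (dvd_mul_right _ _) _))
    | (have fr := r1 (Dvd.dvd.mul_left (Dvd.dvd.mul_left (dvd_mul_right _ _) _) _))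
    | (have fr := r2 (Dvd.dvd.mul_left (Dvd.dvd.mul_left (dvd_mul_right _ _) _) _))
    | (have fr := r1 (Dvd.dvd.mul_left (Dvd.dvd.mul_left (Dvd.dvd.mul_left (dvd_mul_right _ _) _) _) _))
    | (have fr := r2 (Dvd.dvd.mul_left (Dvd.dvd.mul_left (Dvd.dvd.mul_left (dvd_mul_right _ _) _) _) _))
  all_goals first
    | (have fs := s1 (dvd_mul_right _ _))
    | (have fs := s2 (dvd_mul_right _ _))
    | (have fs := s1 (Dvd.dvd.mul_left (dvd_mul_right _ _) _))
    | (have fs := s2 (Dvd.dvd.mul_left (dvd_mul_right _ _) _))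
    | (have fs := s1 (Dvd.dvd.mul_left (Dvd.dvd.mul_left (dvd_mul_right _ _) _) _))
    | (have fs := s2 (Dvd.dvd.mul_left (Dvd.dvd.mul_left (dvd_mul_right _ _) _) _))
    | (have fs := s1 (Dvd.dvd.mul_left (Dvd.dvd.mul_left (Dvd.dvd.mul_left (dvd_mul_right _ _) _) _) _))
    | (have fs := s2 (Dvd.dvd.mul_left (Dvd.dvd.mul_left (Dvd.dvd.mul_left (dvd_mul_right _ _) _) _) _))
  all_goals first
    | (have fq := q1 (dvd_mul_right _ _))
    | (have fq := q2 (dvd_mul_right _ _))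
    | (have fq := q1 (Dvd.dvd.mul_left (dvd_mul_right _ _) _))
    | (have fq := q2 (Dvd.dvd.mul_left (dvd_mul_right _ _) _))
    | (have fq := q1 (Dvd.dvd.mul_left (Dvd.dvd.mul_left (dvd_mul_right _ _) _) _))
    | (have fq := q2 (Dvd.dvd.mul_left (Dvd.dvd.mul_left (dvd_mul_right _ _) _) _))
    | (have fq := q1 (Dvd.dvd.mul_left (Dvd.dvd.mul_left (Dvd.dvd.mul_left (dvd_mul_right _ _) _) _) _))
    | (have fq := q2 (Dvd.dvd.mul_left (Dvd.dvd.mul_left (Dvd.dvd.mul_left (dvd_mul_right _ _) _) _) _))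
  all_goals simp [legendreSym.mul, H.rq, H.sq, H.qr, H.qs, H.rs, H.sr, H.r2, H.s2, H.rm, H.sm, H.qm, H.leg4] at fr fs fq
  all_goals push_cast at e1 e2 hmin
  all_goals first
    | exact ⟨k, hk, Or.inl (Or.inr (by linarith))⟩
    | exact ⟨2 * k, by simpa using hk, Or.inl (Or.inr (by linarith))⟩
    | exact ⟨k, hk, Or.inr (Or.inr (by linarith))⟩
    | exact ⟨2 * k, by simpa using hk, Or.inr (Or.inr (by linarith))⟩
    | exact (hns ⟨q * k, by linear_combination (q : ℤ) / 2 * e2⟩).elim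
    | exact (hns ⟨q * k, by nlinarith⟩).elim
    | exact (hmin (by linarith) (by linarith)).elim

theorem pell_G1 (H : LegData q r s (1)) (γ γ' : ℤ) (hγ : 1 < γ) (hγ' : 0 < γ')
    (h : γ ^ 2 - (2 * (q * (r * s)) : ℕ) * γ' ^ 2 = 1)
    (hfund : ∀ a b : ℤ, 0 < a → 0 < b → a ^ 2 - ((2 * (q * (r * s)) : ℕ) : ℤ) * b ^ 2 = 1 → γ ≤ a) :
    ∃ m : ℤ, m ≠ 0 ∧ (2 * (γ + 1) = q * m ^ 2 ∨ 2 * (γ - 1) = q * m ^ 2) := by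
  obtain ⟨g, D1, d1, m, k, hgD, hd1, hm, hk, hsq, e1, e2⟩ := pell_split _ H.sqf2 γ γ' hγ hγ' h
  have hmin := fun h1 h2 => pell_min _ (Or.inl (by have := H.mod; omega)) γ hγ m k hm hk hfund h1 h2
  obtain ⟨⟨r1, r2⟩, ⟨s1, s2⟩, ⟨q1, q2⟩⟩ := H.conds e1 e2
  have hq := (Fact.out : q.Prime)
  have hr := (Fact.out : r.Prime)
  have hs := (Fact.out : s.Prime)
  rcases dvd_split Nat.prime_two hgD with ⟨g0, rfl, hg0⟩ | ⟨g0, rfl, hg0⟩ <;>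
  rcases dvd_split hq hg0 with ⟨g1, rfl, hg1⟩ | ⟨g1, rfl, hg1⟩ <;>
  rcases dvd_split hr hg1 with ⟨g2, rfl, hg2⟩ | ⟨g2, rfl, hg2⟩ <;>
  rcases dvd_split (D0 := 1) hs (hg2.trans (mul_one s).symm) with ⟨g3, rfl, hg3⟩ | ⟨g3, rfl, hg3⟩ <;>
  obtain ⟨rfl, rfl⟩ := one_of_mul hg3 <;>
  rcases hd1 with rfl | rfl
  all_goals (try (exact absurd (hsq 2 (mul_dvd_mul (dvd_mul_right 2 _) (dvd_refl 2))) (by norm_num)))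
  all_goals first
    | (have fr := r1 (dvd_mul_right _ _))
    | (have fr := r2 (dvd_mul_right _ _))
    | (have fr := r1 (Dvd.dvd.mul_left (dvd_mul_right _ _) _))
    | (have fr := r2 (Dvd.dvd.mul_left (dvd_mul_right _ _) _))
    | (have fr := r1 (Dvd.dvd.mul_left (Dvd.dvd.mul_left (dvd_mul_right _ _) _) _))
    | (have fr := r2 (Dvd.dvd.mul_left (Dvd.dvd.mul_left (dvd_mul_right _ _) _) _))
    | (have fr := r1 (Dvd.dvd.mul_left (Dvd.dvd.mul_left (Dvd.dvd.mul_left (dvd_mul_right _ _) _) _) _))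
    | (have fr := r2 (Dvd.dvd.mul_left (Dvd.dvd.mul_left (Dvd.dvd.mul_left (dvd_mul_right _ _) _) _) _))
  all_goals first
    | (have fs := s1 (dvd_mul_right _ _))
    | (have fs := s2 (dvd_mul_right _ _))
    | (have fs := s1 (Dvd.dvd.mul_left (dvd_mul_right _ _) _))
    | (have fs := s2 (Dvd.dvd.mul_left (dvd_mul_right _ _) _))
    | (have fs := s1 (Dvd.dvd.mul_left (Dvd.dvd.mul_left (dvd_mul_right _ _) _) _))
    | (have fs := s2 (Dvd.dvd.mul_left (Dvd.dvd.mul_left (dvd_mul_right _ _) _) _))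
    | (have fs := s1 (Dvd.dvd.mul_left (Dvd.dvd.mul_left (Dvd.dvd.mul_left (dvd_mul_right _ _) _) _) _))
    | (have fs := s2 (Dvd.dvd.mul_left (Dvd.dvd.mul_left (Dvd.dvd.mul_left (dvd_mul_right _ _) _) _) _))
  all_goals first
    | (have fq := q1 (dvd_mul_right _ _))
    | (have fq := q2 (dvd_mul_right _ _))
    | (have fq := q1 (Dvd.dvd.mul_left (dvd_mul_right _ _) _))
    | (have fq := q2 (Dvd.dvd.mul_left (dvd_mul_right _ _) _))
    | (have fq := q1 (Dvd.dvd.mul_left (Dvd.dvd.mul_left (dvd_mul_right _ _) _) _))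
    | (have fq := q2 (Dvd.dvd.mul_left (Dvd.dvd.mul_left (dvd_mul_right _ _) _) _))
    | (have fq := q1 (Dvd.dvd.mul_left (Dvd.dvd.mul_left (Dvd.dvd.mul_left (dvd_mul_right _ _) _) _) _))
    | (have fq := q2 (Dvd.dvd.mul_left (Dvd.dvd.mul_left (Dvd.dvd.mul_left (dvd_mul_right _ _) _) _) _))
  all_goals simp [legendreSym.mul, H.rq, H.sq, H.qr, H.qs, H.rs, H.sr, H.r2, H.s2, H.rm, H.sm, H.qm, H.leg4] at fr fs fq
  all_goals push_cast at e1 e2 hmin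
  all_goals first
    | exact ⟨m, hm, Or.inl (by linarith)⟩
    | exact ⟨k, hk, Or.inr (by linarith)⟩
    | exact ⟨2 * k, by simpa using hk, Or.inr (by linarith)⟩
    | exact (hmin (by linarith) (by linarith)).elim

theorem pell_G2 (H : LegData q r s (-1)) (γ γ' : ℤ) (hγ : 1 < γ) (hγ' : 0 < γ')
    (h : γ ^ 2 - (q * (r * s) : ℕ) * γ' ^ 2 = 1)
    (hfund : ∀ a b : ℤ, 0 < a → 0 < b → a ^ 2 - ((q * (r * s) : ℕ) : ℤ) * b ^ 2 = 1 → γ ≤ a) :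
    ∃ m : ℤ, m ≠ 0 ∧ (2 * (γ + 1) = (2 * q) * m ^ 2 ∨ 2 * (γ - 1) = (2 * q) * m ^ 2) := by
  obtain ⟨g, D1, d1, m, k, hgD, hd1, hm, hk, hsq, e1, e2⟩ := pell_split _ H.sqf γ γ' hγ hγ' h
  have hmin := fun h1 h2 => pell_min _ (Or.inr H.mod) γ hγ m k hm hk hfund h1 h2
  obtain ⟨⟨r1, r2⟩, ⟨s1, s2⟩, ⟨q1, q2⟩⟩ := H.conds e1 e2
  have hq := (Fact.out : q.Prime)
  have hr := (Fact.out : r.Prime)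
  have hs := (Fact.out : s.Prime)
  rcases dvd_split hq hgD with ⟨g1, rfl, hg1⟩ | ⟨g1, rfl, hg1⟩ <;>
  rcases dvd_split hr hg1 with ⟨g2, rfl, hg2⟩ | ⟨g2, rfl, hg2⟩ <;>
  rcases dvd_split (D0 := 1) hs (hg2.trans (mul_one s).symm) with ⟨g3, rfl, hg3⟩ | ⟨g3, rfl, hg3⟩ <;>
  obtain ⟨rfl, rfl⟩ := one_of_mul hg3 <;>
  rcases hd1 with rfl | rfl
  all_goals first
    | (have fr := r1 (dvd_mul_right _ _))
    | (have fr := r2 (dvd_mul_right _ _))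
    | (have fr := r1 (Dvd.dvd.mul_left (dvd_mul_right _ _) _))
    | (have fr := r2 (Dvd.dvd.mul_left (dvd_mul_right _ _) _))
    | (have fr := r1 (Dvd.dvd.mul_left (Dvd.dvd.mul_left (dvd_mul_right _ _) _) _))
    | (have fr := r2 (Dvd.dvd.mul_left (Dvd.dvd.mul_left (dvd_mul_right _ _) _) _))
    | (have fr := r1 (Dvd.dvd.mul_left (Dvd.dvd.mul_left (Dvd.dvd.mul_left (dvd_mul_right _ _) _) _) _))
    | (have fr := r2 (Dvd.dvd.mul_left (Dvd.dvd.mul_left (Dvd.dvd.mul_left (dvd_mul_right _ _) _) _) _))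
  all_goals first
    | (have fs := s1 (dvd_mul_right _ _))
    | (have fs := s2 (dvd_mul_right _ _))
    | (have fs := s1 (Dvd.dvd.mul_left (dvd_mul_right _ _) _))
    | (have fs := s2 (Dvd.dvd.mul_left (dvd_mul_right _ _) _))
    | (have fs := s1 (Dvd.dvd.mul_left (Dvd.dvd.mul_left (dvd_mul_right _ _) _) _))
    | (have fs := s2 (Dvd.dvd.mul_left (Dvd.dvd.mul_left (dvd_mul_right _ _) _) _))
    | (have fs := s1 (Dvd.dvd.mul_left (Dvd.dvd.mul_left (Dvd.dvd.mul_left (dvd_mul_right _ _) _) _) _))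
    | (have fs := s2 (Dvd.dvd.mul_left (Dvd.dvd.mul_left (Dvd.dvd.mul_left (dvd_mul_right _ _) _) _) _))
  all_goals first
    | (have fq := q1 (dvd_mul_right _ _))
    | (have fq := q2 (dvd_mul_right _ _))
    | (have fq := q1 (Dvd.dvd.mul_left (dvd_mul_right _ _) _))
    | (have fq := q2 (Dvd.dvd.mul_left (dvd_mul_right _ _) _))
    | (have fq := q1 (Dvd.dvd.mul_left (Dvd.dvd.mul_left (dvd_mul_right _ _) _) _))
    | (have fq := q2 (Dvd.dvd.mul_left (Dvd.dvd.mul_left (dvd_mul_right _ _) _) _))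
    | (have fq := q1 (Dvd.dvd.mul_left (Dvd.dvd.mul_left (Dvd.dvd.mul_left (dvd_mul_right _ _) _) _) _))
    | (have fq := q2 (Dvd.dvd.mul_left (Dvd.dvd.mul_left (Dvd.dvd.mul_left (dvd_mul_right _ _) _) _) _))
  all_goals simp [legendreSym.mul, H.rq, H.sq, H.qr, H.qs, H.rs, H.sr, H.r2, H.s2, H.rm, H.sm, H.qm, H.leg4] at fr fs fq
  all_goals push_cast at e1 e2 hmin
  all_goals first
    | exact ⟨m, hm, Or.inl (by linarith)⟩
    | exact ⟨k, hk, Or.inr (by linarith)⟩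
    | exact (hmin (by linarith) (by linarith)).elim

end four

end pell

end

section

section rep

def QRep (D d : ℤ) : Prop := ∃ x y z : ℤ, z ≠ 0 ∧ (x ^ 2 - D * y ^ 2 = d * z ^ 2 ∨ x ^ 2 - D * y ^ 2 = -(d * z ^ 2))

theorem rep_leg (p : ℕ) [Fact p.Prime] (hp : legendreSym p (-1) = 1) (D1 d : ℤ) (hD : ¬ (p : ℤ) ∣ D1)
    (hd : ¬ (p : ℤ) ∣ d) (h : QRep (p * D1) d) : legendreSym p d = 1 := by
  obtain ⟨x, y, z, hz, h⟩ := h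
  have hpp : Prime (p : ℤ) := Nat.prime_iff_prime_int.1 Fact.out
  induction hn : z.natAbs using Nat.strong_induction_on generalizing x y z with
  | _ n ih =>
    by_cases hpz : (p : ℤ) ∣ z
    · obtain ⟨z', rfl⟩ := hpz
      have hx : (p : ℤ) ∣ x := by
        apply hpp.dvd_of_dvd_pow (n := 2)
        rcases h with h | h
        · exact ⟨D1 * y ^ 2 + d * p * z' ^ 2, by linear_combination h⟩
        · exact ⟨D1 * y ^ 2 - d * p * z' ^ 2, by linear_combination h⟩
      obtain ⟨x', rfl⟩ := hx
      have hy : (p : ℤ) ∣ y := by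
        apply hpp.dvd_of_dvd_pow (n := 2)
        refine (hpp.dvd_or_dvd (a := D1) (b := y ^ 2) ?_).resolve_left hD
        rcases h with h | h
        · exact ⟨x' ^ 2 - d * z' ^ 2, mul_left_cancel₀ hpp.ne_zero (by linear_combination -h)⟩
        · exact ⟨x' ^ 2 + d * z' ^ 2, mul_left_cancel₀ hpp.ne_zero (by linear_combination -h)⟩
      obtain ⟨y', rfl⟩ := hy
      have hp2 : ((p : ℤ) ^ 2) ≠ 0 := pow_ne_zero 2 hpp.ne_zero
      have hz' : z' ≠ 0 := by rintro rfl; simp at hz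
      refine ih z'.natAbs ?_ x' y' z' hz' ?_ rfl
      · rw [← hn, Int.natAbs_mul, Int.natAbs_natCast]
        have : 0 < z'.natAbs := Int.natAbs_pos.2 hz'
        have := (Fact.out : p.Prime).two_le
        nlinarith
      · rcases h with h | h
        · left; exact mul_left_cancel₀ hp2 (by linear_combination h)
        · right; exact mul_left_cancel₀ hp2 (by linear_combination h)
    · have hx : ¬ (p : ℤ) ∣ x := by
        rintro ⟨x', rfl⟩
        have : (p : ℤ) ∣ d * z ^ 2 := by
          rcases h with h | h
          · exact ⟨p * x' ^ 2 - D1 * y ^ 2, by linear_combination -h⟩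
          · exact ⟨-(p * x' ^ 2 - D1 * y ^ 2), by linear_combination h⟩
        rcases hpp.dvd_or_dvd this with h | h
        · exact hd h
        · exact hpz (hpp.dvd_of_dvd_pow h)
      rcases h with h | h
      · exact leg_one p d z x hx ⟨-D1 * y ^ 2, by linear_combination -h⟩
      · have := leg_one p (-1 * d) z x hx ⟨-D1 * y ^ 2, by linear_combination -h⟩
        rwa [legendreSym.mul, hp, one_mul] at this

theorem rep_swap (p : ℕ) [Fact p.Prime] (D1 d1 : ℤ) (hD1 : D1 ≠ 0) (h : QRep (p * D1) (p * d1)) : QRep (p * D1) (D1 * d1) := by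
  obtain ⟨x, y, z, hz, h⟩ := h
  have hpp : Prime (p : ℤ) := Nat.prime_iff_prime_int.1 Fact.out
  have hx : (p : ℤ) ∣ x := by
    apply hpp.dvd_of_dvd_pow (n := 2)
    rcases h with h | h
    · exact ⟨D1 * y ^ 2 + d1 * z ^ 2, by linear_combination h⟩
    · exact ⟨D1 * y ^ 2 - d1 * z ^ 2, by linear_combination h⟩
  obtain ⟨x', rfl⟩ := hx
  refine ⟨D1 * y, x', z, hz, ?_⟩
  rcases h with h | h
  · right; exact mul_left_cancel₀ hpp.ne_zero (by linear_combination -D1 * h)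
  · left; exact mul_left_cancel₀ hpp.ne_zero (by linear_combination -D1 * h)

theorem rep_neg (p : ℕ) [Fact p.Prime] (hp : legendreSym p (-1) = 1) (D1 d : ℤ) (hD : ¬ (p : ℤ) ∣ D1)
    (hd : legendreSym p d = -1) : ¬ QRep (p * D1) d := by
  intro h
  have : ¬ (p : ℤ) ∣ d := by
    intro hdv
    rw [(legendreSym.eq_zero_iff p d).2 ((ZMod.intCast_zmod_eq_zero_iff_dvd d p).2 hdv)] at hd
    norm_num at hd
  rw [rep_leg p hp D1 d hD this h] at hd
  norm_num at hd

theorem rep_neg_swap (p : ℕ) [Fact p.Prime] (hp : legendreSym p (-1) = 1) (D1 d1 : ℤ)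
    (hD : ¬ (p : ℤ) ∣ D1) (hd : legendreSym p D1 * legendreSym p d1 = -1) : ¬ QRep (p * D1) (p * d1) := by
  intro h
  refine rep_neg p hp D1 (D1 * d1) hD (by rw [legendreSym.mul, hd]) (rep_swap p D1 d1 ?_ h)
  rintro rfl; simp at hD

end rep

end

section

open NumberField Module

section squ

theorem ideal_sq_inj {R : Type*} [CommRing R] [IsDedekindDomain R] {I J : Ideal R} (h : I ^ 2 = J ^ 2) : I = J := by
  have h1 : I ∣ J := (UniqueFactorizationMonoid.pow_dvd_pow_iff_dvd two_ne_zero).1 h.dvd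
  have h2 : J ∣ I := (UniqueFactorizationMonoid.pow_dvd_pow_iff_dvd two_ne_zero).1 h.symm.dvd
  exact le_antisymm (Ideal.dvd_iff_le.1 h2) (Ideal.dvd_iff_le.1 h1)

variable (L : Type*) [Field L] [NumberField L]

def SqU (d : ℕ) : Prop := ∃ β : 𝓞 L, ∃ u : (𝓞 L)ˣ, β ^ 2 = d * u

variable {L}

theorem int_of_sq (y : L) (z : 𝓞 L) (h : y ^ 2 = z) : ∃ w : 𝓞 L, (w : L) = y := by
  have : IsIntegral ℤ (y ^ 2) := by rw [h]; exact RingOfIntegers.isIntegral_coe z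
  have h2 : IsIntegral ℤ y := IsIntegral.of_pow (n := 2) (by norm_num) this
  exact ⟨⟨y, h2⟩, rfl⟩

theorem squ_sq (t : ℕ) : SqU L (t ^ 2) := ⟨t, 1, by simp⟩

theorem squ_mul {d e : ℕ} (hd : SqU L d) (he : SqU L e) : SqU L (d * e) := by
  obtain ⟨β, u, hβ⟩ := hd
  obtain ⟨γ, v, hγ⟩ := he
  exact ⟨β * γ, u * v, by rw [mul_pow, hβ, hγ]; push_cast; ring⟩

theorem squ_cancel {d e : ℕ} (he0 : e ≠ 0) (hd : SqU L (d * e)) (he : SqU L e) : SqU L d := by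
  obtain ⟨β, u, hβ⟩ := hd
  obtain ⟨γ, v, hγ⟩ := he
  have he0' : (e : L) ≠ 0 := by exact_mod_cast he0
  have h1 := congrArg (algebraMap (𝓞 L) L) hβ
  have h2 := congrArg (algebraMap (𝓞 L) L) hγ
  simp only [map_pow, map_mul, map_natCast, Nat.cast_mul] at h1 h2
  obtain ⟨w, hw⟩ := int_of_sq ((β : L) * γ / e) (d * u * v) (by
    rw [div_pow, mul_pow]
    field_simp
    push_cast
    rw [h1, h2]
    ring)
  refine ⟨w, u * v, ?_⟩
  apply RingOfIntegers.coe_injective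
  simp only [map_pow, map_mul, map_natCast, Units.val_mul]
  replace hw : algebraMap (𝓞 L) L w = _ := hw
  rw [hw, div_pow, mul_pow, h1, h2]
  field_simp

theorem squ_map {K : Type*} [Field K] [NumberField K] [Algebra K L] {d : ℕ} (h : SqU K d) : SqU L d := by
  obtain ⟨β, u, hβ⟩ := h
  refine ⟨algebraMap (𝓞 K) (𝓞 L) β, Units.map (algebraMap (𝓞 K) (𝓞 L)).toMonoidHom u, ?_⟩
  rw [← map_pow, hβ]
  simp

theorem squ_principal {d : ℕ} (h : SqU L d) {I : Ideal (𝓞 L)} (hI : I ^ 2 = Ideal.span {(d : 𝓞 L)}) : I.IsPrincipal := by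
  obtain ⟨β, u, hβ⟩ := h
  have : I = Ideal.span {β} := by
    apply ideal_sq_inj
    rw [hI, Ideal.span_singleton_pow, hβ]
    exact (Ideal.span_singleton_mul_right_unit u.isUnit _).symm
  exact ⟨⟨β, this⟩⟩

theorem squ_theta {D : ℕ} (θ : 𝓞 L) (hθ : θ ^ 2 = D) : SqU L D := ⟨θ, 1, by simp [hθ]⟩

theorem squ_pell {D d : ℕ} (θ : 𝓞 L) (hθ : θ ^ 2 = D) (γ γ' m : ℤ) (hm : m ≠ 0)
    (h : γ ^ 2 - D * γ' ^ 2 = 1) (hd : 2 * (γ + 1) = d * m ^ 2 ∨ 2 * (γ - 1) = d * m ^ 2) : SqU L d := by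
  have h' : (γ : 𝓞 L) ^ 2 - D * (γ' : 𝓞 L) ^ 2 = 1 := by exact_mod_cast congrArg (Int.cast (R := 𝓞 L)) h
  let ε : (𝓞 L)ˣ := ⟨γ + γ' * θ, γ - γ' * θ, by linear_combination h' - γ' ^ 2 * hθ, by linear_combination h' - γ' ^ 2 * hθ⟩
  have hε : (ε : 𝓞 L) = γ + γ' * θ := rfl
  refine squ_cancel (e := m.natAbs ^ 2) (pow_ne_zero 2 (Int.natAbs_ne_zero.2 hm)) ?_ (squ_sq _)
  have key : ((d * m.natAbs ^ 2 : ℕ) : 𝓞 L) = (d : 𝓞 L) * (m : 𝓞 L) ^ 2 := by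
    have : ((d * m.natAbs ^ 2 : ℕ) : ℤ) = d * m ^ 2 := by push_cast; rw [sq_abs]
    rw [← Int.cast_natCast (R := 𝓞 L), this]
    push_cast; rfl
  rcases hd with hd | hd
  · have hd' : 2 * ((γ : 𝓞 L) + 1) = d * (m : 𝓞 L) ^ 2 := by exact_mod_cast congrArg (Int.cast (R := 𝓞 L)) hd
    exact ⟨ε + 1, ε, by rw [key, ← hd', hε]; linear_combination γ' ^ 2 * hθ - h'⟩
  · have hd' : 2 * ((γ : 𝓞 L) - 1) = d * (m : 𝓞 L) ^ 2 := by exact_mod_cast congrArg (Int.cast (R := 𝓞 L)) hd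
    exact ⟨ε - 1, ε, by rw [key, ← hd', hε]; linear_combination γ' ^ 2 * hθ - h'⟩

end squ

end

section

open NumberField Module

theorem no_neg_one (q D1 : ℕ) (hq : q.Prime) (hq4 : q % 4 = 3) (hD1 : ¬ q ∣ D1) (X Y t : ℤ) (ht : t ≠ 0) :
    X ^ 2 - (q * D1 : ℕ) * Y ^ 2 ≠ - t ^ 2 := by
  intro h
  haveI := Fact.mk hq
  have hD10 : D1 ≠ 0 := by rintro rfl; simp at hD1
  have hs : (q * D1 : ℕ) * Y.natAbs ^ 2 = X.natAbs ^ 2 + t.natAbs ^ 2 := by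
    zify
    simp only [sq_abs]
    push_cast at h
    linarith
  have hY : Y.natAbs ≠ 0 := by
    intro h0
    rw [h0] at hs
    have : 0 < t.natAbs ^ 2 := pow_pos (Int.natAbs_pos.2 ht) 2
    simp only [ne_eq, OfNat.ofNat_ne_zero, not_false_eq_true, zero_pow, mul_zero] at hs
    omega
  have h1 := (Nat.eq_sq_add_sq_iff (n := (q * D1 : ℕ) * Y.natAbs ^ 2)).1 ⟨_, _, hs⟩ q (by
    rw [Nat.mem_primeFactors]
    exact ⟨hq, Dvd.dvd.mul_right (dvd_mul_right _ _) _,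
      mul_ne_zero (mul_ne_zero hq.ne_zero hD10) (pow_ne_zero 2 hY)⟩) hq4
  rw [padicValNat.mul (mul_ne_zero hq.ne_zero hD10) (pow_ne_zero 2 hY), padicValNat.mul hq.ne_zero hD10,
    padicValNat.pow, padicValNat_self, padicValNat.eq_zero_of_not_dvd hD1] at h1
  rcases h1 with ⟨k, hk⟩
  omega

theorem pid_Q : IsPrincipalIdealRing (𝓞 ℚ) :=
  IsPrincipalIdealRing.of_surjective (Rat.ringOfIntegersEquiv.symm : ℤ →+* 𝓞 ℚ) Rat.ringOfIntegersEquiv.symm.surjective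

section quadQ
variable {K : Type*} [Field K] [NumberField K]

theorem norm_int_form (h2 : finrank ℚ K = 2) (σ : K ≃ₐ[ℚ] K) (θ : 𝓞 K) (D : ℕ) (hD : 0 < D) (hθ : θ ^ 2 = D)
    (hσ : σ θ = -θ) (w : 𝓞 K) : ∃ X Y t : ℤ, t ≠ 0 ∧ X ^ 2 - D * Y ^ 2 = t ^ 2 * Algebra.norm ℤ w := by
  have hθL : (θ : K) ^ 2 = D := by
    have := congrArg (algebraMap (𝓞 K) K) hθ
    simpa using this
  have hθ0 : (θ : K) ≠ 0 := by
    intro h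
    rw [h] at hθL
    have : (D : K) ≠ 0 := by exact_mod_cast hD.ne'
    exact this (by rw [← hθL]; simp)
  obtain ⟨a, b, hab⟩ := quad_repr h2 σ (θ : K) hθ0 hσ (w : K)
  have hn := quad_norm h2 σ (θ : K) hθ0 hσ (w : K)
  rw [← Algebra.coe_norm_int, hab] at hn
  simp only [map_add, map_mul, AlgEquiv.commutes, hσ] at hn
  have hn2 : ((Algebra.norm ℤ w : ℤ) : ℚ) = a ^ 2 - D * b ^ 2 := by
    apply (algebraMap ℚ K).injective
    rw [hn]
    simp only [map_sub, map_pow, map_mul, map_natCast]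
    rw [← hθL]; ring
  refine ⟨a.num * b.den, b.num * a.den, a.den * b.den, by simp, ?_⟩
  have ha : (a.num : ℚ) = a * a.den := (Rat.mul_den_eq_num a).symm
  have hb : (b.num : ℚ) = b * b.den := (Rat.mul_den_eq_num b).symm
  have : (((a.num * b.den) ^ 2 - D * (b.num * a.den) ^ 2 : ℤ) : ℚ) = ((a.den * b.den : ℤ) ^ 2 * Algebra.norm ℤ w : ℤ) := by
    push_cast
    rw [hn2, ha, hb]; ring
  exact_mod_cast this

theorem rep_of_sq (h2 : finrank ℚ K = 2) (σ : K ≃ₐ[ℚ] K) (θ : 𝓞 K) (D : ℕ) (hD : 0 < D) (hθ : θ ^ 2 = D)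
    (hσ : σ θ = -θ) (J : Ideal (𝓞 K)) (hJ : J ≠ ⊥) (c : ClassGroup (𝓞 K)) (hc : icl J = c ^ 2) :
    QRep D (Ideal.absNorm J) := by
  obtain ⟨I, hI, rfl⟩ := icl_surj c
  rw [← icl_pow hI, icl_eq hJ (pow_ne_zero 2 hI)] at hc
  obtain ⟨x, y, hx, hy, hxy⟩ := hc
  obtain ⟨X, Y, t, ht, hXY⟩ := norm_int_form h2 σ θ D hD hθ hσ (x * y)
  have h1 := congrArg Ideal.absNorm hxy
  simp only [map_mul, map_pow, Ideal.absNorm_span_singleton] at h1 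
  set n := Ideal.absNorm J
  set M := Ideal.absNorm I
  have hM : M ≠ 0 := fun h => hI (Ideal.absNorm_eq_zero_iff.1 h)
  set a := Algebra.norm ℤ x
  set b := Algebra.norm ℤ y with hb
  have hb0 : b ≠ 0 := by rw [hb, Algebra.norm_ne_zero_iff]; exact hy
  rw [map_mul] at hXY
  have h1' : |a| * n = |b| * M ^ 2 := by
    rw [Int.abs_eq_natAbs, Int.abs_eq_natAbs]; exact_mod_cast h1
  refine ⟨n * X, n * Y, t * b * M, mul_ne_zero (mul_ne_zero ht hb0) (by exact_mod_cast hM), ?_⟩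
  have e : ((n : ℤ) * X) ^ 2 - D * (n * Y) ^ 2 = n ^ 2 * t ^ 2 * (a * b) := by linear_combination (n : ℤ) ^ 2 * hXY
  rw [e]
  rcases abs_choice a with ha | ha <;> rcases abs_choice b with hb | hb <;> rw [ha, hb] at h1'
  · left; linear_combination (n : ℤ) * t ^ 2 * b * h1'
  · right; linear_combination (n : ℤ) * t ^ 2 * b * h1'
  · right; linear_combination -(n : ℤ) * t ^ 2 * b * h1'
  · left; linear_combination -(n : ℤ) * t ^ 2 * b * h1'

theorem tors_mem (h2 : finrank ℚ K = 2) (σ : K ≃ₐ[ℚ] K) (θ : 𝓞 K) (D : ℕ) (hD : 0 < D) (hθ : θ ^ 2 = D)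
    (hσ : σ θ = -θ) (hneg : ∀ X Y t : ℤ, t ≠ 0 → X ^ 2 - D * Y ^ 2 ≠ - t ^ 2)
    (S : Subgroup (ClassGroup (𝓞 K)))
    (hS : ∀ p : Ideal (𝓞 K), p ≠ ⊥ → p.IsMaximal → 2 * θ ∈ p → icl p ∈ S)
    (c : ClassGroup (𝓞 K)) (hc : c ^ 2 = 1) : c ∈ S := by
  have hθL : (θ : K) ^ 2 = D := by
    have := congrArg (algebraMap (𝓞 K) K) hθ
    simpa using this
  have hθ0 : (θ : K) ≠ 0 := by
    intro h
    rw [h] at hθL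
    have : (D : K) ≠ 0 := by exact_mod_cast hD.ne'
    exact this (by rw [← hθL]; simp)
  haveI := pid_Q
  obtain ⟨I, hI, rfl⟩ := icl_surj c
  rw [← icl_pow hI, icl_eq_one (pow_ne_zero 2 hI)] at hc
  obtain ⟨α, hα⟩ := hc
  replace hα : I ^ 2 = Ideal.span {α} := hα
  have hα0 : α ≠ 0 := by
    rintro rfl
    rw [Ideal.span_singleton_zero] at hα
    exact hI (pow_eq_zero_iff two_ne_zero |>.1 hα)
  have hα0' : (α : K) ≠ 0 := by simpa using hα0
  set n := Ideal.absNorm I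
  have hn0 : n ≠ 0 := fun h => hI (Ideal.absNorm_eq_zero_iff.1 h)
  have hn0' : (n : K) ≠ 0 := by exact_mod_cast hn0
  have hN : Algebra.norm ℤ α = n ^ 2 := by
    have h1 := congrArg Ideal.absNorm hα
    simp only [map_pow, Ideal.absNorm_span_singleton] at h1
    have h1' : |Algebra.norm ℤ α| = n ^ 2 := by
      rw [Int.abs_eq_natAbs]; exact_mod_cast h1.symm
    rcases abs_choice (Algebra.norm ℤ α) with h | h
    · rw [← h, h1']
    · exfalso
      obtain ⟨X, Y, t, ht, hXY⟩ := norm_int_form h2 σ θ D hD hθ hσ α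
      have : Algebra.norm ℤ α = - n ^ 2 := by rw [← h1', h]; ring
      rw [this] at hXY
      exact hneg X Y (t * n) (mul_ne_zero ht (by exact_mod_cast hn0)) (by rw [hXY]; ring)
  have hNK : (α : K) * σ α = n ^ 2 := by
    rw [← quad_norm h2 σ (θ : K) hθ0 hσ, ← Algebra.coe_norm_int, hN]
    simp
  obtain ⟨z, hz0, hz⟩ := quad_h90 σ (θ : K) hθ0 hσ ((α : K) / n) (by
    rw [map_div₀, map_natCast, div_mul_div_comm, hNK]; field_simp)
  -- make z integral
  obtain ⟨y, hy0, hy⟩ := ((IsFractionRing.isAlgebraic_iff ℤ ℚ K).2 (Algebra.IsAlgebraic.isAlgebraic (R := ℚ) z)).exists_integral_multiple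
  obtain ⟨w, hw⟩ : ∃ w : 𝓞 K, algebraMap (𝓞 K) K w = y • z := ⟨⟨y • z, hy⟩, rfl⟩
  have hy0' : (y : K) ≠ 0 := by exact_mod_cast hy0
  have hwz : algebraMap (𝓞 K) K w = y * z := by rw [hw, zsmul_eq_mul]
  have hw0 : w ≠ 0 := by
    rintro rfl
    rw [map_zero] at hwz
    exact mul_ne_zero hy0' hz0 hwz.symm
  set s : 𝓞 K ≃+* 𝓞 K := RingOfIntegers.mapRingEquiv (σ : K ≃+* K) with hs
  have hsK : ∀ v : 𝓞 K, algebraMap (𝓞 K) K (s v) = σ (algebraMap (𝓞 K) K v) := fun v => rfl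
  have hss : ∀ v : 𝓞 K, s (s v) = v := fun v => by
    apply RingOfIntegers.coe_injective
    rw [hsK, hsK]
    exact quad_inv h2 σ (θ : K) hθ0 hσ _
  have hsw0 : s w ≠ 0 := by simpa using hw0
  have hrel : α * s w = n * w := by
    apply RingOfIntegers.coe_injective
    rw [map_mul, map_mul, hsK, hwz, map_natCast, map_mul, map_intCast]
    have hσz : σ z ≠ 0 := by simpa using hz0
    field_simp at hz
    linear_combination (y : K) * hz
  have hJ0 : I * Ideal.span {s w} ≠ ⊥ := mul_ne_zero hI (by simpa using hsw0)
  have hJ2 : (I * Ideal.span {s w}) ^ 2 = Ideal.span {n * w * s w} := by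
    rw [mul_pow, hα, Ideal.span_singleton_pow, Ideal.span_singleton_mul_span_singleton, ← hrel]
    congr 2; ring
  have hinv : gI K (σ : K ≃+* K) (I * Ideal.span {s w}) = I * Ideal.span {s w} := by
    apply ideal_sq_inj
    have e1 : gI K (σ : K ≃+* K) (I * Ideal.span {s w}) ^ 2 = gI K (σ : K ≃+* K) ((I * Ideal.span {s w}) ^ 2) := by
      rw [sq, sq]; exact (gI_mul _ _ _).symm
    have e2 : gI K (σ : K ≃+* K) (Ideal.span {n * w * s w}) = Ideal.span {s (n * w * s w)} := by
      unfold gI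
      rw [Ideal.map_span, Set.image_singleton]

    rw [e1, hJ2, e2, map_mul, map_mul, hss, map_natCast]
    ring_nf
  have hmem : icl (I * Ideal.span {s w}) ∈ S := by
    refine inv_induction h2 σ θ hθ0 hσ (fun a => icl a ∈ S) ?_ ?_ ?_ _ hJ0 hinv
    · intro a b ha hb h1 h2
      change icl (a * b) ∈ S
      rw [icl_mul ha hb]; exact S.mul_mem h1 h2
    · intro J hJ
      change icl _ ∈ S
      rw [← clExt_icl ℚ K hJ, icl_of_principal (IsPrincipalIdealRing.principal J), map_one]
      exact S.one_mem
    · intro p hp hpm _ hpθ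
      exact hS p hp hpm hpθ
  rwa [icl_mul hI (by simpa using hsw0), icl_span, mul_one] at hmem

end quadQ

end

section

open NumberField Module

theorem span_sq_of {R : Type*} [CommRing R] (l a b x y z : R) (h : a ^ 2 = l * b) (h1 : x * l + y * a + z * b = 1) :
    (Ideal.span {l, a}) ^ 2 = Ideal.span {l} := by
  have hl : l ∈ Ideal.span {l, a} := Ideal.subset_span (by simp)
  have ha : a ∈ Ideal.span {l, a} := Ideal.subset_span (by simp)
  apply le_antisymm
  · rw [sq, Ideal.span_pair_mul_span_pair, Ideal.span_le]
    intro t ht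
    rw [SetLike.mem_coe, Ideal.mem_span_singleton]
    rcases ht with rfl | rfl | rfl | rfl
    · exact ⟨l, rfl⟩
    · exact ⟨a, rfl⟩
    · exact ⟨a, mul_comm _ _⟩
    · exact ⟨b, by rw [← h]; ring⟩
  · rw [Ideal.span_singleton_le_iff_mem]
    have : l = x * (l * l) + y * (l * a) + z * (a * a) := by
      linear_combination -l * h1 - z * h
    have hm : x * (l * l) + y * (l * a) + z * (a * a) ∈ Ideal.span {l, a} * Ideal.span {l, a} := Ideal.add_mem _ (Ideal.add_mem _ (Ideal.mul_mem_left _ _ (Ideal.mul_mem_mul hl hl))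
      (Ideal.mul_mem_left _ _ (Ideal.mul_mem_mul hl ha))) (Ideal.mul_mem_left _ _ (Ideal.mul_mem_mul ha ha))
    rw [← this, ← sq] at hm
    exact hm

section ram
variable {K : Type*} [Field K] [NumberField K]

theorem ram_norm (h2 : finrank ℚ K = 2) {l : ℕ} {I : Ideal (𝓞 K)} (h : I ^ 2 = Ideal.span {(l : 𝓞 K)}) : Ideal.absNorm I = l := by
  have h1 := congrArg Ideal.absNorm h
  rw [map_pow, Ideal.absNorm_span_singleton] at h1
  have : Algebra.norm ℤ (l : 𝓞 K) = l ^ 2 := by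
    have := Algebra.norm_algebraMap (R := ℤ) (S := 𝓞 K) (l : ℤ)
    rw [RingOfIntegers.rank, h2] at this
    simpa using this
  rw [this, Int.natAbs_pow, Int.natAbs_natCast] at h1
  exact Nat.pow_left_injective two_ne_zero h1

theorem ram_ne_bot {l : ℕ} (hl : l ≠ 0) {I : Ideal (𝓞 K)} (h : I ^ 2 = Ideal.span {(l : 𝓞 K)}) : I ≠ ⊥ := by
  rintro rfl
  rw [Ideal.bot_pow two_ne_zero] at h
  have := Ideal.span_singleton_eq_bot.1 h.symm
  exact hl (by exact_mod_cast this)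

theorem ram_unique (h2 : finrank ℚ K = 2) {l : ℕ} (hl : l.Prime) {I : Ideal (𝓞 K)} (h : I ^ 2 = Ideal.span {(l : 𝓞 K)})
    (p : Ideal (𝓞 K)) (hp : p.IsMaximal) (hlp : (l : 𝓞 K) ∈ p) : p = I := by
  have hn := ram_norm h2 h
  have hI : I.IsPrime := Ideal.isPrime_of_irreducible_absNorm (by rw [hn]; exact hl)
  have hIm : I.IsMaximal := hI.isMaximal (ram_ne_bot hl.ne_zero h)
  refine (hIm.eq_of_le hp.ne_top ?_).symm
  have : I ^ 2 ≤ p := by rw [h, Ideal.span_singleton_le_iff_mem]; exact hlp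
  exact hp.isPrime.le_of_pow_le this

theorem ram_exists (θ : 𝓞 K) (l D1 : ℕ) (hθ : θ ^ 2 = (l * D1 : ℕ)) (hc : l.Coprime D1) :
    ∃ I : Ideal (𝓞 K), I ^ 2 = Ideal.span {(l : 𝓞 K)} := by
  obtain ⟨x, z, h⟩ := Nat.isCoprime_iff_coprime.2 hc
  refine ⟨_, span_sq_of (l : 𝓞 K) θ D1 x 0 z (by rw [hθ]; push_cast; rfl) ?_⟩
  have := congrArg (Int.cast (R := 𝓞 K)) h
  push_cast at this
  rw [← this]; ring

theorem ram_exists_two (θ : 𝓞 K) (D : ℕ) (hθ : θ ^ 2 = D) (hD : D % 4 = 3) :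
    ∃ I : Ideal (𝓞 K), I ^ 2 = Ideal.span {((2 : ℕ) : 𝓞 K)} := by
  obtain ⟨k, hk⟩ : ∃ k, D + 1 = 4 * k := ⟨(D + 1) / 4, by omega⟩
  have hk' : (D : 𝓞 K) + 1 = 4 * k := by exact_mod_cast congrArg (Nat.cast (R := 𝓞 K)) hk
  refine ⟨_, span_sq_of ((2 : ℕ) : 𝓞 K) (1 + θ) (θ + 2 * k) k 1 (-1) ?_ ?_⟩
  · push_cast; linear_combination hθ + hk'
  · push_cast; ring

theorem mem_of_dvd_prime {p : Ideal (𝓞 K)} (hp : p.IsMaximal) {a b : ℕ} (h : ((a * b : ℕ) : 𝓞 K) ∈ p) :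
    (a : 𝓞 K) ∈ p ∨ (b : 𝓞 K) ∈ p := by
  rw [Nat.cast_mul] at h
  exact hp.isPrime.mem_or_mem h

theorem ram4 (h2 : finrank ℚ K = 2) {q r s : ℕ} [Fact q.Prime] [Fact r.Prime] [Fact s.Prime] {e : ℤ} (H : LegData q r s e)
    (D : ℕ) (hD : D = q * (r * s) ∨ D = 2 * (q * (r * s))) (θ : 𝓞 K) (hθ : θ ^ 2 = D) :
    ∃ I2 Iq Ir Is : Ideal (𝓞 K), I2 ^ 2 = Ideal.span {((2 : ℕ) : 𝓞 K)} ∧ Iq ^ 2 = Ideal.span {(q : 𝓞 K)} ∧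
      Ir ^ 2 = Ideal.span {(r : 𝓞 K)} ∧ Is ^ 2 = Ideal.span {(s : 𝓞 K)} ∧
      ∀ p : Ideal (𝓞 K), p.IsMaximal → 2 * θ ∈ p → p = I2 ∨ p = Iq ∨ p = Ir ∨ p = Is := by
  have hq := (Fact.out : q.Prime)
  have hr := (Fact.out : r.Prime)
  have hs := (Fact.out : s.Prime)
  have h1 := H.q4
  have h3 := H.r8
  have h4 := H.s8
  have qr : q.Coprime r := (Nat.coprime_primes hq hr).2 (by rintro rfl; omega)
  have qs : q.Coprime s := (Nat.coprime_primes hq hs).2 (by rintro rfl; omega)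
  have rs : r.Coprime s := (Nat.coprime_primes hr hs).2 H.ne
  have q2 : q.Coprime 2 := (Nat.coprime_primes hq Nat.prime_two).2 (by omega)
  have r2 : r.Coprime 2 := (Nat.coprime_primes hr Nat.prime_two).2 (by omega)
  have s2 : s.Coprime 2 := (Nat.coprime_primes hs Nat.prime_two).2 (by omega)
  have e2 : ∃ I : Ideal (𝓞 K), I ^ 2 = Ideal.span {((2 : ℕ) : 𝓞 K)} := by
    rcases hD with rfl | rfl
    · exact ram_exists_two θ _ hθ H.mod
    · exact ram_exists θ 2 _ hθ (q2.symm.mul_right (r2.symm.mul_right s2.symm))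
  have eq : ∃ I : Ideal (𝓞 K), I ^ 2 = Ideal.span {((q : ℕ) : 𝓞 K)} := by
    rcases hD with rfl | rfl
    · exact ram_exists θ q _ hθ (qr.mul_right qs)
    · exact ram_exists θ q (2 * (r * s)) (by rw [hθ]; congr 1; ring) (q2.mul_right (qr.mul_right qs))
  have er : ∃ I : Ideal (𝓞 K), I ^ 2 = Ideal.span {((r : ℕ) : 𝓞 K)} := by
    rcases hD with rfl | rfl
    · exact ram_exists θ r (q * s) (by rw [hθ]; congr 1; ring) (qr.symm.mul_right rs)
    · exact ram_exists θ r (2 * (q * s)) (by rw [hθ]; congr 1; ring) (r2.mul_right (qr.symm.mul_right rs))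
  have es : ∃ I : Ideal (𝓞 K), I ^ 2 = Ideal.span {((s : ℕ) : 𝓞 K)} := by
    rcases hD with rfl | rfl
    · exact ram_exists θ s (q * r) (by rw [hθ]; congr 1; ring) (qs.symm.mul_right rs.symm)
    · exact ram_exists θ s (2 * (q * r)) (by rw [hθ]; congr 1; ring) (s2.mul_right (qs.symm.mul_right rs.symm))
  obtain ⟨I2, i2⟩ := e2
  obtain ⟨Iq, iq⟩ := eq
  obtain ⟨Ir, ir⟩ := er
  obtain ⟨Is, is⟩ := es
  refine ⟨I2, Iq, Ir, Is, i2, iq, ir, is, fun p hp hmem => ?_⟩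
  have hmem2 : ((2 * (2 * (q * (r * s))) : ℕ) : 𝓞 K) ∈ p := by
    have : ((2 * (2 * D) : ℕ) : 𝓞 K) ∈ p := by
      have : ((2 * (2 * D) : ℕ) : 𝓞 K) = (2 * θ) * (2 * θ) := by push_cast; rw [← hθ]; ring
      rw [this]; exact p.mul_mem_left _ hmem
    rcases hD with rfl | rfl
    · exact this
    · rcases mem_of_dvd_prime hp this with h | h
      · rw [Nat.cast_mul]; exact p.mul_mem_right _ h
      · exact h
  rcases mem_of_dvd_prime hp hmem2 with h | h
  · exact Or.inl (ram_unique h2 Nat.prime_two i2 p hp h)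
  rcases mem_of_dvd_prime hp h with h | h
  · exact Or.inl (ram_unique h2 Nat.prime_two i2 p hp h)
  rcases mem_of_dvd_prime hp h with h | h
  · exact Or.inr (Or.inl (ram_unique h2 hq iq p hp h))
  rcases mem_of_dvd_prime hp h with h | h
  · exact Or.inr (Or.inr (Or.inl (ram_unique h2 hr ir p hp h)))
  · exact Or.inr (Or.inr (Or.inr (ram_unique h2 hs is p hp h)))

/-- product of ramified ideals -/
theorem ram_mul {a b : ℕ} {I J : Ideal (𝓞 K)} (h : I ^ 2 = Ideal.span {(a : 𝓞 K)}) (h' : J ^ 2 = Ideal.span {(b : 𝓞 K)}) :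
    (I * J) ^ 2 = Ideal.span {((a * b : ℕ) : 𝓞 K)} := by
  rw [mul_pow, h, h', Ideal.span_singleton_mul_span_singleton, Nat.cast_mul]

theorem ram_icl_sq {a : ℕ} (ha : a ≠ 0) {I : Ideal (𝓞 K)} (h : I ^ 2 = Ideal.span {(a : 𝓞 K)}) : icl I ^ 2 = 1 := by
  rw [← icl_pow (ram_ne_bot ha h), h, icl_span]

end ram

end

section

open NumberField Module

theorem pair_mem {G : Type*} [CommGroup G] {P Q x : G} (hP : P ^ 2 = 1) (hQ : Q ^ 2 = 1)
    (hx : x ∈ Subgroup.closure {P, Q}) : x = 1 ∨ x = P ∨ x = Q ∨ x = P * Q := by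
  have hz : ∀ {P : G}, P ^ 2 = 1 → ∀ m : ℤ, P ^ m = 1 ∨ P ^ m = P := by
    intro P hP m
    rcases Int.even_or_odd' m with ⟨k, rfl | rfl⟩
    · left; rw [zpow_mul]; norm_cast; rw [hP, one_zpow]
    · right; rw [zpow_add, zpow_mul]; norm_cast; rw [hP, one_zpow]; simp
  obtain ⟨m, n, rfl⟩ := Subgroup.mem_closure_pair.1 hx
  rcases hz hP m with h | h <;> rcases hz hQ n with h' | h' <;> rw [h, h'] <;> simp

theorem card_tors_le {G : Type*} [CommGroup G] {P Q : G} (hP : P ^ 2 = 1) (hQ : Q ^ 2 = 1)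
    (h : ∀ x : G, x ^ 2 = 1 → x ∈ Subgroup.closure {P, Q}) : Nat.card {x : G // x ^ 2 = 1} ≤ 4 := by
  classical
  have hs : {x : G | x ^ 2 = 1} ⊆ (({1, P, Q, P * Q} : Finset G) : Set G) := by
    intro x hx
    have := pair_mem hP hQ (h x hx)
    simpa using this
  have : Nat.card {x : G // x ^ 2 = 1} = Set.ncard {x : G | x ^ 2 = 1} := rfl
  rw [this]
  refine (Set.ncard_le_ncard hs (Finset.finite_toSet _)).trans ?_
  rw [Set.ncard_coe_finset]
  exact Finset.card_le_four

theorem leg_not_dvd (p : ℕ) [Fact p.Prime] (a : ℤ) (h : legendreSym p a ≠ 0) : ¬ (p : ℤ) ∣ a := fun hd =>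
  h ((legendreSym.eq_zero_iff p a).2 ((ZMod.intCast_zmod_eq_zero_iff_dvd a p).2 hd))

section
variable {K : Type*} [Field K] [NumberField K] {q r s : ℕ} [Fact q.Prime] [Fact r.Prime] [Fact s.Prime]

theorem negone (e : ℤ) (H : LegData q r s e) (D : ℕ) (hD : D = q * (r * s) ∨ D = 2 * (q * (r * s))) :
    ∀ X Y t : ℤ, t ≠ 0 → X ^ 2 - D * Y ^ 2 ≠ - t ^ 2 := by
  have hq := (Fact.out : q.Prime)
  have h1 := H.q4
  have h3 := H.r8
  have h4 := H.s8
  have hr := (Nat.prime_dvd_prime_iff_eq hq (Fact.out : r.Prime)).not.2 (by rintro rfl; omega)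
  have hs := (Nat.prime_dvd_prime_iff_eq hq (Fact.out : s.Prime)).not.2 (by rintro rfl; omega)
  have h2 := (Nat.prime_dvd_prime_iff_eq hq Nat.prime_two).not.2 (by omega)
  rcases hD with rfl | rfl
  · exact no_neg_one q _ hq h1 (by rw [hq.dvd_mul]; tauto)
  · rw [mul_left_comm]
    exact no_neg_one q _ hq h1 (by rw [hq.dvd_mul, hq.dvd_mul]; tauto)

/-- F : torsion bound and non-square class of the prime over 2 -/
theorem F_main (h2 : finrank ℚ K = 2) (σ : K ≃ₐ[ℚ] K) (e : ℤ) (H : LegData q r s e)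
    (D : ℕ) (hD : D = q * (r * s) ∨ D = 2 * (q * (r * s))) (θ : 𝓞 K) (hθ : θ ^ 2 = D) (hσ : σ θ = -θ)
    (hsq : SqU K r ∨ SqU K s) :
    Nat.card {x : ClassGroup (𝓞 K) // x ^ 2 = 1} ≤ 4 ∧
      ∃ p : ClassGroup (𝓞 K), p ^ 2 = 1 ∧ ∀ y, y ^ 2 ≠ p := by
  have hq := (Fact.out : q.Prime).ne_zero
  have hr := (Fact.out : r.Prime).ne_zero
  have hs := (Fact.out : s.Prime).ne_zero
  have hD0 : 0 < D := by rcases hD with rfl | rfl <;> positivity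
  have hr' : ((r : ℕ) : ℤ) ≠ 0 := by exact_mod_cast hr
  have hs' : ((s : ℕ) : ℤ) ≠ 0 := by exact_mod_cast hs
  obtain ⟨I2, Iq, Ir, Is, i2, iq, ir, is, hram⟩ := ram4 h2 H D hD θ hθ
  have b2 := ram_ne_bot two_ne_zero i2
  have bq := ram_ne_bot hq iq
  have br := ram_ne_bot hr ir
  have bs := ram_ne_bot hs is
  have hP : icl I2 ^ 2 = 1 := ram_icl_sq two_ne_zero i2
  have hQ : icl Iq ^ 2 = 1 := ram_icl_sq hq iq
  have hR : icl Ir ^ 2 = 1 := ram_icl_sq hr ir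
  have hS : icl Is ^ 2 = 1 := ram_icl_sq hs is
  have hPQ : ∀ x : ClassGroup (𝓞 K), x ^ 2 = 1 → x ∈ Subgroup.closure {icl I2, icl Iq} := by
    set S := Subgroup.closure {icl I2, icl Iq} with hSdef
    have m2 : icl I2 ∈ S := Subgroup.subset_closure (by simp)
    have mq : icl Iq ∈ S := Subgroup.subset_closure (by simp)
    have hrs : icl Ir * icl Is ∈ S := by
      have hU := squ_theta θ hθ
      rcases hD with rfl | rfl
      · have := icl_of_principal (squ_principal hU (ram_mul iq (ram_mul ir is)))
        rw [icl_mul bq (mul_ne_zero br bs), icl_mul br bs] at this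
        rw [eq_inv_of_mul_eq_one_right this]
        exact S.inv_mem mq
      · have := icl_of_principal (squ_principal hU (ram_mul i2 (ram_mul iq (ram_mul ir is))))
        rw [icl_mul b2 (mul_ne_zero bq (mul_ne_zero br bs)), icl_mul bq (mul_ne_zero br bs), icl_mul br bs, ← mul_assoc] at this
        rw [eq_inv_of_mul_eq_one_right this]
        exact S.inv_mem (S.mul_mem m2 mq)
    have hrs2 : icl Ir ∈ S ∧ icl Is ∈ S := by
      rcases hsq with h | h
      · have h1 := icl_of_principal (squ_principal h ir)
        rw [h1, one_mul] at hrs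
        exact ⟨h1 ▸ S.one_mem, hrs⟩
      · have h1 := icl_of_principal (squ_principal h is)
        rw [h1, mul_one] at hrs
        exact ⟨hrs, h1 ▸ S.one_mem⟩
    refine fun x hx => tors_mem h2 σ θ D hD0 hθ hσ (negone e H D hD) S ?_ x hx
    intro p _ hp hpm
    rcases hram p hp hpm with rfl | rfl | rfl | rfl
    exacts [m2, mq, hrs2.1, hrs2.2]
  refine ⟨card_tors_le hP hQ hPQ, icl I2, hP, fun y hy => ?_⟩
  have hrep := rep_of_sq h2 σ θ D hD0 hθ hσ I2 b2 y hy.symm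
  rw [ram_norm h2 i2] at hrep
  have key : ∀ D1 : ℤ, (D : ℤ) = r * D1 → ¬ (r : ℤ) ∣ D1 → False := fun D1 hD1 hn => by
    rw [hD1] at hrep
    exact rep_neg r H.rm D1 _ hn H.r2 hrep
  have hq0 : legendreSym r q ≠ 0 := by
    intro h0
    have := (legendreSym.eq_zero_iff r q).1 h0
    have h4 := H.r8
    have h5 := H.q4
    rw [ZMod.intCast_zmod_eq_zero_iff_dvd] at this
    have := (Nat.prime_dvd_prime_iff_eq (Fact.out : r.Prime) (Fact.out : q.Prime)).1 (by exact_mod_cast this)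
    subst this
    omega
  rcases hD with rfl | rfl
  · refine key (q * s) (by push_cast; ring) (leg_not_dvd r _ ?_)
    rw [legendreSym.mul, H.rs]; simpa using hq0
  · refine key (2 * (q * s)) (by push_cast; ring) (leg_not_dvd r _ ?_)
    rw [legendreSym.mul, legendreSym.mul, H.rs, H.r2]; simpa using hq0

/-- The companion field. -/
theorem F'_main (h2 : finrank ℚ K = 2) (σ : K ≃ₐ[ℚ] K) (e : ℤ) (H : LegData q r s e)
    (D : ℕ) (hD : (e = -1 ∧ D = q * (r * s) ∧ SqU K (2 * q)) ∨ (e = 1 ∧ D = 2 * (q * (r * s)) ∧ SqU K q))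
    (θ : 𝓞 K) (hθ : θ ^ 2 = D) (hσ : σ θ = -θ) :
    ∃ Ir Is : Ideal (𝓞 K), Ir ^ 2 = Ideal.span {(r : 𝓞 K)} ∧ Is ^ 2 = Ideal.span {(s : 𝓞 K)} ∧
      ∀ y, tp y → y ∈ Subgroup.closure {icl Ir, icl Is} := by
  have hq := (Fact.out : q.Prime).ne_zero
  have hr := (Fact.out : r.Prime).ne_zero
  have hs := (Fact.out : s.Prime).ne_zero
  have hDD : D = q * (r * s) ∨ D = 2 * (q * (r * s)) := by tauto
  have hD0 : 0 < D := by rcases hDD with rfl | rfl <;> positivity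
  obtain ⟨I2, Iq, Ir, Is, i2, iq, ir, is, hram⟩ := ram4 h2 H D hDD θ hθ
  have b2 := ram_ne_bot two_ne_zero i2
  have bq := ram_ne_bot hq iq
  have br := ram_ne_bot hr ir
  have bs := ram_ne_bot hs is
  have hR : icl Ir ^ 2 = 1 := ram_icl_sq hr ir
  have hS : icl Is ^ 2 = 1 := ram_icl_sq hs is
  refine ⟨Ir, Is, ir, is, ?_⟩
  have htors : ∀ x : ClassGroup (𝓞 K), x ^ 2 = 1 → x ∈ Subgroup.closure {icl Ir, icl Is} := by
    set S := Subgroup.closure {icl Ir, icl Is} with hSdef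
    have mr : icl Ir ∈ S := Subgroup.subset_closure (by simp)
    have ms : icl Is ∈ S := Subgroup.subset_closure (by simp)
    have h2q : icl I2 ∈ S ∧ icl Iq ∈ S := by
      have hU := squ_theta θ hθ
      rcases hD with ⟨-, rfl, hU2⟩ | ⟨-, rfl, hU2⟩
      · have h1 := icl_of_principal (squ_principal hU (ram_mul iq (ram_mul ir is)))
        rw [icl_mul bq (mul_ne_zero br bs), icl_mul br bs] at h1
        have h3 : icl Iq ∈ S := by
          rw [eq_inv_of_mul_eq_one_left h1]
          exact S.inv_mem (S.mul_mem mr ms)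
        have h4 := icl_of_principal (squ_principal hU2 (ram_mul i2 iq))
        rw [icl_mul b2 bq] at h4
        rw [eq_inv_of_mul_eq_one_left h4]
        exact ⟨S.inv_mem h3, h3⟩
      · have h1 := icl_of_principal (squ_principal hU (ram_mul i2 (ram_mul iq (ram_mul ir is))))
        rw [icl_mul b2 (mul_ne_zero bq (mul_ne_zero br bs)), icl_mul bq (mul_ne_zero br bs), icl_mul br bs,
          icl_of_principal (squ_principal hU2 iq), one_mul] at h1
        rw [eq_inv_of_mul_eq_one_left h1, icl_of_principal (squ_principal hU2 iq)]
        exact ⟨S.inv_mem (S.mul_mem mr ms), S.one_mem⟩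
    refine fun x hx => tors_mem h2 σ θ D hD0 hθ hσ (negone e H D hDD) S ?_ x hx
    intro p _ hp hpm
    rcases hram p hp hpm with rfl | rfl | rfl | rfl
    exacts [h2q.1, h2q.2, mr, ms]
  -- no squares
  have keyr : ∀ d1 : ℕ, legendreSym r d1 = 1 → ¬ QRep D ((r * d1 : ℕ) : ℤ) := by
    intro d1 hd1
    push_cast
    rcases hD with ⟨rfl, rfl, -⟩ | ⟨rfl, rfl, -⟩
    · have := rep_neg_swap r H.rm (q * s) d1 (leg_not_dvd r _ (by rw [legendreSym.mul, H.rs, H.rq]; norm_num))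
        (by rw [legendreSym.mul, H.rs, H.rq, hd1]; norm_num)
      convert this using 2; push_cast; ring
    · have := rep_neg_swap r H.rm (2 * (q * s)) d1
        (leg_not_dvd r _ (by rw [legendreSym.mul, legendreSym.mul, H.rs, H.rq, H.r2]; norm_num))
        (by rw [legendreSym.mul, legendreSym.mul, H.rs, H.rq, H.r2, hd1]; norm_num)
      convert this using 2; push_cast; ring
  have keys : ¬ QRep D ((s * 1 : ℕ) : ℤ) := by
    push_cast
    rcases hD with ⟨rfl, rfl, -⟩ | ⟨rfl, rfl, -⟩
    · have := rep_neg_swap s H.sm (q * r) 1 (leg_not_dvd s _ (by rw [legendreSym.mul, H.sr, H.sq]; norm_num))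
        (by rw [legendreSym.mul, H.sr, H.sq]; simp)
      convert this using 2; push_cast; ring
    · have := rep_neg_swap s H.sm (2 * (q * r)) 1
        (leg_not_dvd s _ (by rw [legendreSym.mul, legendreSym.mul, H.sr, H.sq, H.s2]; norm_num))
        (by rw [legendreSym.mul, legendreSym.mul, H.sr, H.sq, H.s2]; simp)
      convert this using 2; push_cast; ring
  have hfour : ∀ c : ClassGroup (𝓞 K), (c ^ 2) ^ 2 = 1 → c ^ 2 = 1 := by
    intro c hc
    rcases pair_mem hR hS (htors _ hc) with h | h | h | h
    · exact h
    · exfalso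
      have := rep_of_sq h2 σ θ D hD0 hθ hσ Ir br c h.symm
      rw [ram_norm h2 ir] at this
      exact keyr 1 (by simp) (by simpa using this)
    · exfalso
      have := rep_of_sq h2 σ θ D hD0 hθ hσ Is bs c h.symm
      rw [ram_norm h2 is] at this
      exact keys (by simpa using this)
    · exfalso
      have := rep_of_sq h2 σ θ D hD0 hθ hσ (Ir * Is) (mul_ne_zero br bs) c (by rw [icl_mul br bs, h])
      rw [map_mul, ram_norm h2 is, ram_norm h2 ir] at this
      exact keyr s H.rs this
  rintro y ⟨k, hk⟩
  apply htors
  induction k with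
  | zero => rw [pow_zero, pow_one] at hk; rw [hk, one_pow]
  | succ k ih =>
    rcases k with _ | k
    · simpa using hk
    · apply ih
      rw [pow_succ, pow_succ, pow_mul, pow_mul] at hk
      rw [pow_succ, pow_mul]
      exact hfour _ hk

end

end

section

open NumberField Module
open scoped nonZeroDivisors

theorem val_step {Γ : Type*} [LinearOrderedCommGroupWithZero Γ] {L : Type*} [Field L]
    (v : Valuation L Γ) (h2 : v 2 < 1) (h20 : v 2 ≠ 0) (c : ℕ → L) (n : ℕ) (c0 : c 0 = 0)
    (cs : ∀ i < n, c (i+1) ^ 2 = 2 + c i) :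
    ∀ i ≤ n, v (c i) < 1 ∧ v (2 - c i) = v (2 + c i) ∧ v (2 - c i) ^ 2 ^ i = v 2 := by
  intro i
  induction i with
  | zero => intro _; simp [c0]
  | succ i ih =>
    intro hi
    obtain ⟨h1, h3, h4⟩ := ih (by omega)
    have hc := cs i (by omega)
    have hc1 : v (c (i+1)) < 1 := by
      have : v (c (i+1)) ^ 2 < 1 := by
        rw [← map_pow, hc]
        exact lt_of_le_of_lt (v.map_add _ _) (max_lt h2 h1)
      exact lt_of_not_ge fun h => absurd this (not_lt.2 (one_le_pow₀ h))
    have hle : v 2 ≤ v (2 - c i) := by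
      have h5 : v (2 - c i) ≤ 1 := le_trans (v.map_sub _ _) (max_le h2.le h1.le)
      calc v 2 = v (2 - c i) ^ 2 ^ i := h4.symm
        _ ≤ v (2 - c i) ^ 1 := pow_le_pow_right_of_le_one' h5 Nat.one_le_two_pow
        _ = _ := pow_one _
    have hab : v (2 - c (i+1)) * v (2 + c (i+1)) = v (2 - c i) := by
      rw [← map_mul]; congr 1; linear_combination -hc
    have h2c : v (2 * c (i+1)) < v 2 := by
      rw [map_mul]
      calc v 2 * v (c (i+1)) < v 2 * 1 := by
            exact mul_lt_mul_of_pos_left hc1 (zero_lt_iff.2 h20)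
        _ = _ := mul_one _
    have heq : v (2 - c (i+1)) = v (2 + c (i+1)) := by
      by_contra hne
      have h6 : ∀ a b : L, v a < v b → (b = a + 2 * c (i+1) ∨ b = a - 2 * c (i+1)) →
          v a * v b = v (2 - c i) → False := by
        intro a b hlt hb hm
        have hb' : v b < v 2 := by
          have : v b ≤ max (v a) (v (2 * c (i+1))) := by
            rcases hb with rfl | rfl
            · exact v.map_add _ _
            · exact v.map_sub _ _
          rcases le_max_iff.1 this with h | h
          · exact absurd hlt (not_lt.2 h)
          · exact lt_of_le_of_lt h h2c
        have : v a * v b < v 2 := by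
          calc v a * v b ≤ 1 * v b := by
                exact mul_le_mul_left ((hlt.trans hb').trans h2).le _
            _ = v b := one_mul _
            _ < v 2 := hb'
        rw [hm] at this
        exact absurd this (not_lt.2 hle)
      rcases lt_or_gt_of_ne hne with h | h
      · exact h6 _ _ h (Or.inl (by ring)) hab
      · exact h6 _ _ h (Or.inr (by ring)) (by rw [mul_comm]; exact hab)
    refine ⟨hc1, heq, ?_⟩
    rw [← heq, ← sq] at hab
    rw [pow_succ', pow_mul, hab, h4]

theorem val_top {Γ : Type*} [LinearOrderedCommGroupWithZero Γ] {L : Type*} [Field L] [CharZero L]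
    (v : Valuation L Γ) (h2 : v 2 < 1) (h20 : v 2 ≠ 0) (c : ℕ → L) (n : ℕ) (c0 : c 0 = 0)
    (cs : ∀ i < n, c (i+1) ^ 2 = 2 + c i) (s θ : L) (hs : s ^ 2 = 4 - c n ^ 2)
    (k : ℤ) (hθ : θ ^ 2 = 4 * k - 1) (hk : v (k : L) ≤ 1)
    (hInteg : v (((c n - 2) + s * θ) / 2) ≤ 1) :
    v (((c n - 2) + s * θ) / 2) ^ 2 ^ (n+1) = v 2 := by
  obtain ⟨h1, h3, h4⟩ := val_step v h2 h20 c n c0 cs n le_rfl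
  set u := ((c n - 2) + s * θ) / 2 with hu
  have hu2 : 2 * u = (c n - 2) + s * θ := by rw [hu]; field_simp
  have hq : u ^ 2 = -((2 - c n) * (u + (1 - k * (2 + c n)))) := by
    have : (2 * u - (c n - 2)) ^ 2 = (4 - c n ^ 2) * (4 * k - 1) := by
      rw [hu2, ← hs, ← hθ]; ring
    have h4 : (4 : L) ≠ 0 := by norm_num
    apply mul_left_cancel₀ h4
    linear_combination this
  have h2c : v (2 + c n) < 1 := lt_of_le_of_lt (v.map_add _ _) (max_lt h2 h1)
  have hkc : v (k * (2 + c n)) < 1 := by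
    rw [map_mul]
    exact lt_of_le_of_lt (mul_le_mul_left hk _) (by rwa [one_mul])
  have hw : v (1 - k * (2 + c n)) = 1 := by
    have := v.map_one_add_of_lt (x := -(k * (2 + c n))) (by rwa [Valuation.map_neg])
    rw [sub_eq_add_neg]; exact this
  have hlt : v u < 1 := by
    have : v u ^ 2 < 1 := by
      rw [← map_pow, hq, Valuation.map_neg, map_mul, h3]
      exact lt_of_le_of_lt (mul_le_mul_right (le_trans (v.map_add _ _) (max_le hInteg hw.le)) _)
        (by rwa [mul_one])
    exact lt_of_not_ge fun h => absurd this (not_lt.2 (one_le_pow₀ h))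
  have huw : v (u + (1 - k * (2 + c n))) = 1 := by
    rw [v.map_add_eq_of_lt_right (by rw [hw]; exact hlt), hw]
  have : v u ^ 2 = v (2 - c n) := by
    rw [← map_pow, hq, Valuation.map_neg, map_mul, huw, mul_one]
  rw [pow_succ', pow_mul, this, h4]

/-- if every prime over 2 has an element whose `N`th power of valuation is that of 2 -/
theorem tot_ram {L : Type*} [Field L] [NumberField L] (N : ℕ) (hN : 0 < N)
    (hle : finrank ℚ L ≤ N) (w : L) (hw : IsIntegral ℤ w)
    (H : ∀ v : Valuation L (WithZero (Multiplicative ℤ)), v 2 < 1 → v 2 ≠ 0 →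
      (∀ x : L, IsIntegral ℤ x → v x ≤ 1) → v w ^ N = v 2) :
    finrank ℚ L = N ∧ ∀ p q : Ideal (𝓞 L), p.IsMaximal → q.IsMaximal →
      (2 : 𝓞 L) ∈ p → (2 : 𝓞 L) ∈ q → p = q := by
  have h20 : (2 : 𝓞 L) ≠ 0 := by norm_num
  have key : ∀ p : Ideal (𝓞 L), p.IsMaximal → (2 : 𝓞 L) ∈ p → p ^ N ∣ Ideal.span {2} := by
    intro p hp h2p
    have hpb : p ≠ ⊥ := by rintro rfl; exact h20 ((Submodule.mem_bot _).1 h2p)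
    let P : IsDedekindDomain.HeightOneSpectrum (𝓞 L) := ⟨p, hp.isPrime, hpb⟩
    let W : 𝓞 L := ⟨w, hw⟩
    have hv2 : P.valuation L (2 : L) = P.intValuation (2 : 𝓞 L) := by
      rw [← P.valuation_of_algebraMap (K := L)]; congr 1
    have hvw : P.valuation L w = P.intValuation W := by
      rw [← P.valuation_of_algebraMap (K := L)]; rfl
    have hi : ∀ x : L, IsIntegral ℤ x → P.valuation L x ≤ 1 := fun x hx =>
      P.valuation_le_one (K := L) (⟨x, hx⟩ : 𝓞 L)
    have hlt : P.valuation L (2 : L) < 1 := by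
      rw [hv2, P.intValuation_lt_one_iff_dvd, Ideal.dvd_span_singleton]; exact h2p
    have hH := H (P.valuation L) hlt (by simp) hi
    rw [hv2, hvw] at hH
    have hW1 : P.intValuation W < 1 := by
      by_contra h
      have h1 : P.intValuation W = 1 := le_antisymm (P.intValuation_le_one _) (not_lt.1 h)
      rw [h1, one_pow, ← hv2] at hH
      exact absurd hlt (by rw [← hH]; exact lt_irrefl _)
    rw [P.intValuation_lt_one_iff_dvd, Ideal.dvd_span_singleton] at hW1
    have h3 : W ^ N ∈ p ^ N := Ideal.pow_mem_pow hW1 N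
    have h4 : P.intValuation (2 : 𝓞 L) ≤ WithZero.exp (-(N : ℤ)) := by
      rw [← hH, ← map_pow, P.intValuation_le_pow_iff_dvd, Ideal.dvd_span_singleton]
      exact h3
    rwa [P.intValuation_le_pow_iff_dvd] at h4
  have hnorm2 : Ideal.absNorm (Ideal.span {(2 : 𝓞 L)}) = 2 ^ finrank ℚ L := by
    rw [Ideal.absNorm_span_singleton]
    have := Algebra.norm_algebraMap (S := 𝓞 L) (2 : ℤ)
    have h3 : algebraMap ℤ (𝓞 L) 2 = 2 := by simp
    rw [h3] at this
    rw [this, RingOfIntegers.rank]; simp [Int.natAbs_pow]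
  have hge2 : ∀ p : Ideal (𝓞 L), p.IsMaximal → (2 : 𝓞 L) ∈ p → 2 ≤ Ideal.absNorm p := by
    intro p hp h2p
    have h0 : Ideal.absNorm p ≠ 0 := by
      rw [Ne, Ideal.absNorm_eq_zero_iff]
      rintro rfl; exact h20 ((Submodule.mem_bot _).1 h2p)
    have h1 : Ideal.absNorm p ≠ 1 := by
      rw [Ne, Ideal.absNorm_eq_one_iff]; exact hp.ne_top
    omega
  constructor
  · obtain ⟨p, hp, hle'⟩ := Ideal.exists_le_maximal (Ideal.span {(2 : 𝓞 L)}) (by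
      intro h
      have := hnorm2
      rw [h, Ideal.absNorm_top] at this
      have h3 : 0 < finrank ℚ L := finrank_pos
      have : 1 < 2 ^ finrank ℚ L := Nat.one_lt_two_pow h3.ne'
      omega)
    have h2p : (2 : 𝓞 L) ∈ p := hle' (Ideal.mem_span_singleton_self _)
    have h3 := map_dvd Ideal.absNorm (key p hp h2p)
    rw [hnorm2, map_pow] at h3
    have h4 := Nat.le_of_dvd (by positivity) h3
    have h5 : 2 ^ N ≤ 2 ^ finrank ℚ L := (Nat.pow_le_pow_left (hge2 p hp h2p) N).trans h4
    have := (Nat.pow_le_pow_iff_right (by norm_num : 1 < 2)).1 h5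
    omega
  · intro p q hp hq h2p h2q
    by_contra hne
    have hcop : IsCoprime (p ^ N) (q ^ N) := by
      apply IsCoprime.pow
      rw [Ideal.isCoprime_iff_sup_eq]
      exact Ideal.IsMaximal.coprime_of_ne hp hq hne
    have h3 := map_dvd Ideal.absNorm (hcop.mul_dvd (key p hp h2p) (key q hq h2q))
    rw [hnorm2, map_mul, map_pow, map_pow] at h3
    have h4 := Nat.le_of_dvd (by positivity) h3
    have h5 : 2 ^ N * 2 ^ N ≤ 2 ^ finrank ℚ L := le_trans (Nat.mul_le_mul
      (Nat.pow_le_pow_left (hge2 p hp h2p) N) (Nat.pow_le_pow_left (hge2 q hq h2q) N)) h4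
    rw [← pow_add] at h5
    have := (Nat.pow_le_pow_iff_right (by norm_num : 1 < 2)).1 h5
    omega

end

section

open NumberField Module IntermediateField
open scoped nonZeroDivisors

noncomputable def cc (n : ℕ) : ℝ := 2 * Real.cos (2 * Real.pi / 2 ^ (n + 2))
noncomputable def ss (n : ℕ) : ℝ := 2 * Real.sin (2 * Real.pi / 2 ^ (n + 2))

theorem cc_zero : cc 0 = 0 := by
  have : 2 * Real.pi / 2 ^ (0 + 2) = Real.pi / 2 := by ring
  rw [cc, this, Real.cos_pi_div_two, mul_zero]

theorem ss_zero : ss 0 = 2 := by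
  have : 2 * Real.pi / 2 ^ (0 + 2) = Real.pi / 2 := by ring
  rw [ss, this, Real.sin_pi_div_two, mul_one]

theorem ang_succ (n : ℕ) : 2 * Real.pi / 2 ^ (n + 2) = 2 * (2 * Real.pi / 2 ^ (n + 1 + 2)) := by
  rw [show n + 1 + 2 = (n + 2) + 1 by ring, pow_succ 2 (n+2)]
  field_simp

theorem cc_sq (n : ℕ) : cc (n+1) ^ 2 = 2 + cc n := by
  rw [cc, cc, ang_succ n, Real.cos_two_mul]; ring

theorem ss_mul (n : ℕ) : ss (n+1) * cc (n+1) = ss n := by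
  rw [cc, ss, ss, ang_succ n, Real.sin_two_mul]; ring

theorem ss_sq (n : ℕ) : ss n ^ 2 = 4 - cc n ^ 2 := by
  rw [cc, ss]
  have := Real.sin_sq_add_cos_sq (2 * Real.pi / 2 ^ (n + 2))
  linear_combination 4 * this

theorem ss_ne (n : ℕ) : ss n ≠ 0 := by
  induction n with
  | zero => rw [ss_zero]; norm_num
  | succ n ih => intro h; apply ih; rw [← ss_mul, h, zero_mul]

theorem cc_ne (n : ℕ) : cc (n+1) ≠ 0 := by
  intro h; apply ss_ne n; rw [← ss_mul, h, mul_zero]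

theorem cc_int (n : ℕ) : IsIntegral ℤ (cc n) := by
  induction n with
  | zero => rw [cc_zero]; exact isIntegral_zero
  | succ n ih =>
    apply IsIntegral.of_pow (n := 2) (by norm_num)
    rw [cc_sq]
    exact IsIntegral.add (isIntegral_algebraMap (x := (2:ℤ))) ih

theorem ss_int (n : ℕ) : IsIntegral ℤ (ss n) := by
  apply IsIntegral.of_pow (n := 2) (by norm_num)
  rw [ss_sq]
  exact IsIntegral.sub (isIntegral_algebraMap (x := (4:ℤ))) ((cc_int n).pow 2)

theorem cc_mem (L : IntermediateField ℚ ℝ) (n : ℕ) (h : cc n ∈ L) : ∀ i ≤ n, cc i ∈ L := by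
  induction n with
  | zero => intro i hi; rwa [Nat.le_zero.1 hi]
  | succ n ih =>
    intro i hi
    rcases Nat.lt_or_eq_of_le hi with h1 | rfl
    · refine ih ?_ i (by omega)
      have : cc n = cc (n+1) ^ 2 - 2 := by rw [cc_sq]; ring
      rw [this]
      exact L.sub_mem (L.pow_mem h 2) (by exact_mod_cast L.natCast_mem 2)
    · exact h

theorem ss_mem (L : IntermediateField ℚ ℝ) (n : ℕ) (h : cc n ∈ L) : ss n ∈ L := by
  induction n with
  | zero => rw [ss_zero]; exact_mod_cast L.natCast_mem 2
  | succ n ih =>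
    have h1 := ih (cc_mem L _ h n (by omega))
    rw [show ss (n+1) = ss n / cc (n+1) from (eq_div_of_mul_eq (cc_ne n) (ss_mul n))]
    exact L.div_mem h1 h

/-- divisors of 2 -/
theorem two_div (L : IntermediateField ℚ ℝ) (n : ℕ) (h : cc n ∈ L) :
    ∃ t ∈ L, IsIntegral ℤ t ∧ ss n * t = 2 := by
  induction n with
  | zero => exact ⟨1, L.one_mem, isIntegral_one, by rw [ss_zero, mul_one]⟩
  | succ n ih =>
    obtain ⟨t, ht, h1, h3⟩ := ih (cc_mem L _ h n (by omega))
    exact ⟨cc (n+1) * t, L.mul_mem h ht, (cc_int _).mul h1, by rw [← mul_assoc, ss_mul, h3]⟩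

theorem two_div' (L : IntermediateField ℚ ℝ) (n : ℕ) (h : cc (n+1) ∈ L) :
    ∃ t ∈ L, IsIntegral ℤ t ∧ cc (n+1) * t = 2 := by
  obtain ⟨t, ht, h1, h3⟩ := two_div L n (cc_mem L _ h n (by omega))
  exact ⟨ss (n+1) * t, L.mul_mem (ss_mem L _ h) ht, (ss_int _).mul h1, by
    rw [← mul_assoc, mul_comm (cc _), ss_mul, h3]⟩

noncomputable instance (priority := 5000) leAlgebra {K L : IntermediateField ℚ ℝ} [h : Fact (K ≤ L)] : Algebra K L :=
  (inclusion h.out).toAlgebra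

noncomputable instance (priority := 5001) leModule {K L : IntermediateField ℚ ℝ} [h : Fact (K ≤ L)] :
    Module K L := Algebra.toModule

noncomputable instance (priority := 5000) ratAlgebra (L : IntermediateField ℚ ℝ) : Algebra ℚ L :=
  IntermediateField.algebra' L

noncomputable instance (priority := 5000) ratModule (L : IntermediateField ℚ ℝ) : Module ℚ L :=
  Algebra.toModule

theorem leAlg_coe {K L : IntermediateField ℚ ℝ} [h : Fact (K ≤ L)] (x : K) :
    ((algebraMap K L x : L) : ℝ) = x := rfl

instance leTower0 {K L : IntermediateField ℚ ℝ} [h : Fact (K ≤ L)] : IsScalarTower ℚ K L :=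
  IsScalarTower.of_algebraMap_eq fun x => by
    apply Subtype.ext; rw [leAlg_coe]; rfl

theorem leTower {K L M : IntermediateField ℚ ℝ} [Fact (K ≤ L)] [Fact (L ≤ M)] [Fact (K ≤ M)] :
    IsScalarTower K L M :=
  IsScalarTower.of_algebraMap_eq fun x => by
    apply Subtype.ext; rw [leAlg_coe, leAlg_coe, leAlg_coe]

theorem adj_top {K L : IntermediateField ℚ ℝ} [h : Fact (K ≤ L)] (x : L)
    (hL : L ≤ K ⊔ adjoin ℚ {(x:ℝ)}) : adjoin K {x} = ⊤ := by
  set S : IntermediateField ℚ L := (adjoin K {x}).restrictScalars ℚ with hS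
  have h1 : L ≤ S.map L.val := by
    refine hL.trans (sup_le ?_ ?_)
    · intro y hy
      refine ⟨⟨y, h.out hy⟩, ?_, rfl⟩
      exact (adjoin K {x}).algebraMap_mem ⟨y, hy⟩
    · rw [adjoin_le_iff, Set.singleton_subset_iff]
      exact ⟨x, mem_adjoin_simple_self K x, rfl⟩
  rw [eq_top_iff]
  intro y _
  obtain ⟨z, hz, hzy⟩ := h1 y.2
  have : z = y := Subtype.ext hzy
  rw [← this]; exact hz

theorem gen_ind {L : IntermediateField ℚ ℝ} (a b : L)
    (hL : L ≤ adjoin ℚ {(a:ℝ)} ⊔ adjoin ℚ {(b:ℝ)}) (S : Subfield L) (ha : a ∈ S) (hb : b ∈ S)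
    (y : L) : y ∈ S := by
  let T : IntermediateField ℚ L := S.toIntermediateField (fun x => by
    have := S.toSubring.toAddSubgroup
    exact SubfieldClass.ratCast_mem S x)
  have h1 : L ≤ T.map L.val := by
    refine hL.trans (sup_le ?_ ?_) <;> rw [adjoin_le_iff, Set.singleton_subset_iff]
    · exact ⟨a, ha, rfl⟩
    · exact ⟨b, hb, rfl⟩
  obtain ⟨z, hz, hzy⟩ := h1 y.2
  have : z = y := Subtype.ext hzy
  rw [← this]; exact hz

theorem gen_ext {L : IntermediateField ℚ ℝ} {M : Type*} [Field M] (a b : L)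
    (hL : L ≤ adjoin ℚ {(a:ℝ)} ⊔ adjoin ℚ {(b:ℝ)}) (f g : L →+* M) (ha : f a = g a)
    (hb : f b = g b) : f = g := by
  ext y
  exact gen_ind a b hL (RingHom.eqLocusField f g) ha hb y

theorem exists_aut {K L : Type*} [Field K] [Field L] [Algebra K L] [FiniteDimensional K L]
    (x y : L) (htop : adjoin K {x} = ⊤) (p : Polynomial K) (hp : p.Monic)
    (hd : p.natDegree = finrank K L) (hx : Polynomial.aeval x p = 0)
    (hy : Polynomial.aeval y p = 0) : ∃ σ : L ≃ₐ[K] L, σ x = y := by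
  have hi : IsIntegral K x := IsIntegral.of_finite K x
  have hdeg : (minpoly K x).natDegree = finrank K L := by
    rw [← adjoin.finrank hi, htop, finrank_top']
  have hmp : minpoly K x = p := by
    symm
    apply Polynomial.eq_of_monic_of_dvd_of_natDegree_le (minpoly.monic hi) hp
      (minpoly.dvd K x hx)
    rw [hd, hdeg]
  have hye : Polynomial.eval₂ (Algebra.ofId K L : K →+* L) y (minpoly K x) = 0 := by
    rw [hmp]; exact hy
  let e : adjoin K {x} ≃ₐ[K] L := (equivOfEq htop).trans topEquiv
  let f : adjoin K {x} →ₐ[K] L := (AdjoinRoot.liftAlgHom (minpoly K x) (Algebra.ofId K L) y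
    hye).comp (adjoinRootEquivAdjoin K hi).symm.toAlgHom
  let g : L →ₐ[K] L := f.comp e.symm.toAlgHom
  have hb := Algebra.IsAlgebraic.algHom_bijective g
  refine ⟨AlgEquiv.ofBijective g hb, ?_⟩
  have h1 : e.symm x = AdjoinSimple.gen K x := by
    rw [AlgEquiv.symm_apply_eq]; rfl
  show f (e.symm x) = y
  rw [h1]
  show AdjoinRoot.liftAlgHom (minpoly K x) (Algebra.ofId K L) y hye ((adjoinRootEquivAdjoin K hi).symm (AdjoinSimple.gen K x)) = y
  rw [adjoinRootEquivAdjoin_symm_apply_gen]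
  exact AdjoinRoot.liftAlgHom_root (minpoly K x) (Algebra.ofId K L) y hye

theorem exists_quad {K L : Type*} [Field K] [Field L] [Algebra K L] [FiniteDimensional K L]
    (x : L) (htop : adjoin K {x} = ⊤) (a : K) (hx : x ^ 2 = algebraMap K L a)
    (hd : finrank K L = 2) : ∃ σ : L ≃ₐ[K] L, σ x = -x := by
  apply exists_aut x (-x) htop (Polynomial.X ^ 2 - Polynomial.C a)
    (Polynomial.monic_X_pow_sub_C a two_ne_zero)
  · rw [hd, Polynomial.natDegree_X_pow_sub_C]
  · simp [hx]
  · simp [hx]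

theorem quad_le {K L : Type*} [Field K] [Field L] [Algebra K L] 
    (x : L) (htop : adjoin K {x} = ⊤) (a : K) (hx : x ^ 2 = algebraMap K L a) :
    FiniteDimensional K L ∧ finrank K L ≤ 2 := by
  have hi : IsIntegral K x := IsIntegral.of_pow (n := 2) (by norm_num)
    (by rw [hx]; exact isIntegral_algebraMap)
  constructor
  · have := adjoin.finiteDimensional hi
    rw [htop] at this
    exact Module.Finite.equiv (topEquiv (F := K) (E := L)).toLinearEquiv
  rw [← finrank_top', ← htop, adjoin.finrank hi]
  have h1 : (Polynomial.X ^ 2 - Polynomial.C a).natDegree = 2 := Polynomial.natDegree_X_pow_sub_C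
  rw [← h1]
  apply Polynomial.natDegree_le_of_dvd
  · apply minpoly.dvd; simp [hx]
  · exact (Polynomial.monic_X_pow_sub_C a two_ne_zero).ne_zero

end

section

open NumberField Module IntermediateField
open scoped nonZeroDivisors

noncomputable abbrev Fld (D : ℕ) : IntermediateField ℚ ℝ := adjoin ℚ {Real.sqrt (D : ℕ)}

theorem sqrt_int (D : ℕ) : IsIntegral ℤ (Real.sqrt D) := by
  apply IsIntegral.of_pow (n := 2) (by norm_num)
  rw [Real.sq_sqrt (Nat.cast_nonneg _)]
  exact_mod_cast isIntegral_algebraMap (R := ℤ) (A := ℝ) (x := (D:ℤ))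

theorem sqrt_mem_Fld (D : ℕ) : Real.sqrt D ∈ Fld D := mem_adjoin_simple_self ℚ _

theorem cc_one_sq : cc 1 ^ 2 = 2 := by rw [cc_sq, cc_zero, add_zero]

theorem cc_one : cc 1 = Real.sqrt (2:ℕ) := by
  have h : 0 ≤ cc 1 := by
    have : 2 * Real.pi / 2 ^ (1 + 2) = Real.pi / 4 := by ring
    rw [cc, this, Real.cos_pi_div_four]; positivity
  rw [← Real.sqrt_sq h, cc_one_sq]; norm_num

theorem Fld_le_layer (D n : ℕ) : Fld D ≤ layer (Fld D) n := le_sup_left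

theorem sqrt_mem_layer (D n : ℕ) : Real.sqrt D ∈ layer (Fld D) n :=
  Fld_le_layer D n (sqrt_mem_Fld D)

theorem cc_mem_layer (F : IntermediateField ℚ ℝ) (n : ℕ) : cc n ∈ layer F n :=
  (le_sup_right : _ ≤ layer F n) (mem_adjoin_simple_self ℚ _)

theorem layer_zero (F : IntermediateField ℚ ℝ) : layer F 0 = F := by
  have : adjoin ℚ {cc 0} = ⊥ := by rw [cc_zero]; exact adjoin_zero
  show F ⊔ adjoin ℚ {cc 0} = F
  rw [this, sup_bot_eq]

theorem layer_mono (F : IntermediateField ℚ ℝ) {m n : ℕ} (h : m ≤ n) : layer F m ≤ layer F n := by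
  refine sup_le le_sup_left ?_
  rw [adjoin_le_iff, Set.singleton_subset_iff]
  exact cc_mem _ n (cc_mem_layer F n) m h

theorem layer_gen (F : IntermediateField ℚ ℝ) (m n : ℕ) :
    layer F n ≤ layer F m ⊔ adjoin ℚ {cc n} :=
  sup_le (le_sup_left.trans le_sup_left) le_sup_right

instance layerFact (F : IntermediateField ℚ ℝ) (n : ℕ) : Fact (layer F n ≤ layer F (n+1)) :=
  ⟨layer_mono F (Nat.le_succ n)⟩

theorem layerFact' (F : IntermediateField ℚ ℝ) {m n : ℕ} (h : m ≤ n) :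
    Fact (layer F m ≤ layer F n) := ⟨layer_mono F h⟩

theorem layer_top (F : IntermediateField ℚ ℝ) {m n : ℕ} [Fact (layer F m ≤ layer F n)] :
    adjoin (layer F m) {(⟨cc n, cc_mem_layer F n⟩ : layer F n)} = ⊤ :=
  adj_top _ (layer_gen F m n)

theorem layer_sq (F : IntermediateField ℚ ℝ) (n : ℕ) :
    (⟨cc (n+1), cc_mem_layer F (n+1)⟩ : layer F (n+1)) ^ 2 =
      algebraMap (layer F n) (layer F (n+1)) (2 + ⟨cc n, cc_mem_layer F n⟩) := by
  apply Subtype.ext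
  rw [leAlg_coe]
  exact cc_sq n

theorem Fld_fin (D : ℕ) : FiniteDimensional ℚ (Fld D) ∧ finrank ℚ (Fld D) ≤ 2 := by
  have htop : adjoin ℚ {(⟨Real.sqrt D, sqrt_mem_Fld D⟩ : Fld D)} = ⊤ := by
    rw [eq_top_iff]
    intro y _
    have h1 : Fld D ≤ (adjoin ℚ {(⟨Real.sqrt D, sqrt_mem_Fld D⟩ : Fld D)}).map (Fld D).val := by
      rw [adjoin_le_iff, Set.singleton_subset_iff]
      exact ⟨_, mem_adjoin_simple_self ℚ _, rfl⟩
    obtain ⟨z, hz, hzy⟩ := h1 y.2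
    have : z = y := Subtype.ext hzy
    rw [← this]; exact hz
  exact quad_le _ htop (D : ℚ) (by
    apply Subtype.ext
    show Real.sqrt D ^ 2 = _
    rw [Real.sq_sqrt (Nat.cast_nonneg _)]; simp)

theorem layer_fin (D n : ℕ) : FiniteDimensional ℚ (layer (Fld D) n) ∧
    finrank ℚ (layer (Fld D) n) ≤ 2 ^ (n+1) := by
  induction n with
  | zero => rw [layer_zero]; exact Fld_fin D
  | succ n ih =>
    obtain ⟨h1, h3⟩ := ih
    obtain ⟨h4, h5⟩ := quad_le _ (layer_top (Fld D)) _ (layer_sq (Fld D) n)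
    refine ⟨FiniteDimensional.trans ℚ (layer (Fld D) n) _, ?_⟩
    rw [← finrank_mul_finrank ℚ (layer (Fld D) n), pow_succ]
    exact Nat.mul_le_mul h3 h5

instance Fld_nf (D : ℕ) : NumberField (Fld D) := @NumberField.mk _ _ inferInstance (Fld_fin D).1
instance layer_nf (D n : ℕ) : NumberField (layer (Fld D) n) := 
  @NumberField.mk _ _ inferInstance (layer_fin D n).1

theorem layer_gen2 (D n : ℕ) : layer (Fld D) n ≤ adjoin ℚ {Real.sqrt D} ⊔ adjoin ℚ {cc n} := le_rfl

/-- totally real -/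
theorem tot_real {L : IntermediateField ℚ ℝ} [NumberField L] (a b : L)
    (hL : L ≤ adjoin ℚ {(a:ℝ)} ⊔ adjoin ℚ {(b:ℝ)})
    (ha : ∀ φ : L →+* ℂ, ∃ t : ℝ, φ a = t) (hb : ∀ φ : L →+* ℂ, ∃ t : ℝ, φ b = t) :
    IsTotallyReal L := by
  refine ⟨fun v => ?_⟩
  rw [InfinitePlace.isReal_iff, ComplexEmbedding.isReal_iff]
  apply gen_ext a b hL
  · obtain ⟨t, ht⟩ := ha v.embedding
    rw [ComplexEmbedding.conjugate_coe_eq, ht, Complex.conj_ofReal]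
  · obtain ⟨t, ht⟩ := hb v.embedding
    rw [ComplexEmbedding.conjugate_coe_eq, ht, Complex.conj_ofReal]

theorem real_of_sq (z : ℂ) (t : ℝ) (ht : 0 ≤ t) (h : z ^ 2 = t) : ∃ u : ℝ, z = u ∧ u ^ 2 = t := by
  have : (z - Real.sqrt t) * (z + Real.sqrt t) = 0 := by
    have h1 : ((Real.sqrt t : ℝ) : ℂ) ^ 2 = t := by rw [← Complex.ofReal_pow, Real.sq_sqrt ht]
    linear_combination h - h1
  rcases mul_eq_zero.1 this with h | h
  · exact ⟨Real.sqrt t, by linear_combination h, Real.sq_sqrt ht⟩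
  · exact ⟨-Real.sqrt t, by push_cast; linear_combination h, by rw [neg_sq, Real.sq_sqrt ht]⟩

theorem cc_real {L : IntermediateField ℚ ℝ} (n : ℕ) (h : cc n ∈ L) (φ : L →+* ℂ) :
    ∃ t : ℝ, φ ⟨cc n, h⟩ = t ∧ |t| ≤ 2 := by
  induction n with
  | zero =>
    refine ⟨0, ?_, by simp⟩
    have : (⟨cc 0, h⟩ : L) = 0 := Subtype.ext cc_zero
    rw [this]; simp
  | succ n ih =>
    obtain ⟨t, ht, h1⟩ := ih (cc_mem L _ h n (by omega))
    rw [abs_le] at h1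
    obtain ⟨u, hu, hu2⟩ := real_of_sq (φ ⟨cc (n+1), h⟩) (2 + t) (by linarith) (by
      rw [← map_pow]
      have : (⟨cc (n+1), h⟩ : L) ^ 2 = 2 + ⟨cc n, cc_mem L _ h n (by omega)⟩ := Subtype.ext (cc_sq n)
      rw [this, map_add, ht, map_ofNat]; simp)
    refine ⟨u, hu, abs_le_of_sq_le_sq (by rw [hu2]; linarith) (by norm_num)⟩

theorem sqrt_real {L : IntermediateField ℚ ℝ} (D : ℕ) (h : Real.sqrt D ∈ L) (φ : L →+* ℂ) :
    ∃ t : ℝ, φ ⟨Real.sqrt D, h⟩ = t := by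
  obtain ⟨u, hu, -⟩ := real_of_sq (φ ⟨Real.sqrt D, h⟩) D (by positivity) (by
      rw [← map_pow]
      have : (⟨Real.sqrt D, h⟩ : L) ^ 2 = (D : L) := Subtype.ext (Real.sq_sqrt (Nat.cast_nonneg _))
      rw [this]; simp)
  exact ⟨u, hu⟩

instance layer_real (D n : ℕ) : IsTotallyReal (layer (Fld D) n) :=
  tot_real ⟨_, sqrt_mem_layer D n⟩ ⟨_, cc_mem_layer _ n⟩ (layer_gen2 D n)
    (fun φ => sqrt_real D _ φ) (fun φ => (cc_real n _ φ).imp fun _ h => h.1)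

instance Fld_real (D : ℕ) : IsTotallyReal (Fld D) :=
  tot_real ⟨_, sqrt_mem_Fld D⟩ ⟨_, sqrt_mem_Fld D⟩ le_sup_left
    (fun φ => sqrt_real D _ φ) (fun φ => sqrt_real D _ φ)

/-- ramification -/
theorem ram_tower {L : IntermediateField ℚ ℝ} [NumberField L] (n D1 : ℕ) (hD : D1 % 4 = 3)
    (hle : finrank ℚ L ≤ 2 ^ (n+1)) (hc : cc n ∈ L) (hθ : Real.sqrt D1 ∈ L) :
    finrank ℚ L = 2 ^ (n+1) ∧ ∀ p q : Ideal (𝓞 L), p.IsMaximal → q.IsMaximal →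
      (2 : 𝓞 L) ∈ p → (2 : 𝓞 L) ∈ q → p = q := by
  obtain ⟨k, hk⟩ : ∃ k : ℤ, (D1 : ℤ) = 4 * k - 1 := ⟨(D1 + 1)/4, by omega⟩
  let c : ℕ → L := fun i => if h : i ≤ n then ⟨cc i, cc_mem L n hc i h⟩ else 0
  have hci : ∀ i (h : i ≤ n), c i = ⟨cc i, cc_mem L n hc i h⟩ := fun i h => by simp [c, h]
  let s : L := ⟨ss n, ss_mem L n hc⟩
  let θ : L := ⟨Real.sqrt D1, hθ⟩
  have hθ2 : θ ^ 2 = 4 * k - 1 := by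
    have h1 : θ ^ 2 = (D1 : L) := Subtype.ext (Real.sq_sqrt (Nat.cast_nonneg _))
    rw [h1]; exact_mod_cast congrArg (Int.cast (R := L)) hk
  have hs2 : s ^ 2 = 4 - c n ^ 2 := by rw [hci n le_rfl]; exact Subtype.ext (ss_sq n)
  have hinj : ∀ x : L, IsIntegral ℤ (x : ℝ) → IsIntegral ℤ x := fun x hx =>
    (isIntegral_algHom_iff (L.val.restrictScalars ℤ) L.val.injective).1 hx
  have hcint : IsIntegral ℤ (c n) := by rw [hci n le_rfl]; exact hinj _ (cc_int n)
  have hwint : IsIntegral ℤ (((c n - 2) + s * θ) / 2) := by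
    have h2i : IsIntegral ℤ (2 : L) := by
      simpa using isIntegral_algebraMap (R := ℤ) (A := L) (x := (2:ℤ))
    have hki : IsIntegral ℤ (k : L) := by
      simpa using isIntegral_algebraMap (R := ℤ) (A := L) (x := k)
    set u := ((c n - 2) + s * θ) / 2 with hu
    have hu2 : 2 * u = (c n - 2) + s * θ := by rw [hu]; field_simp
    have hq : u ^ 2 + (2 - c n) * u + (2 - c n) * (1 - k * (2 + c n)) = 0 := by
      have : (2 * u - (c n - 2)) ^ 2 = (4 - c n ^ 2) * (4 * k - 1) := by
        rw [hu2, ← hs2, ← hθ2]; ring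
      have h4 : (4 : L) ≠ 0 := by norm_num
      apply mul_left_cancel₀ h4
      linear_combination this
    have hA : IsIntegral ℤ (2 - c n) := h2i.sub hcint
    have hB : IsIntegral ℤ ((2 - c n) * (1 - k * (2 + c n))) :=
      hA.mul (isIntegral_one.sub (hki.mul (h2i.add hcint)))
    let R := integralClosure ℤ L
    have : IsIntegral R u := by
      let a : R := ⟨_, hA⟩
      let b : R := ⟨_, hB⟩
      refine ⟨Polynomial.X ^ 2 + (Polynomial.C a * Polynomial.X + Polynomial.C b), ?_, ?_⟩
      · exact Polynomial.monic_X_pow_add (n := 2) (Polynomial.degree_linear_lt)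
      · have h3 : u ^ 2 + ((2 - c n) * u + (2 - c n) * (1 - k * (2 + c n))) = 0 := by
          rw [← hq]; ring
        simpa using h3
    exact isIntegral_trans (A := R) u this
  refine tot_ram (2^(n+1)) (by positivity) hle _ hwint ?_
  intro v h2 h20 hi
  refine val_top v h2 h20 c n ?_ ?_ s θ hs2 k hθ2 (hi _ ?_) (hi _ hwint)
  · rw [hci 0 (by omega)]; exact Subtype.ext cc_zero
  · intro i h
    rw [hci i (by omega), hci (i+1) (by omega)]
    exact Subtype.ext (cc_sq i)
  · simpa using isIntegral_algebraMap (R := ℤ) (A := L) (x := k)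

theorem ram_base {L : IntermediateField ℚ ℝ} [NumberField L] (D1 : ℕ) (hD : D1 % 2 = 1)
    (hle : finrank ℚ L ≤ 2) (hθ : Real.sqrt (2 * D1 : ℕ) ∈ L) :
    finrank ℚ L = 2 ∧ ∀ p q : Ideal (𝓞 L), p.IsMaximal → q.IsMaximal →
      (2 : 𝓞 L) ∈ p → (2 : 𝓞 L) ∈ q → p = q := by
  let θ : L := ⟨Real.sqrt (2 * D1 : ℕ), hθ⟩
  have hθ2 : θ ^ 2 = 2 * (D1 : L) := by
    apply Subtype.ext
    show Real.sqrt (2 * D1 : ℕ) ^ 2 = _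
    rw [Real.sq_sqrt (Nat.cast_nonneg _)]; push_cast; rfl
  have hinj : ∀ x : L, IsIntegral ℤ (x : ℝ) → IsIntegral ℤ x := fun x hx =>
    (isIntegral_algHom_iff (L.val.restrictScalars ℤ) L.val.injective).1 hx
  refine tot_ram 2 (by norm_num) hle θ (hinj _ (sqrt_int _)) ?_
  intro v h2 h20 hi
  obtain ⟨j, hj⟩ : ∃ j : ℕ, D1 = 1 + 2 * j := ⟨D1/2, by omega⟩
  have h1 : v (D1 : L) = 1 := by
    rw [hj]; push_cast
    apply v.map_one_add_of_lt
    rw [map_mul]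
    exact lt_of_le_of_lt (mul_le_mul_right (hi (j:L)
      (by simpa using isIntegral_algebraMap (R := ℤ) (A := L) (x := (j:ℤ)))) _) (by rwa [mul_one])
  rw [← map_pow, hθ2, map_mul, h1, mul_one]

theorem layer_ram (D D1 n : ℕ) (hD1 : D1 % 4 = 3) (hD : D = D1 ∨ D = 2 * D1) :
    finrank ℚ (layer (Fld D) n) = 2 ^ (n+1) ∧ ∀ p q : Ideal (𝓞 (layer (Fld D) n)),
      p.IsMaximal → q.IsMaximal → (2 : 𝓞 (layer (Fld D) n)) ∈ p →
      (2 : 𝓞 (layer (Fld D) n)) ∈ q → p = q := by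
  rcases hD with rfl | rfl
  · exact ram_tower n D hD1 (layer_fin D n).2 (cc_mem_layer _ n) (sqrt_mem_layer D n)
  · rcases n with _ | n
    · exact ram_base D1 (by omega) (layer_fin _ 0).2 (sqrt_mem_layer _ 0)
    · refine ram_tower (n+1) D1 hD1 (layer_fin _ _).2 (cc_mem_layer _ _) ?_
      have h1 : cc 1 ∈ layer (Fld (2*D1)) (n+1) := cc_mem _ _ (cc_mem_layer _ _) 1 (by omega)
      have h3 : Real.sqrt D1 = Real.sqrt (2 * D1 : ℕ) / cc 1 := by
        rw [cc_one]; push_cast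
        rw [Real.sqrt_mul (by norm_num)]
        field_simp
      rw [h3]
      exact (layer _ _).div_mem (sqrt_mem_layer _ _) h1

theorem layer_rank (D D1 n : ℕ) (hD1 : D1 % 4 = 3) (hD : D = D1 ∨ D = 2 * D1) :
    finrank (layer (Fld D) n) (layer (Fld D) (n+1)) = 2 := by
  have h := finrank_mul_finrank ℚ (layer (Fld D) n) (layer (Fld D) (n+1))
  rw [(layer_ram D D1 n hD1 hD).1, (layer_ram D D1 (n+1) hD1 hD).1, pow_succ 2 (n+1)] at h
  exact Nat.eq_of_mul_eq_mul_left (by positivity) h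

noncomputable def ccO (F : IntermediateField ℚ ℝ) (n : ℕ) : 𝓞 (layer F n) :=
  ⟨⟨cc n, cc_mem_layer F n⟩,
    (isIntegral_algHom_iff ((layer F n).val.restrictScalars ℤ) (layer F n).val.injective).1
      (cc_int n)⟩

theorem layer_hP (D D1 n : ℕ) (hD1 : D1 % 4 = 3) (hD : D = D1 ∨ D = 2 * D1) 
    (p q : Ideal (𝓞 (layer (Fld D) (n+1)))) (hp : p.IsMaximal) (hq : q.IsMaximal)
    (h2p : 2 * ccO (Fld D) (n+1) ∈ p) (h2q : 2 * ccO (Fld D) (n+1) ∈ q) : p = q := by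
  obtain ⟨t, ht, h1, h3⟩ := two_div' (layer (Fld D) (n+1)) n (cc_mem_layer _ _)
  let T : 𝓞 (layer (Fld D) (n+1)) := ⟨⟨t, ht⟩, 
    (isIntegral_algHom_iff ((layer (Fld D) (n+1)).val.restrictScalars ℤ)
      (layer (Fld D) (n+1)).val.injective).1 h1⟩
  have hT : ccO (Fld D) (n+1) * T = 2 := by
    apply RingOfIntegers.coe_injective
    apply Subtype.ext
    exact h3
  have key : ∀ p : Ideal (𝓞 (layer (Fld D) (n+1))), p.IsMaximal → 
      2 * ccO (Fld D) (n+1) ∈ p → (2 : 𝓞 (layer (Fld D) (n+1))) ∈ p := by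
    intro p hp h
    rcases hp.isPrime.mem_or_mem h with h | h
    · exact h
    · rw [← hT]; exact p.mul_mem_right _ h
  exact (layer_ram D D1 (n+1) hD1 hD).2 p q hp hq (key p hp h2p) (key q hq h2q)

end

section

open NumberField Module IntermediateField
open scoped nonZeroDivisors

theorem ker_step {K L : Type*} [Field K] [Field L] [NumberField K] [NumberField L] [Algebra K L]
    [IsTotallyReal K] [IsTotallyReal L] (φ : L →+* ℝ) (h2 : finrank K L = 2) (σ : L ≃ₐ[K] L)
    (x : 𝓞 L) (hx : (x : L) ≠ 0) (hσ : σ x = -x)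
    (hP : ∀ p q : Ideal (𝓞 L), p.IsMaximal → q.IsMaximal → 2*x∈p → 2*x∈q → p=q)
    (hs : Function.Surjective (clNorm K L)) (y : ClassGroup (𝓞 L)) (hy : clNorm K L y = 1) :
    ∃ z, y = z / clMap (σ : L ≃+* L) z :=
  ker_of_surj (clNorm K L) (clMap (σ : L ≃+* L)) hs (clNorm_clMap σ)
    (amb_bound φ h2 σ x hx hσ hP) y hy

instance layerFact0 (F : IntermediateField ℚ ℝ) (n : ℕ) : Fact (layer F 0 ≤ layer F n) :=
  layerFact' F (Nat.zero_le n)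
instance layerFact2 (F : IntermediateField ℚ ℝ) (n : ℕ) : Fact (layer F n ≤ layer F (n+2)) :=
  layerFact' F (by omega)

def JJ (D n : ℕ) : Prop := ∀ x : ClassGroup (𝓞 (layer (Fld D) (n+1))), tp x →
  clNorm (layer (Fld D) n) (layer (Fld D) (n+1)) x = 1 → x = 1

theorem layer_sigma (D D1 n : ℕ) (hD1 : D1 % 4 = 3) (hD : D = D1 ∨ D = 2 * D1) :
    ∃ σ : layer (Fld D) (n+1) ≃ₐ[layer (Fld D) n] layer (Fld D) (n+1),
      σ (ccO (Fld D) (n+1) : layer (Fld D) (n+1)) = -(ccO (Fld D) (n+1) : layer (Fld D) (n+1)) := by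
  haveI : FiniteDimensional (layer (Fld D) n) (layer (Fld D) (n+1)) := 
    FiniteDimensional.of_finrank_pos (by rw [layer_rank D D1 n hD1 hD]; norm_num)
  exact exists_quad _ (layer_top (Fld D)) _ (layer_sq (Fld D) n) (layer_rank D D1 n hD1 hD)

theorem ccO_ne (F : IntermediateField ℚ ℝ) (n : ℕ) : (ccO F (n+1) : layer F (n+1)) ≠ 0 := fun h =>
  cc_ne n (congrArg Subtype.val h)

theorem layer_gamma (D D1 n : ℕ) (hD1 : D1 % 4 = 3) (hD : D = D1 ∨ D = 2 * D1) :
    ∃ γ : layer (Fld D) (n+2) ≃ₐ[layer (Fld D) n] layer (Fld D) (n+2),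
      γ ⟨cc (n+2), cc_mem_layer _ _⟩ = ⟨ss (n+2), ss_mem _ _ (cc_mem_layer _ _)⟩ := by
  have hr : finrank (layer (Fld D) n) (layer (Fld D) (n+2)) = 4 := by
    have h := finrank_mul_finrank ℚ (layer (Fld D) n) (layer (Fld D) (n+2))
    rw [(layer_ram D D1 n hD1 hD).1, (layer_ram D D1 (n+2) hD1 hD).1,
      show n + 2 + 1 = (n + 1) + 2 by ring, pow_add 2 (n+1) 2] at h
    exact Nat.eq_of_mul_eq_mul_left (by positivity) h
  haveI : FiniteDimensional (layer (Fld D) n) (layer (Fld D) (n+2)) := 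
    FiniteDimensional.of_finrank_pos (by rw [hr]; norm_num)
  have hsq : ss (n+2) ^ 2 = 2 - cc (n+1) := by rw [ss_sq, cc_sq]; ring
  have hdeg : (Polynomial.C (1 : layer (Fld D) n) * Polynomial.X ^ 4 + 
      Polynomial.C (-4) * Polynomial.X ^ 2 + Polynomial.C (2 - (⟨cc n, cc_mem_layer _ _⟩ : layer (Fld D) n))).natDegree = 4 := by
    compute_degree!
  apply exists_aut _ _ (layer_top (Fld D)) 
    (Polynomial.C (1 : layer (Fld D) n) * Polynomial.X ^ 4 + 
      Polynomial.C (-4) * Polynomial.X ^ 2 + Polynomial.C (2 - (⟨cc n, cc_mem_layer _ _⟩ : layer (Fld D) n)))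
  · monicity!
  · rw [hr]; exact hdeg
  · simp only [map_add, map_mul, Polynomial.aeval_C, Polynomial.aeval_X_pow]
    apply Subtype.ext
    show 1 * cc (n+2) ^ 4 + (-4) * cc (n+2) ^ 2 + (2 - cc n) = 0
    have h1 := cc_sq (n+1)
    have h3 := cc_sq n
    rw [show cc (n+2) ^ 4 = (cc (n+1+1) ^ 2) ^ 2 by ring, show cc (n+2) = cc (n+1+1) from rfl, h1]
    linear_combination h3
  · simp only [map_add, map_mul, Polynomial.aeval_C, Polynomial.aeval_X_pow]
    apply Subtype.ext
    show 1 * ss (n+2) ^ 4 + (-4) * ss (n+2) ^ 2 + (2 - cc n) = 0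
    have h3 := cc_sq n
    rw [show ss (n+2) ^ 4 = (ss (n+2) ^ 2) ^ 2 by ring, hsq]
    linear_combination h3

theorem J_step (D D1 n : ℕ) (hD1 : D1 % 4 = 3) (hD : D = D1 ∨ D = 2 * D1)
    (hs : Function.Surjective (clNorm (layer (Fld D) (n+1)) (layer (Fld D) (n+2))))
    (hJ : JJ D n) : JJ D (n+1) := by
  obtain ⟨σ1, h1⟩ := layer_sigma D D1 n hD1 hD
  obtain ⟨σ2, h2⟩ := layer_sigma D D1 (n+1) hD1 hD
  obtain ⟨γ, hγ⟩ := layer_gamma D D1 n hD1 hD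
  let K0 := layer (Fld D) n
  let K := layer (Fld D) (n+1)
  let L := layer (Fld D) (n+2)
  have hq1 : cc (n+1) ∈ L := layer_mono (Fld D) (by omega : n+1 ≤ n+2) (cc_mem_layer _ _)
  have hq0 : cc n ∈ K0 := cc_mem_layer _ _
  -- values of γ
  have hγ1 : γ (⟨cc (n+1), hq1⟩ : L) = -⟨cc (n+1), hq1⟩ := by
    have e1 : (⟨cc (n+1), hq1⟩ : L) = (⟨cc (n+2), cc_mem_layer _ _⟩ : L) ^ 2 - 2 := by
      apply Subtype.ext
      show cc (n+1) = cc (n+1+1) ^ 2 - 2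
      rw [cc_sq]; ring
    rw [e1, map_sub, map_pow, hγ, map_ofNat, ← e1]
    apply Subtype.ext
    show ss (n+2) ^ 2 - 2 = - cc (n+1)
    rw [ss_sq, cc_sq]; ring
  have hsn : ss n ∈ K0 := ss_mem _ _ hq0
  have hsL : ss n ∈ L := layer_mono (Fld D) (by omega : n ≤ n+2) hsn
  have hγs0 : γ (⟨ss n, hsL⟩ : L) = ⟨ss n, hsL⟩ := γ.commutes (⟨ss n, hsn⟩ : K0)
  have hs1L : ss (n+1) ∈ L := ss_mem _ _ hq1
  have hγs1 : γ (⟨ss (n+1), hs1L⟩ : L) = - ⟨ss (n+1), hs1L⟩ := by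
    have e1 : (⟨ss (n+1), hs1L⟩ : L) * ⟨cc (n+1), hq1⟩ = ⟨ss n, hsL⟩ := Subtype.ext (ss_mul n)
    have e2 := congrArg γ e1
    rw [map_mul, hγ1, hγs0, ← e1] at e2
    have e3 : (⟨cc (n+1), hq1⟩ : L) ≠ 0 := fun h => cc_ne n (congrArg Subtype.val h)
    apply mul_right_cancel₀ e3
    linear_combination -e2
  have hγs2 : γ (⟨ss (n+2), ss_mem _ _ (cc_mem_layer _ _)⟩ : L) = - ⟨cc (n+2), cc_mem_layer _ _⟩ := by
    have e1 : (⟨ss (n+2), ss_mem _ _ (cc_mem_layer _ _)⟩ : L) * ⟨cc (n+2), cc_mem_layer _ _⟩ =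
      ⟨ss (n+1), hs1L⟩ := Subtype.ext (ss_mul (n+1))
    have e2 := congrArg γ e1
    rw [map_mul, hγ, hγs1, ← e1] at e2
    have e3 : (⟨ss (n+2), ss_mem _ _ (cc_mem_layer _ _)⟩ : L) ≠ 0 :=
      fun h => ss_ne (n+2) (congrArg Subtype.val h)
    apply mul_right_cancel₀ e3
    linear_combination e2
  have hθγ : γ (⟨Real.sqrt D, sqrt_mem_layer D _⟩ : L) = ⟨Real.sqrt D, sqrt_mem_layer D _⟩ :=
    γ.commutes (⟨Real.sqrt D, sqrt_mem_layer D _⟩ : K0)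
  have hθσ2 : σ2 (⟨Real.sqrt D, sqrt_mem_layer D _⟩ : L) = ⟨Real.sqrt D, sqrt_mem_layer D _⟩ :=
    σ2.commutes (⟨Real.sqrt D, sqrt_mem_layer D _⟩ : K)
  have hθσ1 : σ1 (⟨Real.sqrt D, sqrt_mem_layer D _⟩ : K) = ⟨Real.sqrt D, sqrt_mem_layer D _⟩ :=
    σ1.commutes (⟨Real.sqrt D, sqrt_mem_layer D _⟩ : K0)
  have hγγ : ∀ y : L, γ (γ y) = σ2 y := by
    have := gen_ext (L := L) (⟨Real.sqrt D, sqrt_mem_layer D _⟩ : L) (⟨cc (n+2), cc_mem_layer _ _⟩ : L)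
      (layer_gen2 D (n+2)) 
      (((γ : L ≃+* L) : L →+* L).comp ((γ : L ≃+* L) : L →+* L)) ((σ2 : L ≃+* L) : L →+* L)
      (by
        show γ (γ _) = σ2 _
        rw [hθγ, hθγ, hθσ2])
      (by
        show γ (γ _) = σ2 _
        rw [hγ, hγs2]; exact h2.symm)
    exact fun y => congrArg (fun f => f y) this
  have hg : ∀ k : K, γ (algebraMap K L k) = algebraMap K L (σ1 k) := by
    have := gen_ext (L := K) (⟨Real.sqrt D, sqrt_mem_layer D _⟩ : K) (⟨cc (n+1), cc_mem_layer _ _⟩ : K)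
      (layer_gen2 D (n+1)) 
      (((γ : L ≃+* L) : L →+* L).comp (algebraMap K L)) 
      ((algebraMap K L).comp ((σ1 : K ≃+* K) : K →+* K))
      (by
        show γ _ = algebraMap K L (σ1 _)
        rw [hθσ1]; exact hθγ)
      (by
        show γ _ = algebraMap K L (σ1 _)
        refine hγ1.trans ?_
        have h1' : σ1 (⟨cc (n+1), cc_mem_layer _ _⟩ : K) = -⟨cc (n+1), cc_mem_layer _ _⟩ := h1
        rw [h1', map_neg]; rfl)
    exact fun y => congrArg (fun f => f y) this
  have hker := ker_step (K := K) (L := L) (L.val : L →+* ℝ) (layer_rank D D1 (n+1) hD1 hD) σ2 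
    (ccO (Fld D) (n+2)) (ccO_ne _ _) h2 (layer_hP D D1 (n+1) hD1 hD) hs
  have hmm : ∀ z : ClassGroup (𝓞 L), clMap (γ : L ≃+* L) (clMap (γ : L ≃+* L) z) =
      clMap (σ2 : L ≃+* L) z := by
    intro z
    rw [clMap_trans]
    congr 2
    ext y
    exact congrArg Subtype.val (hγγ y)
  have hσ2inv := quad_inv (layer_rank D D1 (n+1) hD1 hD) σ2 _ (ccO_ne _ _) h2
  intro x hx hNx
  refine inj_step (clNorm K L) (clMap (γ : L ≃+* L)) (clMap (σ1 : K ≃+* K)) ?_ ?_ ?_ ?_ x hx hNx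
  · intro z
    rw [hmm, hmm, clMap_trans]
    exact clMap_of_id _ hσ2inv z
  · intro y hy
    obtain ⟨z, hz⟩ := hker y hy
    exact ⟨z, by rw [hmm]; exact hz⟩
  · intro z
    refine clNorm_equivariant (layer_rank D D1 (n+1) hD1 hD) σ2 _ (ccO_ne _ _) h2 (γ : L ≃+* L)
      (σ1 : K ≃+* K) hg ?_ z
    intro y
    show γ (σ2 y) = σ2 (γ y)
    rw [← hγγ, ← hγγ]
  · intro y hy
    rw [← div_eq_one]
    apply hJ
    · exact tp_div (tp_map _ hy) hy
    · rw [map_div, clNorm_clMap, div_self']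

end

section

open NumberField Module IntermediateField
open scoped nonZeroDivisors

theorem Fld_top (D : ℕ) : adjoin ℚ {(⟨Real.sqrt D, sqrt_mem_Fld D⟩ : Fld D)} = ⊤ := by
  rw [eq_top_iff]
  intro y _
  have h1 : Fld D ≤ (adjoin ℚ {(⟨Real.sqrt D, sqrt_mem_Fld D⟩ : Fld D)}).map (Fld D).val := by
    rw [adjoin_le_iff, Set.singleton_subset_iff]
    exact ⟨_, mem_adjoin_simple_self ℚ _, rfl⟩
  obtain ⟨z, hz, hzy⟩ := h1 y.2
  have : z = y := Subtype.ext hzy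
  rw [← this]; exact hz

noncomputable def sqO (L : IntermediateField ℚ ℝ) (D : ℕ) (h : Real.sqrt D ∈ L) : 𝓞 L :=
  ⟨⟨Real.sqrt D, h⟩,
    (isIntegral_algHom_iff (L.val.restrictScalars ℤ) L.val.injective).1 (sqrt_int D)⟩

theorem sqO_sq (L : IntermediateField ℚ ℝ) (D : ℕ) (h : Real.sqrt D ∈ L) :
    sqO L D h ^ 2 = (D : 𝓞 L) := by
  apply RingOfIntegers.coe_injective
  apply Subtype.ext
  have : Real.sqrt D ^ 2 = (D : ℝ) := Real.sq_sqrt (Nat.cast_nonneg _)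
  rw [map_natCast]
  exact this

theorem Fld_sigma (D : ℕ) (h2 : finrank ℚ (Fld D) = 2) : ∃ σ : Fld D ≃ₐ[ℚ] Fld D,
    σ (sqO (Fld D) D (sqrt_mem_Fld D) : Fld D) = -(sqO (Fld D) D (sqrt_mem_Fld D) : Fld D) := by
  haveI : FiniteDimensional ℚ (Fld D) := (Fld_fin D).1
  refine exists_quad _ (Fld_top D) (D : ℚ) ?_ h2
  apply Subtype.ext
  show Real.sqrt D ^ 2 = _
  rw [Real.sq_sqrt (Nat.cast_nonneg _)]; simp

theorem sqO_ne (L : IntermediateField ℚ ℝ) (D : ℕ) (h : Real.sqrt D ∈ L) (hD : 0 < D) :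
    (sqO L D h : L) ≠ 0 := fun h => by
  have : Real.sqrt D = 0 := congrArg Subtype.val h
  rw [Real.sqrt_eq_zero (Nat.cast_nonneg _)] at this
  have : D = 0 := by exact_mod_cast this
  omega

theorem Fld_two_triv (y : ClassGroup (𝓞 (Fld 2))) (hy : tp y) : y = 1 := by
  have hr := ram_base (L := Fld 2) 1 (by norm_num) (Fld_fin 2).2 (sqrt_mem_Fld 2)
  obtain ⟨σ, hσ⟩ := Fld_sigma 2 hr.1
  have hne := sqO_ne (Fld 2) 2 (sqrt_mem_Fld 2) (by norm_num)
  have hb := amb_bound (K := ℚ) (L := Fld 2) ((Fld 2).val : Fld 2 →+* ℝ) hr.1 σ _ hne hσ (by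
    have key : ∀ p : Ideal (𝓞 (Fld 2)), p.IsMaximal → 
      2 * sqO (Fld 2) 2 (sqrt_mem_Fld 2) ∈ p → (2 : 𝓞 (Fld 2)) ∈ p := by
      intro p hp h
      rcases hp.isPrime.mem_or_mem h with h | h
      · exact h
      · have := sqO_sq (Fld 2) 2 (sqrt_mem_Fld 2)
        have h3 := p.pow_mem_of_mem h 2 (by norm_num)
        rw [this] at h3; exact_mod_cast h3
    intro p q hp hq h2p h2q
    exact hr.2 p q hp hq (key p hp h2p) (key q hq h2q))
  haveI := pid_Q
  have hsub : Subsingleton (ClassGroup (𝓞 ℚ)) := by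
    rw [← Fintype.card_le_one_iff_subsingleton]
    exact (card_classGroup_eq_one_iff.2 pid_Q).le
  have h1 : Nat.card (ClassGroup (𝓞 ℚ)) = 1 := Nat.card_eq_one_iff_unique.2 ⟨hsub, inferInstance⟩
  rw [h1] at hb
  have hinv : ∀ c : ClassGroup (𝓞 (Fld 2)), c * clMap (σ : Fld 2 ≃+* Fld 2) c = 1 := by
    intro c
    rw [← clExt_clNorm hr.1 σ _ hne hσ c, Subsingleton.elim (clNorm ℚ (Fld 2) c) 1, map_one]
  have hsq : ∀ c : ClassGroup (𝓞 (Fld 2)), c ^ 2 = 1 → c = 1 := by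
    intro c hc
    have hfix : clMap (σ : Fld 2 ≃+* Fld 2) c = c := by
      apply mul_left_cancel (a := c)
      rw [hinv, ← sq, hc]
    have : Subsingleton {c : ClassGroup (𝓞 (Fld 2)) // clMap (σ : Fld 2 ≃+* Fld 2) c = c} := 
      Finite.card_le_one_iff_subsingleton.1 hb
    have h3 := this.elim ⟨c, hfix⟩ ⟨1, map_one _⟩
    exact congrArg Subtype.val h3
  obtain ⟨k, hk⟩ := hy
  induction k with
  | zero => simpa using hk
  | succ k ih => 
    apply ih; apply hsq; rw [← pow_mul, ← pow_succ]; exact hk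

theorem ext_triv {K L : Type*} [Field K] [Field L] [NumberField K] [NumberField L] [Algebra K L]
    {d : ℕ} (hd : d ≠ 0) (I : Ideal (𝓞 K)) (hI : I ^ 2 = Ideal.span {(d : 𝓞 K)}) (h : SqU L d) :
    clExt K L (icl I) = 1 := by
  have hI0 : I ≠ ⊥ := by
    rintro rfl
    rw [Ideal.bot_pow two_ne_zero] at hI
    have := (Ideal.span_singleton_eq_bot.1 hI.symm)
    exact hd (by exact_mod_cast this)
  rw [clExt_icl K L hI0]
  refine icl_of_principal (squ_principal h ?_)
  rw [← Ideal.map_pow, hI, Ideal.map_span]; simp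

theorem J_base (D D' D1 r s : ℕ) (hD1 : D1 % 4 = 3) 
    (hD : (D = D1 ∧ D' = 2 * D1) ∨ (D = 2 * D1 ∧ D' = D1)) (hr0 : r ≠ 0) (hs0 : s ≠ 0)
    (hr : SqU (layer (Fld D) 1) r) (hs : SqU (layer (Fld D) 1) s)
    (hF' : ∃ Ir Is : Ideal (𝓞 (Fld D')), Ir^2=Ideal.span {(r:𝓞 (Fld D'))} ∧
      Is^2=Ideal.span {(s:𝓞 (Fld D'))} ∧ ∀ y, tp y → y ∈ Subgroup.closure {icl Ir, icl Is})
    (hsurj : Function.Surjective (clNorm (layer (Fld D) 0) (layer (Fld D) 1))) : JJ D 0 := by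
  have hDD : D = D1 ∨ D = 2 * D1 := by tauto
  have hDD' : D' = D1 ∨ D' = 2 * D1 := by tauto
  have hmul : Real.sqrt D * Real.sqrt D' = D1 * cc 1 := by
    rw [cc_one]
    rcases hD with ⟨rfl, rfl⟩ | ⟨rfl, rfl⟩ <;> push_cast <;> 
      rw [Real.sqrt_mul (by norm_num)]
    · linear_combination (Real.sqrt 2) * Real.mul_self_sqrt (Nat.cast_nonneg D)
    · linear_combination (Real.sqrt 2) * Real.mul_self_sqrt (Nat.cast_nonneg D')
  have hDpos : 0 < D := by omega
  have hD'pos : 0 < D' := by omega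
  have hn0 : Real.sqrt D ≠ 0 := by
    rw [Real.sqrt_ne_zero (Nat.cast_nonneg _)]; exact_mod_cast hDpos.ne'
  have hn0' : Real.sqrt D' ≠ 0 := by
    rw [Real.sqrt_ne_zero (Nat.cast_nonneg _)]; exact_mod_cast hD'pos.ne'
  let L := layer (Fld D) 1
  have hcL : cc 1 ∈ L := cc_mem_layer _ _
  have hθL : Real.sqrt D ∈ L := sqrt_mem_layer D 1
  have hθ'L : Real.sqrt D' ∈ L := by
    rw [show Real.sqrt D' = D1 * cc 1 / Real.sqrt D by rw [← hmul]; field_simp]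
    exact L.div_mem (L.mul_mem (L.natCast_mem _) hcL) hθL
  haveI f1 : Fact (Fld D' ≤ L) := ⟨by
    rw [adjoin_le_iff, Set.singleton_subset_iff]; exact hθ'L⟩
  haveI f2 : Fact (Fld 2 ≤ L) := ⟨by
    rw [adjoin_le_iff, Set.singleton_subset_iff, ← cc_one]; exact hcL⟩
  have hrL : finrank ℚ L = 4 := (layer_ram D D1 1 hD1 hDD).1
  have hr' : finrank ℚ (Fld D') = 2 := by
    have := (layer_ram D' D1 0 hD1 hDD').1
    rwa [layer_zero] at this
  have hr2 : finrank ℚ (Fld 2) = 2 := 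
    (ram_base (L := Fld 2) 1 (by norm_num) (Fld_fin 2).2 (sqrt_mem_Fld 2)).1
  have k' : finrank (Fld D') L = 2 := by
    have h := finrank_mul_finrank ℚ (Fld D') L
    rw [hr', hrL] at h; omega
  have k2 : finrank (Fld 2) L = 2 := by
    have h := finrank_mul_finrank ℚ (Fld 2) L
    rw [hr2, hrL] at h; omega
  haveI : FiniteDimensional (Fld D') L := FiniteDimensional.of_finrank_pos (by rw [k']; norm_num)
  haveI : FiniteDimensional (Fld 2) L := FiniteDimensional.of_finrank_pos (by rw [k2]; norm_num)
  obtain ⟨σ, hσ⟩ := layer_sigma D D1 0 hD1 hDD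
  have hσc : σ (⟨cc 1, hcL⟩ : L) = -⟨cc 1, hcL⟩ := hσ
  have hσθ : σ (⟨Real.sqrt D, hθL⟩ : L) = ⟨Real.sqrt D, hθL⟩ :=
    σ.commutes (⟨Real.sqrt D, sqrt_mem_layer D _⟩ : layer (Fld D) 0)
  obtain ⟨σ', hσ'⟩ : ∃ σ' : L ≃ₐ[Fld D'] L, σ' (⟨cc 1, hcL⟩ : L) = -⟨cc 1, hcL⟩ := by
    refine exists_quad _ (adj_top _ ?_) (2 : Fld D') ?_ k'
    · refine (layer_gen2 D 1).trans (sup_le ?_ le_sup_right)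
      rw [adjoin_le_iff, Set.singleton_subset_iff]
      show Real.sqrt D ∈ Fld D' ⊔ adjoin ℚ {cc 1}
      rw [show Real.sqrt D = D1 * cc 1 / Real.sqrt D' by rw [← hmul]; field_simp]
      exact (Fld D' ⊔ adjoin ℚ {cc 1}).div_mem ((Fld D' ⊔ adjoin ℚ {cc 1}).mul_mem 
        (_root_.natCast_mem _ _) ((le_sup_right : adjoin ℚ {cc 1} ≤ _) (mem_adjoin_simple_self ℚ _)))
        ((le_sup_left : Fld D' ≤ _) (sqrt_mem_Fld D'))
    · apply Subtype.ext
      rw [leAlg_coe]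
      exact cc_one_sq
  have hσ'θ : σ' (⟨Real.sqrt D, hθL⟩ : L) = -⟨Real.sqrt D, hθL⟩ := by
    have e0 : σ' (⟨Real.sqrt D', hθ'L⟩ : L) = ⟨Real.sqrt D', hθ'L⟩ :=
      σ'.commutes (⟨Real.sqrt D', sqrt_mem_Fld D'⟩ : Fld D')
    have e1 : (⟨Real.sqrt D, hθL⟩ : L) * ⟨Real.sqrt D', hθ'L⟩ = (D1 : L) * ⟨cc 1, hcL⟩ :=
      Subtype.ext hmul
    have e2 := congrArg σ' e1
    rw [map_mul, map_mul, map_natCast, e0, hσ'] at e2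
    have e3 : (⟨Real.sqrt D', hθ'L⟩ : L) ≠ 0 := fun h => hn0' (congrArg Subtype.val h)
    apply mul_right_cancel₀ e3
    linear_combination e2 + e1
  obtain ⟨τ, hτ⟩ : ∃ τ : L ≃ₐ[Fld 2] L, τ (⟨Real.sqrt D, hθL⟩ : L) = -⟨Real.sqrt D, hθL⟩ := by
    refine exists_quad _ (adj_top _ ?_) (D : Fld 2) ?_ k2
    · refine (layer_gen2 D 1).trans (sup_le le_sup_right ?_)
      rw [cc_one]
      exact le_sup_left
    · apply Subtype.ext
      rw [leAlg_coe]
      exact Real.sq_sqrt (Nat.cast_nonneg _)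
  have hτc : τ (⟨cc 1, hcL⟩ : L) = ⟨cc 1, hcL⟩ := by
    have : cc 1 ∈ Fld 2 := by rw [cc_one]; exact sqrt_mem_Fld 2
    exact τ.commutes (⟨cc 1, this⟩ : Fld 2)
  have hcomp : ∀ y : L, σ (τ y) = σ' y := by
    have := gen_ext (L := L) (⟨Real.sqrt D, hθL⟩ : L) (⟨cc 1, hcL⟩ : L) (layer_gen2 D 1) 
      (((σ : L ≃+* L) : L →+* L).comp ((τ : L ≃+* L) : L →+* L)) ((σ' : L ≃+* L) : L →+* L)
      (by
        show σ (τ _) = σ' _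
        rw [hτ, map_neg, hσθ, hσ'θ])
      (by
        show σ (τ _) = σ' _
        rw [hτc, hσc, hσ'])
    exact fun y => congrArg (fun f => f y) this
  have hc0 : (⟨cc 1, hcL⟩ : L) ≠ 0 := fun h => cc_ne 0 (congrArg Subtype.val h)
  have hθ0 : (⟨Real.sqrt D, hθL⟩ : L) ≠ 0 := fun h => hn0 (congrArg Subtype.val h)
  obtain ⟨Ir, Is, hIr, hIs, hcl⟩ := hF'
  have htriv : ∀ x : ClassGroup (𝓞 L), tp x → clMap (σ : L ≃+* L) x = x := by
    intro x hx
    have e1 : clMap (τ : L ≃+* L) x = x⁻¹ := by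
      have h := clExt_clNorm k2 τ _ hθ0 hτ x
      rw [Fld_two_triv _ (tp_map _ hx), map_one] at h
      exact eq_inv_of_mul_eq_one_right h.symm
    have e2 : clMap (σ' : L ≃+* L) x = x⁻¹ := by
      have h := clExt_clNorm k' σ' _ hc0 hσ' x
      have h3 : Subgroup.closure {icl Ir, icl Is} ≤ (clExt (Fld D') L).ker := by
        rw [Subgroup.closure_le]
        rintro y (rfl | rfl)
        · exact ext_triv hr0 Ir hIr hr
        · exact ext_triv hs0 Is hIs hs
      have h4 := h3 (hcl _ (tp_map (clNorm (Fld D') L) hx))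
      rw [MonoidHom.mem_ker.1 h4] at h
      exact eq_inv_of_mul_eq_one_right h.symm
    have e3 : clMap (σ : L ≃+* L) (clMap (τ : L ≃+* L) x) = clMap (σ' : L ≃+* L) x := by
      rw [clMap_trans]
      congr 2
      ext y
      exact congrArg Subtype.val (hcomp y)
    rw [e1, e2, map_inv, inv_inj] at e3
    exact e3
  have hker := ker_step (K := layer (Fld D) 0) (L := L) (L.val : L →+* ℝ) (layer_rank D D1 0 hD1 hDD) σ 
    (ccO (Fld D) 1) (ccO_ne _ _) hσ (layer_hP D D1 0 hD1 hDD) hsurj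
  exact inj_of_triv (clNorm (layer (Fld D) 0) L) (clMap (σ : L ≃+* L)) hker htriv

end

section

open NumberField Module IntermediateField
open scoped nonZeroDivisors

theorem II_all (D D1 : ℕ) (hD1 : D1 % 4 = 3) (hD : D = D1 ∨ D = 2 * D1)
    (hS : ∀ n, Function.Surjective (clNorm (layer (Fld D) 0) (layer (Fld D) n)))
    (hJ : JJ D 0) (n : ℕ) : JJ D n ∧ ∀ x : ClassGroup (𝓞 (layer (Fld D) (n+1))), tp x →
      clNorm (layer (Fld D) 0) (layer (Fld D) (n+1)) x = 1 → x = 1 := by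
  induction n with
  | zero => exact ⟨hJ, hJ⟩
  | succ n ih =>
    obtain ⟨h1, h3⟩ := ih
    have := leTower (K := layer (Fld D) 0) (L := layer (Fld D) (n+1)) (M := layer (Fld D) (n+2))
    have htr := clNorm_trans (layer (Fld D) 0) (layer (Fld D) (n+1)) (layer (Fld D) (n+2))
    have hs : Function.Surjective (clNorm (layer (Fld D) (n+1)) (layer (Fld D) (n+2))) := by
      apply surj_step _ (clNorm (layer (Fld D) 0) (layer (Fld D) (n+1))) _ h3
      · intro y
        refine ⟨clExt _ _ y, ?_⟩
        rw [clNorm_clExt, layer_rank D D1 (n+1) hD1 hD]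
      · intro y
        obtain ⟨x, hx⟩ := hS (n+2) y
        exact ⟨x, by rw [MonoidHom.comp_apply, htr, hx]⟩
    have hJ' := J_step D D1 n hD1 hD hs h1
    refine ⟨hJ', fun x hx hNx => ?_⟩
    apply hJ' x hx
    apply h3 _ (tp_map _ hx)
    rw [htr]; exact hNx

theorem layer_final (D D1 : ℕ) (hD1 : D1 % 4 = 3) (hD : D = D1 ∨ D = 2 * D1)
    (hS : ∀ n, Function.Surjective (clNorm (layer (Fld D) 0) (layer (Fld D) n)))
    (hJ : JJ D 0) (m : ℕ)
    (hc : 2 ^ ((Nat.card (ClassGroup (𝓞 (layer (Fld D) 0)))).factorization 2) = 2 ^ (m+1))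
    (h4 : Nat.card {x : ClassGroup (𝓞 (layer (Fld D) 0)) // x ^ 2 = 1} ≤ 4)
    (hp : ∃ p : ClassGroup (𝓞 (layer (Fld D) 0)), p ^ 2 = 1 ∧ ∀ y, y ^ 2 ≠ p) (n : ℕ)
    (P : Sylow 2 (ClassGroup (𝓞 (layer (Fld D) n)))) : 
    Nonempty (P ≃* Multiplicative (ZMod 2 × ZMod (2 ^ m))) := by
  obtain ⟨p, hp, hps⟩ := hp
  rcases n with _ | n
  · exact sylow_lemma (MonoidHom.id _) Function.surjective_id (fun x _ h => h) m hc h4 p hp hps P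
  · exact sylow_lemma (clNorm (layer (Fld D) 0) (layer (Fld D) (n+1))) (hS _)
      (II_all D D1 hD1 hD hS hJ n).2 m hc h4 p hp hps P

end

section

open NumberField Module IntermediateField
open scoped nonZeroDivisors

theorem exists_hom {K L M : Type*} [Field K] [Field L] [Algebra K L] [FiniteDimensional K L]
    [Field M] [Algebra K M]
    (x : L) (y : M) (htop : adjoin K {x} = ⊤) (p : Polynomial K) (hp : p.Monic)
    (hd : p.natDegree = finrank K L) (hx : Polynomial.aeval x p = 0)
    (hy : Polynomial.aeval y p = 0) : ∃ σ : L →ₐ[K] M, σ x = y := by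
  have hi : IsIntegral K x := IsIntegral.of_finite K x
  have hdeg : (minpoly K x).natDegree = finrank K L := by
    rw [← adjoin.finrank hi, htop, finrank_top']
  have hmp : minpoly K x = p := by
    symm
    apply Polynomial.eq_of_monic_of_dvd_of_natDegree_le (minpoly.monic hi) hp
      (minpoly.dvd K x hx)
    rw [hd, hdeg]
  have hye : Polynomial.eval₂ (Algebra.ofId K M : K →+* M) y (minpoly K x) = 0 := by
    rw [hmp]; exact hy
  let e : adjoin K {x} ≃ₐ[K] L := (equivOfEq htop).trans topEquiv
  let f : adjoin K {x} →ₐ[K] M := (AdjoinRoot.liftAlgHom (minpoly K x) (Algebra.ofId K M) y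
    hye).comp (adjoinRootEquivAdjoin K hi).symm.toAlgHom
  refine ⟨f.comp e.symm.toAlgHom, ?_⟩
  have h1 : e.symm x = AdjoinSimple.gen K x := by
    rw [AlgEquiv.symm_apply_eq]; rfl
  show f (e.symm x) = y
  rw [h1]
  show AdjoinRoot.liftAlgHom (minpoly K x) (Algebra.ofId K M) y hye
    ((adjoinRootEquivAdjoin K hi).symm (AdjoinSimple.gen K x)) = y
  rw [adjoinRootEquivAdjoin_symm_apply_gen]
  exact AdjoinRoot.liftAlgHom_root (minpoly K x) (Algebra.ofId K M) y hye

theorem exists_hom_quad {K L M : Type*} [Field K] [Field L] [Algebra K L] [FiniteDimensional K L]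
    [Field M] (φ : K →+* M)
    (x : L) (y : M) (htop : adjoin K {x} = ⊤) (a : K) (hx : x ^ 2 = algebraMap K L a)
    (hd : finrank K L = 2) (hy : y ^ 2 = φ a) : 
    ∃ ψ : L →+* M, ψ x = y ∧ ∀ k, ψ (algebraMap K L k) = φ k := by
  letI := φ.toAlgebra
  have hy' : y ^ 2 = algebraMap K M a := hy
  obtain ⟨σ, hσ⟩ := exists_hom x y htop (Polynomial.X ^ 2 - Polynomial.C a)
    (Polynomial.monic_X_pow_sub_C a two_ne_zero)
    (by rw [hd, Polynomial.natDegree_X_pow_sub_C]) (by simp [hx]) (by simp [hy'])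
  exact ⟨σ, hσ, fun k => σ.commutes k⟩

theorem hensel_pow (p : ℕ) [Fact p.Prime] (k : ℕ) (hk : 0 < k) (hpk : ¬ p ∣ k) (a t : ℤ)
    (ha : ¬ (p : ℤ) ∣ a) (ht : (p : ℤ) ∣ t ^ k - a) : ∃ z : ℤ_[p], z ^ k = a := by
  have hF : ∀ z : ℤ_[p], (Polynomial.X ^ k - Polynomial.C a : Polynomial ℤ).aeval z = z ^ k - a := by
    intro z; simp
  have hd : ∀ z : ℤ_[p], (Polynomial.X ^ k - Polynomial.C a : Polynomial ℤ).derivative.aeval z 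
      = k * z ^ (k-1) := by
    intro z
    rw [Polynomial.derivative_sub, Polynomial.derivative_C, sub_zero, Polynomial.derivative_X_pow]
    simp
  have hone : ∀ b : ℤ, ¬ (p:ℤ) ∣ b → ‖(b : ℤ_[p])‖ = 1 := by
    intro b hb
    rw [← PadicInt.norm_int_lt_one_iff_dvd] at hb
    exact le_antisymm (PadicInt.norm_le_one _) (not_lt.1 hb)
  have hpt : ¬ (p:ℤ) ∣ t := by
    intro h
    apply ha
    have : (p:ℤ) ∣ t ^ k := dvd_pow h hk.ne'
    have := dvd_sub this ht
    simpa using this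
  have hpp : Prime (p:ℤ) := Nat.prime_iff_prime_int.1 (Fact.out)
  have h1 : ‖(Polynomial.X ^ k - Polynomial.C a : Polynomial ℤ).derivative.aeval (t : ℤ_[p])‖ = 1 := by
    rw [hd]
    have : (k : ℤ_[p]) * (t:ℤ_[p]) ^ (k-1) = ((k * t ^ (k-1) : ℤ) : ℤ_[p]) := by push_cast; ring
    rw [this]
    apply hone
    intro h
    rcases hpp.dvd_or_dvd h with h | h
    · exact hpk (by exact_mod_cast h)
    · exact hpt (hpp.dvd_of_dvd_pow h)
  have h2 : ‖(Polynomial.X ^ k - Polynomial.C a : Polynomial ℤ).aeval (t : ℤ_[p])‖ < 1 := by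
    rw [hF]
    have : (t:ℤ_[p]) ^ k - a = ((t ^ k - a : ℤ) : ℤ_[p]) := by push_cast; ring
    rw [this, PadicInt.norm_int_lt_one_iff_dvd]; exact ht
  obtain ⟨z, hz, -⟩ := hensels_lemma (F := (Polynomial.X ^ k - Polynomial.C a : Polynomial ℤ))
    (a := (t:ℤ_[p])) (by rw [h1]; simpa using h2)
  rw [hF] at hz
  exact ⟨z, sub_eq_zero.1 hz⟩

theorem deg_one_ideal {L : Type*} [Field L] [NumberField L] (p : ℕ) [Fact p.Prime]
    (φ : L →+* ℚ_[p]) : ∃ I : Ideal (𝓞 L), Ideal.absNorm I = p := by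
  have hInteg : ∀ x : 𝓞 L, ∃ y : ℤ_[p], (y : ℚ_[p]) = φ x := by
    intro x
    have h1 : IsIntegral ℤ (φ x) := (RingOfIntegers.isIntegral_coe x).map (φ.toIntAlgHom)
    have h3 : IsIntegral ℤ_[p] (φ x) := h1.tower_top
    obtain ⟨y, hy⟩ := IsIntegrallyClosed.isIntegral_iff.1 h3
    exact ⟨y, hy⟩
  choose f hf using hInteg
  have hinj : Function.Injective ((↑) : ℤ_[p] → ℚ_[p]) := Subtype.val_injective
  let g : 𝓞 L →+* ℤ_[p] := 
    { toFun := f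
      map_one' := hinj (by rw [hf]; simp)
      map_zero' := hinj (by rw [hf]; simp)
      map_mul' := fun x y => hinj (by rw [PadicInt.coe_mul, hf, hf, hf]; simp)
      map_add' := fun x y => hinj (by rw [PadicInt.coe_add, hf, hf, hf]; simp) }
  let h : 𝓞 L →+* ZMod p := PadicInt.toZMod.comp g
  have hs : Function.Surjective h := ZMod.ringHom_surjective h
  refine ⟨RingHom.ker h, ?_⟩
  rw [Ideal.absNorm_apply, Submodule.cardQuot_apply,
    Nat.card_congr (RingHom.quotientKerEquivOfSurjective hs).toEquiv, Nat.card_zmod]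

theorem layer_hom (D D1 : ℕ) (hD1 : D1 % 4 = 3) (hD : D = D1 ∨ D = 2 * D1) {M : Type*} [Field M]
    [CharZero M] (n : ℕ) (C : ℕ → M) (hC0 : C 0 = 0) (hC : ∀ i < n, C (i+1) ^ 2 = 2 + C i)
    (θ : M) (hθ : θ ^ 2 = D) : ∀ i ≤ n, ∃ φ : layer (Fld D) i →+* M, 
      φ ⟨cc i, cc_mem_layer _ _⟩ = C i := by
  intro i
  induction i with
  | zero => 
    intro _
    have hr : finrank ℚ (Fld D) = 2 := by
      have := (layer_ram D D1 0 hD1 hD).1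
      rwa [layer_zero] at this
    haveI : FiniteDimensional ℚ (Fld D) := (Fld_fin D).1
    obtain ⟨ψ, -, -⟩ := exists_hom_quad (algebraMap ℚ M) _ θ (Fld_top D) (D : ℚ) (by
      apply Subtype.ext
      show Real.sqrt D ^ 2 = _
      rw [Real.sq_sqrt (Nat.cast_nonneg _)]; simp) hr (by rw [hθ]; simp)
    refine ⟨ψ.comp (inclusion (layer_zero (Fld D)).le : _ →+* _), ?_⟩
    have : (⟨cc 0, cc_mem_layer _ _⟩ : layer (Fld D) 0) = 0 := Subtype.ext cc_zero
    rw [this, map_zero, hC0]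
  | succ i ih =>
    intro hi
    obtain ⟨φ, hφ⟩ := ih (by omega)
    haveI : FiniteDimensional (layer (Fld D) i) (layer (Fld D) (i+1)) := 
      FiniteDimensional.of_finrank_pos (by rw [layer_rank D D1 i hD1 hD]; norm_num)
    obtain ⟨ψ, hψ, -⟩ := exists_hom_quad φ _ (C (i+1)) (layer_top (Fld D)) _ (layer_sq (Fld D) i)
      (layer_rank D D1 i hD1 hD) (by rw [hC i (by omega), map_add, hφ, map_ofNat])
    exact ⟨ψ, hψ⟩

theorem layer_deg_one (D D1 : ℕ) (hD1 : D1 % 4 = 3) (hD : D = D1 ∨ D = 2 * D1) (n : ℕ)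
    (p : ℕ) [Fact p.Prime] (hp : p % 2 ^ (n+2) = 1) (a : ℤ) (ha : legendreSym p a = -1)
    (hDp : legendreSym p D = 1) : ∃ I : Ideal (𝓞 (layer (Fld D) n)), Ideal.absNorm I = p := by
  have hodd : ¬ p ∣ 2 := by
    intro h
    have : p = 2 := (Nat.prime_dvd_prime_iff_eq Fact.out Nat.prime_two).1 h
    rw [this] at hp
    have h4 : 2 < 2 ^ (n+2) := by
      calc 2 < 2 ^ 2 := by norm_num
        _ ≤ 2 ^ (n+2) := Nat.pow_le_pow_right (by norm_num) (by omega)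
    rw [Nat.mod_eq_of_lt h4] at hp
    omega
  have hpos : 1 < p := (Fact.out : p.Prime).one_lt
  -- sqrt of D
  obtain ⟨θ, hθ⟩ : ∃ z : ℤ_[p], z ^ 2 = ((D : ℤ) : ℤ_[p]) := by
    have h0 : ((D : ℤ) : ZMod p) ≠ 0 := by
      intro h
      rw [(legendreSym.eq_zero_iff p _).2 h] at hDp
      norm_num at hDp
    obtain ⟨b, hb⟩ := (legendreSym.eq_one_iff p h0).1 hDp
    refine hensel_pow p 2 (by norm_num) hodd D (b.val : ℤ) ?_ ?_
    · rwa [Ne, ZMod.intCast_zmod_eq_zero_iff_dvd] at h0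
    · rw [← ZMod.intCast_zmod_eq_zero_iff_dvd]
      push_cast
      rw [ZMod.natCast_zmod_val, sub_eq_zero, sq, ← hb]; simp
  obtain ⟨z, hz⟩ : ∃ z : ℤ_[p], z ^ (2^(n+1)) = ((-1 : ℤ) : ℤ_[p]) := by
    have hdiv := Nat.div_add_mod p (2 ^ (n+2))
    rw [hp] at hdiv
    have hhalf : p / 2 = p / 2 ^ (n+2) * 2 ^ (n+1) := by
      have : p = 2 * (p / 2 ^ (n+2) * 2 ^ (n+1)) + 1 := by
        conv_lhs => rw [← hdiv]
        ring
      omega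
    refine hensel_pow p (2^(n+1)) (by positivity) ?_ (-1) (a ^ (p / 2 ^ (n+2))) ?_ ?_
    · intro h; exact hodd ((Fact.out : p.Prime).dvd_of_dvd_pow h)
    · rw [dvd_neg]; intro h
      have := Int.le_of_dvd (by norm_num) h
      omega
    · rw [← pow_mul, ← hhalf, ← ZMod.intCast_zmod_eq_zero_iff_dvd]
      have := legendreSym.eq_pow p a
      rw [ha] at this
      push_cast at this ⊢
      rw [← this]; ring
  have hzQ : (z : ℚ_[p]) ^ (2 ^ (n+1)) = -1 := by
    have := congrArg (fun x : ℤ_[p] => (x : ℚ_[p])) hz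
    simpa using this
  have hz0 : (z : ℚ_[p]) ≠ 0 := by
    intro h
    rw [h, zero_pow (by positivity)] at hzQ
    norm_num at hzQ
  let Z : ℚ_[p] := z
  obtain ⟨φ, -⟩ := layer_hom D D1 hD1 hD (M := ℚ_[p]) n 
    (fun i => Z ^ 2 ^ (n - i) + (Z⁻¹) ^ 2 ^ (n - i))
    (by
      have hw : (Z ^ 2 ^ n) ^ 2 = -1 := by rw [← pow_mul, ← pow_succ]; exact hzQ
      have hw0 : Z ^ 2 ^ n ≠ 0 := pow_ne_zero _ hz0
      show Z ^ 2 ^ (n - 0) + (Z⁻¹) ^ 2 ^ (n - 0) = 0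
      rw [Nat.sub_zero, inv_pow]
      field_simp
      rw [hw]; ring)
    (by
      intro i hi
      show (Z ^ 2 ^ (n - (i+1)) + (Z⁻¹) ^ 2 ^ (n - (i+1))) ^ 2 = 2 + (Z ^ 2 ^ (n - i) + (Z⁻¹) ^ 2 ^ (n - i))
      have e : n - i = n - (i+1) + 1 := by omega
      rw [e, pow_succ 2, pow_mul, pow_mul]
      have h1 : Z ^ 2 ^ (n - (i+1)) * (Z⁻¹) ^ 2 ^ (n - (i+1)) = 1 := by
        rw [← mul_pow, mul_inv_cancel₀ hz0, one_pow]
      linear_combination 2 * h1)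
    (θ : ℚ_[p]) (by
      have := congrArg (fun x : ℤ_[p] => (x : ℚ_[p])) hθ
      simpa using this) n le_rfl
  exact deg_one_ideal p φ

end

section

open NumberField Module IntermediateField
open scoped nonZeroDivisors

theorem dir_crt (N q r s : ℕ) (hN : N ≠ 0) (hq : q ≠ 0) (hr : r ≠ 0) (hs : s ≠ 0)
    (h1 : N.Coprime q) (h2 : N.Coprime r) (h3 : N.Coprime s)
    (h4 : q.Coprime r) (h5 : q.Coprime s) (h6 : r.Coprime s) (a b c d : ℕ)
    (ha : a.Coprime N) (hb : b.Coprime q) (hc : c.Coprime r) (hd : d.Coprime s) :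
    ∃ p : ℕ, p.Prime ∧ p ≡ a [MOD N] ∧ p ≡ b [MOD q] ∧ p ≡ c [MOD r] ∧ p ≡ d [MOD s] := by
  obtain ⟨x, hx1, hx2⟩ := Nat.chineseRemainder h1 a b
  obtain ⟨y, hy1, hy2⟩ := Nat.chineseRemainder h6 c d
  have hco : (N * q).Coprime (r * s) :=
    Nat.Coprime.mul_left (Nat.Coprime.mul_right h2 h3) (Nat.Coprime.mul_right h4 h5)
  obtain ⟨z, hz1, hz2⟩ := Nat.chineseRemainder hco x y
  have e1 : z ≡ a [MOD N] := (hz1.of_mul_right q).trans hx1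
  have e2 : z ≡ b [MOD q] := (hz1.of_mul_left N).trans hx2
  have e3 : z ≡ c [MOD r] := (hz2.of_mul_right s).trans hy1
  have e4 : z ≡ d [MOD s] := (hz2.of_mul_left r).trans hy2
  have cop : ∀ {m u : ℕ}, z ≡ u [MOD m] → u.Coprime m → z.Coprime m := by
    intro m u h hu
    have := h.gcd_eq
    rw [Nat.Coprime, this]; exact hu
  have hz : z.Coprime (N * q * (r * s)) :=
    Nat.Coprime.mul_right (Nat.Coprime.mul_right (cop e1 ha) (cop e2 hb))
      (Nat.Coprime.mul_right (cop e3 hc) (cop e4 hd))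
  haveI : NeZero (N * q * (r * s)) := ⟨by positivity⟩
  obtain ⟨p, -, hp, hpz⟩ := Nat.forall_exists_prime_gt_and_eq_mod
    ((ZMod.isUnit_iff_coprime z (N * q * (r * s))).2 hz) 0
  have hpz' : p ≡ z [MOD N * q * (r * s)] := (ZMod.natCast_eq_natCast_iff _ _ _).1 hpz
  exact ⟨p, hp, ((hpz'.of_mul_right _).of_mul_right _).trans e1,
    ((hpz'.of_mul_right _).of_mul_left _).trans e2,
    ((hpz'.of_mul_left _).of_mul_right _).trans e3,
    ((hpz'.of_mul_left _).of_mul_left _).trans e4⟩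

theorem leg_modeq (l : ℕ) [Fact l.Prime] (a b : ℕ) (h : a ≡ b [MOD l]) :
    legendreSym l a = legendreSym l b := by
  rw [legendreSym.mod l a, legendreSym.mod l b]
  congr 1
  exact_mod_cast congrArg (Nat.cast (R := ℤ)) h

section
variable {q r s : ℕ} [Fact q.Prime] [Fact r.Prime] [Fact s.Prime]

theorem dir_prime (e : ℤ) (H : LegData q r s e) (n : ℕ) (c d : ℕ)
    (hc0 : c.Coprime r) (hd0 : d.Coprime s) (hcd : legendreSym r c * legendreSym s d = -1)
    (D : ℕ) (hD : D = q * (r * s) ∨ D = 2 * (q * (r * s))) :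
    ∃ p : ℕ, ∃ _ : Fact p.Prime, p % 2 ^ (n+2) = 1 ∧ legendreSym r p = legendreSym r c ∧
      legendreSym s p = legendreSym s d ∧ legendreSym p r = legendreSym r c ∧
      legendreSym p s = legendreSym s d ∧ legendreSym p D = 1 := by
  have hq := (Fact.out : q.Prime)
  have hr := (Fact.out : r.Prime)
  have hs := (Fact.out : s.Prime)
  have q4 := H.q4
  have r8 := H.r8
  have s8 := H.s8
  have cop2 : ∀ l : ℕ, l.Prime → l ≠ 2 → (2 ^ (n+3)).Coprime l := fun l hl h2 =>
    Nat.Coprime.pow_left _ ((Nat.coprime_primes Nat.prime_two hl).2 (Ne.symm h2))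
  obtain ⟨p, hp, p1, p2, p3, p4⟩ := dir_crt (2 ^ (n+3)) q r s (by positivity) hq.ne_zero hr.ne_zero
    hs.ne_zero (cop2 q hq (by omega)) (cop2 r hr (by omega)) (cop2 s hs (by omega))
    ((Nat.coprime_primes hq hr).2 (by rintro rfl; omega))
    ((Nat.coprime_primes hq hs).2 (by rintro rfl; omega))
    ((Nat.coprime_primes hr hs).2 H.ne) 1 (q-1) c d (Nat.coprime_one_left _)
    (by
      have h := Nat.coprime_self_sub_left (m := 1) (n := q) hq.one_lt.le
      exact h.2 (Nat.coprime_one_left _)) hc0 hd0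
  haveI : Fact p.Prime := ⟨hp⟩
  have hk : p ≡ 1 [MOD 2 ^ (n+2)] := p1.of_dvd (pow_dvd_pow 2 (by omega))
  have hk8 : p ≡ 1 [MOD 8] := p1.of_dvd (by
    rw [show (8:ℕ) = 2 ^ 3 by norm_num]; exact pow_dvd_pow 2 (by omega))
  have hp8 : p % 8 = 1 := hk8
  have recip : ∀ (l : ℕ) [Fact l.Prime], l ≠ 2 → legendreSym p l = legendreSym l p := by
    intro l _ hl
    exact (legendreSym.quadratic_reciprocity_one_mod_four (p := p) (q := l) (by omega) hl).symm
  have lr := leg_modeq r _ _ p3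
  have ls := leg_modeq s _ _ p4
  have lq : legendreSym q p = -1 := by
    rw [leg_modeq q _ _ p2, ← H.qm, legendreSym.mod q (-1), legendreSym.mod q ((q-1 : ℕ) : ℤ)]
    congr 1
    rw [Nat.cast_sub hq.one_lt.le]
    simp
  have l2 : legendreSym p 2 = 1 := by
    rw [legendreSym.at_two (by omega), ZMod.χ₈_nat_eq_if_mod_eight]
    simp [hp8]
    omega
  have lD1 : legendreSym p ((q * (r * s) : ℕ) : ℤ) = 1 := by
    push_cast
    rw [legendreSym.mul, legendreSym.mul, recip q (by omega), recip r (by omega), recip s (by omega), lq, lr, ls, hcd]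
    norm_num
  refine ⟨p, ‹_›, ?_, lr, ls, by rw [recip r (by omega), lr], by rw [recip s (by omega), ls], ?_⟩
  · rw [hk, Nat.mod_eq_of_lt]
    exact Nat.one_lt_two_pow (by omega)
  · rcases hD with rfl | rfl
    · exact lD1
    · rw [Nat.cast_mul, legendreSym.mul, lD1, mul_one]; exact l2

end

theorem index_sq4 (G : Type*) [CommGroup G] [Finite G] (h : Nat.card {x : G // x ^ 2 = 1} ≤ 4) (R : Subgroup G)
    (x y : G) (hx : x ∈ R) (hy : y ∈ R) (h1 : ∀ c, x ≠ c ^ 2) (h2 : ∀ c, y ≠ c ^ 2)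
    (h3 : ∀ c, x * y ≠ c ^ 2) : ∀ g : G, ∃ a ∈ R, ∃ c, g = a * c ^ 2 := by
  have hk : Nat.card (powMonoidHom 2 : G →* G).ker ≤ 4 := h
  have hidx : (powMonoidHom 2 : G →* G).range.index ≤ 4 := by
    have e1 := (powMonoidHom 2 : G →* G).ker.card_mul_index
    have e2 := (powMonoidHom 2 : G →* G).range.card_mul_index
    rw [Subgroup.index_ker, ← e2, mul_comm] at e1
    have : 0 < Nat.card (powMonoidHom 2 : G →* G).range := Nat.card_pos
    rw [← Nat.eq_of_mul_eq_mul_left this e1]; exact hk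
  intro g
  by_contra hg
  push Not at hg
  -- five distinct cosets
  let f : Option (Fin 4) → G := fun o => match o with
    | none => g
    | some 0 => 1
    | some 1 => x
    | some 2 => y
    | some 3 => x * y
  have : Function.Injective (fun o => (QuotientGroup.mk (f o) : G ⧸ (powMonoidHom 2 : G →* G).range)) := by
    have key : ∀ o o', o ≠ o' → ∀ c, (f o)⁻¹ * f o' ≠ c ^ 2 := by
      have inv : ∀ u : G, (∀ c, u ≠ c ^ 2) → ∀ c, u⁻¹ ≠ c ^ 2 := fun u hu c hc =>
        hu c⁻¹ (by rw [inv_pow, ← hc, inv_inv])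
      have mulsq : ∀ u v : G, (∀ c, u ≠ c ^ 2) → ∀ c, u * v ^ 2 ≠ c ^ 2 := fun u v hu c hc =>
        hu (c * v⁻¹) (by rw [mul_pow, ← hc, inv_pow]; group)
      have gg : ∀ a ∈ R, ∀ c, g ≠ a * c ^ 2 := hg
      have gl : ∀ a ∈ R, ∀ c, g⁻¹ * a ≠ c ^ 2 := fun a ha c hc => gg a ha c⁻¹ (by
        rw [inv_pow, ← hc]; group)
      have gr : ∀ a ∈ R, ∀ c, a⁻¹ * g ≠ c ^ 2 := fun a ha c hc => gg a ha c (by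
        rw [← hc]; group)
      have hxy := R.mul_mem hx hy
      have sw : ∀ u v : G, (∀ c, u⁻¹ * v ≠ c ^ 2) → ∀ c, v⁻¹ * u ≠ c ^ 2 := fun u v hu c hc =>
        hu c⁻¹ (by rw [inv_pow, ← hc]; group)
      have a1 : ∀ c, x⁻¹ * y ≠ c ^ 2 := fun c hc => h3 (c * x) (by
        rw [mul_pow, ← hc, pow_two]; rw [mul_comm x⁻¹ y]; group; rw [mul_comm])
      have a2 : ∀ c, x⁻¹ * (x * y) ≠ c ^ 2 := fun c => by rw [inv_mul_cancel_left]; exact h2 c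
      have a3 : ∀ c, y⁻¹ * (x * y) ≠ c ^ 2 := fun c => by rw [mul_comm x y, inv_mul_cancel_left]; exact h1 c
      have b1 : ∀ c, (1:G)⁻¹ * x ≠ c ^ 2 := by simpa using h1
      have b2 : ∀ c, (1:G)⁻¹ * y ≠ c ^ 2 := by simpa using h2
      have b3 : ∀ c, (1:G)⁻¹ * (x * y) ≠ c ^ 2 := by simpa using h3
      intro o o' ho
      match o, o' with
      | none, none => exact absurd rfl ho
      | none, some 0 => exact gl _ R.one_mem
      | none, some 1 => exact gl _ hx
      | none, some 2 => exact gl _ hy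
      | none, some 3 => exact gl _ hxy
      | some 0, none => exact gr _ R.one_mem
      | some 1, none => exact gr _ hx
      | some 2, none => exact gr _ hy
      | some 3, none => exact gr _ hxy
      | some 0, some 0 => exact absurd rfl ho
      | some 1, some 1 => exact absurd rfl ho
      | some 2, some 2 => exact absurd rfl ho
      | some 3, some 3 => exact absurd rfl ho
      | some 0, some 1 => exact b1
      | some 0, some 2 => exact b2
      | some 0, some 3 => exact b3
      | some 1, some 0 => exact sw _ _ b1
      | some 2, some 0 => exact sw _ _ b2
      | some 3, some 0 => exact sw _ _ b3
      | some 1, some 2 => exact a1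
      | some 1, some 3 => exact a2
      | some 2, some 3 => exact a3
      | some 2, some 1 => exact sw _ _ a1
      | some 3, some 1 => exact sw _ _ a2
      | some 3, some 2 => exact sw _ _ a3
    intro o o' hoo
    by_contra hne
    obtain ⟨c, hc⟩ := QuotientGroup.eq.1 hoo
    exact key o o' hne c hc.symm
  have hcard := Nat.card_le_card_of_injective _ this
  rw [Nat.card_eq_fintype_card] at hcard
  simp only [Fintype.card_option, Fintype.card_fin] at hcard
  have : Nat.card (G ⧸ (powMonoidHom 2 : G →* G).range) ≤ 4 := hidx
  omega

theorem index_pow (G : Type*) [CommGroup G] (R : Subgroup G)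
    (h : ∀ g : G, ∃ a ∈ R, ∃ c, g = a * c ^ 2) (n : ℕ) : ∀ g : G, ∃ a ∈ R, ∃ c, g = a * c ^ 2 ^ n := by
  induction n with
  | zero => exact fun g => ⟨1, R.one_mem, g, by simp⟩
  | succ n ih =>
    intro g
    obtain ⟨a, ha, c, rfl⟩ := ih g
    obtain ⟨b, hb, d, rfl⟩ := h c
    refine ⟨a * b ^ 2 ^ n, R.mul_mem ha (R.pow_mem hb _), d, ?_⟩
    rw [mul_pow, ← pow_mul, mul_assoc]
    congr 3
    ring

theorem sigma_zero (D : ℕ) (K : IntermediateField ℚ ℝ) (hK : K = Fld D) (hd : finrank ℚ K = 2)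
    (hmem : Real.sqrt D ∈ K) : ∃ σ : K ≃ₐ[ℚ] K, σ (sqO K D hmem : K) = -(sqO K D hmem : K) := by
  subst hK
  exact Fld_sigma D hd

theorem nr_aux (q l t : ℕ) [Fact q.Prime] [Fact l.Prime] [Fact t.Prime] (lm : legendreSym l (-1) = 1)
    (lt : legendreSym l t = 1) (l2 : legendreSym l 2 = -1) (hne : l ≠ q)
    (D : ℕ) (hD : D = q * (l * t) ∨ D = 2 * (q * (l * t))) (d : ℤ) (hd : legendreSym l d = -1) :
    ¬ QRep D d := by
  intro hrep
  have key : ∀ D1 : ℤ, (D : ℤ) = l * D1 → ¬ (l : ℤ) ∣ D1 → False := fun D1 hD1 hn => by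
    rw [hD1] at hrep
    exact rep_neg l lm D1 _ hn hd hrep
  have hq0 : legendreSym l q ≠ 0 := by
    intro h0
    have := (legendreSym.eq_zero_iff l q).1 h0
    rw [ZMod.intCast_zmod_eq_zero_iff_dvd] at this
    exact hne ((Nat.prime_dvd_prime_iff_eq (Fact.out : l.Prime) (Fact.out : q.Prime)).1 (by exact_mod_cast this))
  rcases hD with rfl | rfl
  · refine key (q * t) (by push_cast; ring) (leg_not_dvd l _ ?_)
    rw [legendreSym.mul, lt]; simpa using hq0
  · refine key (2 * (q * t)) (by push_cast; ring) (leg_not_dvd l _ ?_)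
    rw [legendreSym.mul, legendreSym.mul, lt, l2]; simpa using hq0

theorem surj_all {q r s : ℕ} [Fact q.Prime] [Fact r.Prime] [Fact s.Prime] (e : ℤ) (H : LegData q r s e)
    (D : ℕ) (hD : D = q * (r * s) ∨ D = 2 * (q * (r * s)))
    (h4 : Nat.card {x : ClassGroup (𝓞 (layer (Fld D) 0)) // x ^ 2 = 1} ≤ 4) (n : ℕ) :
    Function.Surjective (clNorm (layer (Fld D) 0) (layer (Fld D) n)) := by
  have hq := (Fact.out : q.Prime)
  have hr := (Fact.out : r.Prime)
  have hs := (Fact.out : s.Prime)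
  have r8 := H.r8
  have s8 := H.s8
  have hR0 := (layer_ram D _ 0 H.mod hD).1
  have hRn := (layer_ram D _ n H.mod hD).1
  have hD0 : 0 < D := by
    have := Nat.mul_pos hq.pos (Nat.mul_pos hr.pos hs.pos)
    omega
  obtain ⟨σ, hσ⟩ := sigma_zero D (layer (Fld D) 0) (layer_zero _) (by rw [hR0]; norm_num) (sqrt_mem_layer D 0)
  have hfin : finrank (layer (Fld D) 0) (layer (Fld D) n) = 2 ^ n := by
    have h := finrank_mul_finrank ℚ (layer (Fld D) 0) (layer (Fld D) n)
    rw [hR0, hRn, pow_succ] at h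
    omega
  have ideals : ∀ (c d : ℕ), c.Coprime r → d.Coprime s → legendreSym r c * legendreSym s d = -1 →
      ∃ J : Ideal (𝓞 (layer (Fld D) 0)), J ≠ ⊥ ∧ icl J ∈ (clNorm (layer (Fld D) 0) (layer (Fld D) n)).range ∧
        legendreSym r (Ideal.absNorm J) = legendreSym r c ∧ legendreSym s (Ideal.absNorm J) = legendreSym s d := by
    intro c d hc hd hcd
    obtain ⟨p, hpF, p1, p2, p3, p4, p5, p6⟩ := dir_prime e H n c d hc hd hcd D hD
    have hex : ∃ a : ℤ, legendreSym p a = -1 := by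
      have hc' : legendreSym r c = 1 ∨ legendreSym r c = -1 := by
        apply legendreSym.eq_one_or_neg_one
        intro h0
        rw [(legendreSym.eq_zero_iff r c).2 h0] at hcd
        norm_num at hcd
      rcases hc' with h | h
      · exact ⟨s, by rw [p5]; rw [h, one_mul] at hcd; exact hcd⟩
      · exact ⟨r, by rw [p4, h]⟩
    obtain ⟨a, ha⟩ := hex
    obtain ⟨I, hI⟩ := layer_deg_one D _ H.mod hD n p p1 a ha p6
    have hI0 : I ≠ ⊥ := by
      rintro rfl
      rw [Ideal.absNorm_bot] at hI
      exact hpF.out.ne_zero hI.symm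
    have hN : Ideal.absNorm (Ideal.relNorm (𝓞 (layer (Fld D) 0)) I) = p := by
      rw [Ideal.absNorm_relNorm, hI]
    refine ⟨Ideal.relNorm (𝓞 (layer (Fld D) 0)) I, fun h => hI0 (Ideal.relNorm_eq_bot_iff.1 h),
      ⟨icl I, clNorm_icl _ _ hI0⟩, ?_, ?_⟩
    · rw [hN, p2]
    · rw [hN, p3]
  have hodd2 : ∀ l : ℕ, l % 8 = 5 → (2 : ℕ).Coprime l := fun l hl =>
    Nat.coprime_two_left.2 (Nat.odd_iff.2 (by omega))
  obtain ⟨J1, a1, a2, a3, a4⟩ := ideals 2 1 (hodd2 r r8) (Nat.coprime_one_left _) (by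
    have := H.r2
    push_cast; rw [this]; simp)
  obtain ⟨J2, b1, b2, b3, b4⟩ := ideals 1 2 (Nat.coprime_one_left _) (hodd2 s s8) (by
    have := H.s2
    push_cast; rw [this]; simp)
  have nr : ∀ J : Ideal (𝓞 (layer (Fld D) 0)), J ≠ ⊥ →
      (legendreSym r (Ideal.absNorm J) = -1 ∨ legendreSym s (Ideal.absNorm J) = -1) → ∀ c, icl J ≠ c ^ 2 := by
    intro J hJ hl c hc
    have hrep := rep_of_sq (by rw [hR0]; norm_num) σ (sqO _ D (sqrt_mem_layer D 0)) D hD0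
      (sqO_sq _ _ _) hσ J hJ c hc
    rcases hl with h | h
    · exact nr_aux q r s H.rm H.rs H.r2 (by rintro rfl; have := H.q4; omega) D hD _ h hrep
    · exact nr_aux q s r H.sm H.sr H.s2 (by rintro rfl; have := H.q4; omega) D
        (by rw [mul_comm s r]; exact hD) _ h hrep
  have n1 : legendreSym r (Ideal.absNorm J1) = -1 := by rw [a3]; exact H.r2
  have n2 : legendreSym s (Ideal.absNorm J2) = -1 := by rw [b4]; exact H.s2
  have n3 : legendreSym r (Ideal.absNorm (J1 * J2)) = -1 := by
    rw [map_mul, Nat.cast_mul, legendreSym.mul, n1, b3]; simp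
  have hall := index_pow _ _ (index_sq4 _ h4 _ (icl J1) (icl J2) a2 b2 (nr J1 a1 (Or.inl n1)) (nr J2 b1 (Or.inr n2))
    (by rw [← icl_mul a1 b1]; exact nr _ (mul_ne_zero a1 b1) (Or.inl n3))) n
  intro g
  obtain ⟨a, ⟨a', rfl⟩, c, rfl⟩ := hall g
  refine ⟨a' * clExt _ _ c, ?_⟩
  rw [map_mul, clNorm_clExt, hfin]

end

section

open NumberField Module IntermediateField
open scoped nonZeroDivisors

theorem exists_fund (D : ℕ) (hD : D % 4 = 3 ∨ D % 4 = 2) : ∃ γ γ' : ℤ, 1 < γ ∧ 0 < γ' ∧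
    γ ^ 2 - (D : ℤ) * γ' ^ 2 = 1 ∧ ∀ a b : ℤ, 0 < a → 0 < b → a ^ 2 - (D : ℤ) * b ^ 2 = 1 → γ ≤ a := by
  have hns : ¬ IsSquare (D : ℤ) := by
    rintro ⟨t, ht⟩
    have h1 : t * t % 4 = 0 ∨ t * t % 4 = 1 := by
      rcases Int.even_or_odd' t with ⟨k, rfl | rfl⟩
      · left; ring_nf; omega
      · right; ring_nf; omega
    omega
  have hex : ∃ n : ℕ, ∃ b : ℤ, 0 < n ∧ 0 < b ∧ (n : ℤ) ^ 2 - (D : ℤ) * b ^ 2 = 1 := by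
    obtain ⟨x, y, hxy, hy⟩ := Pell.exists_of_not_isSquare (by omega : (0:ℤ) < D) hns
    refine ⟨x.natAbs, |y|, ?_, abs_pos.2 hy, ?_⟩
    · rw [Int.natAbs_pos]
      rintro rfl
      have : (0:ℤ) ≤ D * y ^ 2 := by positivity
      nlinarith
    · rw [sq_abs, Int.natCast_natAbs, sq_abs]; exact hxy
  classical
  obtain ⟨b, h1, h2, h3⟩ := Nat.find_spec hex
  refine ⟨(Nat.find hex : ℕ), b, ?_, h2, h3, fun a c ha hc hac => ?_⟩
  · by_contra hlt
    have h0 : ((Nat.find hex : ℕ) : ℤ) = 1 := by omega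
    rw [h0] at h3
    have : (0:ℤ) < D * b ^ 2 := mul_pos (by omega) (by positivity)
    nlinarith
  · have := Nat.find_min' hex (m := a.natAbs) ⟨c, Int.natAbs_pos.2 ha.ne', hc, by
      rw [Int.natCast_natAbs, sq_abs]; exact hac⟩
    omega

theorem main_thm {q r s : ℕ} [Fact q.Prime] [Fact r.Prime] [Fact s.Prime] (e : ℤ) (H : LegData q r s e)
    (D D' : ℕ) (hcase : (e = 1 ∧ D = q * (r * s) ∧ D' = 2 * (q * (r * s))) ∨
      (e = -1 ∧ D = 2 * (q * (r * s)) ∧ D' = q * (r * s)))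
    (hsq : SqU (layer (Fld D) 0) r ∨ SqU (layer (Fld D) 0) s) (m : ℕ)
    (hc : 2 ^ ((Nat.card (ClassGroup (𝓞 (layer (Fld D) 0)))).factorization 2) = 2 ^ (m+1)) (n : ℕ)
    (P : Sylow 2 (ClassGroup (𝓞 (layer (Fld D) n)))) :
    Nonempty (P ≃* Multiplicative (ZMod 2 × ZMod (2 ^ m))) := by
  have hq := (Fact.out : q.Prime).ne_zero
  have hr := (Fact.out : r.Prime).ne_zero
  have hs := (Fact.out : s.Prime).ne_zero
  have hmod := H.mod
  have hD : D = q * (r * s) ∨ D = 2 * (q * (r * s)) := by tauto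
  have hD' : D' = q * (r * s) ∨ D' = 2 * (q * (r * s)) := by tauto
  have hDD : (D = q * (r * s) ∧ D' = 2 * (q * (r * s))) ∨ (D = 2 * (q * (r * s)) ∧ D' = q * (r * s)) := by tauto
  have hR0 : finrank ℚ (layer (Fld D) 0) = 2 := by rw [(layer_ram D _ 0 hmod hD).1]; norm_num
  have hR' : finrank ℚ (Fld D') = 2 := by
    have := (layer_ram D' _ 0 hmod hD').1
    rw [layer_zero] at this
    rw [this]; norm_num
  obtain ⟨σ, hσ⟩ := sigma_zero D (layer (Fld D) 0) (layer_zero _) hR0 (sqrt_mem_layer D 0)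
  obtain ⟨h4, hp⟩ := F_main hR0 σ e H D hD (sqO _ D (sqrt_mem_layer D 0)) (sqO_sq _ _ _) hσ hsq
  have hS := surj_all e H D hD h4
  -- the companion field
  have hq' : (e = -1 ∧ D' = q * (r * s) ∧ SqU (Fld D') (2 * q)) ∨
      (e = 1 ∧ D' = 2 * (q * (r * s)) ∧ SqU (Fld D') q) := by
    obtain ⟨γ, γ', g1, g2, g3, g4⟩ := exists_fund D' (by omega)
    have hθ := sqO_sq (Fld D') D' (sqrt_mem_Fld D')
    rcases hcase with ⟨rfl, -, rfl⟩ | ⟨rfl, -, rfl⟩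
    · right
      refine ⟨rfl, rfl, ?_⟩
      obtain ⟨k, hk, hk'⟩ := pell_G1 H γ γ' g1 g2 g3 g4
      exact squ_pell _ hθ γ γ' k hk g3 hk'
    · left
      refine ⟨rfl, rfl, ?_⟩
      obtain ⟨k, hk, hk'⟩ := pell_G2 H γ γ' g1 g2 g3 g4
      exact squ_pell _ hθ γ γ' k hk g3 (by push_cast; exact hk')
  obtain ⟨τ, hτ⟩ := Fld_sigma D' hR'
  have hF' := F'_main hR' τ e H D' hq' (sqO _ D' (sqrt_mem_Fld D')) (sqO_sq _ _ _) hτ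
  -- squares in the first layer
  have hcL : Real.sqrt (2:ℕ) ∈ layer (Fld D) 1 := by rw [← cc_one]; exact cc_mem_layer _ _
  have hθL : Real.sqrt D ∈ layer (Fld D) 1 := sqrt_mem_layer D 1
  have hpos : 0 < q * (r * s) := Nat.pos_of_ne_zero (by positivity)
  have hθ'L : Real.sqrt D' ∈ layer (Fld D) 1 := by
    rcases hDD with ⟨h, h'⟩ | ⟨h, h'⟩
    · rw [h', ← h, Nat.cast_mul, Real.sqrt_mul (Nat.cast_nonneg _)]
      exact mul_mem hcL hθL
    · have : Real.sqrt D' = Real.sqrt D / Real.sqrt (2:ℕ) := by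
        rw [h', h, Nat.cast_mul 2, Real.sqrt_mul (Nat.cast_nonneg _)]
        field_simp
      rw [this]
      exact div_mem hθL hcL
  haveI f1 : Fact (Fld D' ≤ layer (Fld D) 1) := ⟨by
    rw [adjoin_le_iff, Set.singleton_subset_iff]; exact hθ'L⟩
  have s2 : SqU (layer (Fld D) 1) 2 := squ_theta _ (sqO_sq _ 2 hcL)
  have sD : SqU (layer (Fld D) 1) D := squ_theta _ (sqO_sq _ D hθL)
  have sq : SqU (layer (Fld D) 1) q := by
    rcases hq' with ⟨-, -, h⟩ | ⟨-, -, h⟩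
    · have h' : SqU (layer (Fld D) 1) (2 * q) := squ_map h
      rw [mul_comm] at h'
      exact squ_cancel two_ne_zero h' s2
    · exact squ_map h
  have sD1 : SqU (layer (Fld D) 1) (q * (r * s)) := by
    rcases hD with h | h
    · rw [← h]; exact sD
    · refine squ_cancel two_ne_zero ?_ s2
      rw [mul_comm, ← h]; exact sD
  have srs : SqU (layer (Fld D) 1) (r * s) := by
    rw [mul_comm] at sD1
    exact squ_cancel hq sD1 sq
  have hboth : SqU (layer (Fld D) 1) r ∧ SqU (layer (Fld D) 1) s := by
    rcases hsq with h | h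
    · have h' : SqU (layer (Fld D) 1) r := squ_map h
      rw [mul_comm] at srs
      exact ⟨h', squ_cancel hr srs h'⟩
    · have h' : SqU (layer (Fld D) 1) s := squ_map h
      exact ⟨squ_cancel hs srs h', h'⟩
  have hJ := J_base D D' _ r s hmod hDD hr hs hboth.1 hboth.2 hF' (hS 1)
  exact layer_final D _ hmod hD hS hJ m hc h4 hp n P

end

theorem statement_0 (η q r s : ℕ) [Fact q.Prime] [Fact r.Prime] [Fact s.Prime]
    (hη : η = 1 ∨ η = 2)
    (hq4 : q % 4 = 3) (hr8 : r % 8 = 5) (hs8 : s % 8 = 5)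
    (hqr : legendreSym r q = (-1) ^ (if η = 2 then 1 else 0))
    (hqs : legendreSym s q = (-1) ^ (if η = 2 then 1 else 0))
    (hrs : legendreSym s r = 1)
    (hNegPell : ¬ ∃ x y : ℤ, x ^ 2 - (r * s : ℕ) * y ^ 2 = -1)
    (γ γ' : ℤ) (hγ : 0 < γ) (hγ' : 0 < γ')
    (hPell : γ ^ 2 - (η * q * r * s : ℕ) * γ' ^ 2 = 1)
    (hfund : ∀ a b : ℤ, 0 < a → 0 < b → a ^ 2 - (η * q * r * s : ℕ) * b ^ 2 = 1 → γ ≤ a)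
    (hnsq : ¬ ∃ t : ℤ, 2 ^ (if η = 1 then 1 else 0) * (q : ℤ) * (γ - 1) = t ^ 2)
    (m : ℕ)
    (hm : h2 (IntermediateField.adjoin ℚ {Real.sqrt (η * q * r * s : ℕ)}) = 2 ^ (m + 1)) :
    ∀ n : ℕ,
      ∀ P : Sylow 2 (ClassGroup (NumberField.RingOfIntegers
        (layer (IntermediateField.adjoin ℚ {Real.sqrt (η * q * r * s : ℕ)}) n))),
      Nonempty (P ≃* Multiplicative (ZMod 2 × ZMod (2 ^ m))) := by
  have hpos : 0 < η * q * r * s := by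
    have h1 := (Fact.out : q.Prime).pos
    have h2 := (Fact.out : r.Prime).pos
    have h3 := (Fact.out : s.Prime).pos
    have h4 : 0 < η := by omega
    positivity
  have hγ1 : 1 < γ := by
    by_contra hlt
    have h0 : γ = 1 := by omega
    rw [h0] at hPell
    have : (0:ℤ) < (η * q * r * s : ℕ) * γ' ^ 2 := mul_pos (by exact_mod_cast hpos) (by positivity)
    linarith
  intro n P
  have hm' : 2 ^ ((Nat.card (ClassGroup (𝓞 (layer (Fld (η * q * r * s)) 0)))).factorization 2) = 2 ^ (m+1) := by
    rw [layer_zero]; exact hm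
  clear hm hNegPell
  rcases hη with rfl | rfl
  · have hE : 1 * q * r * s = q * (r * s) := by ring
    generalize 1 * q * r * s = D at *
    have H := legData q r s 1 hq4 hr8 hs8 (by simpa using hqr) (by simpa using hqs) hrs
    subst hE
    refine main_thm 1 H (q * (r * s)) _ (Or.inl ⟨rfl, rfl, rfl⟩) ?_ m hm' n P
    have hθ := sqO_sq (layer (Fld (q * (r * s))) 0) _ (sqrt_mem_layer _ 0)
    obtain ⟨k, hk, h | h⟩ := pell_F1 H γ γ' hγ1 hγ' hPell hfund (by simpa using hnsq)
    · exact Or.inl (squ_pell _ hθ γ γ' k hk hPell h)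
    · exact Or.inr (squ_pell _ hθ γ γ' k hk hPell h)
  · have hE : 2 * q * r * s = 2 * (q * (r * s)) := by ring
    generalize 2 * q * r * s = D at *
    have H := legData q r s (-1) hq4 hr8 hs8 (by simpa using hqr) (by simpa using hqs) hrs
    subst hE
    refine main_thm (-1) H (2 * (q * (r * s))) _ (Or.inr ⟨rfl, rfl, rfl⟩) ?_ m hm' n P
    have hθ := sqO_sq (layer (Fld (2 * (q * (r * s)))) 0) _ (sqrt_mem_layer _ 0)
    obtain ⟨k, hk, h | h⟩ := pell_F2 H γ γ' hγ1 hγ' hPell hfund (by simpa using hnsq)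
    · exact Or.inl (squ_pell _ hθ γ γ' k hk hPell h)
    · exact Or.inr (squ_pell _ hθ γ γ' k hk hPell h)
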